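/- (Pourchet's Theorem) Every polynomial f ∈ ℚ[x] such that f(t) > 0 for all t ∈ ℝ can be written as f = f₁² + f₂² + f₃² + f₄² + f₅² with f₁, f₂, f₃, f₄, f₅ ∈ ℚ[x]. -/

import Mathlib

section
open Polynomial

theorem pr_sum_sq_eq_zero {ι : Type*} [Fintype ι] {k : Type*} [Field k] (φ : k →+* ℝ) (r : ι → k)
    (h : ∑ i, r i ^ 2 = 0) : ∀ i, r i = 0 := by
  have h1 : ∑ i, (φ (r i)) ^ 2 = 0 := by
    have := congrArg φ h
    simpa using this
  intro i
  have h2 := (Finset.sum_eq_zero_iff_of_nonneg (fun i _ => sq_nonneg (φ (r i)))).1 h1 i (Finset.mem_univ i)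
  have h3 : φ (r i) = 0 := by simpa using h2
  exact (map_eq_zero φ).1 h3

/-- degree of a diagonal form in polynomials -/
theorem pr_diag_degree {ι : Type*} [Fintype ι] {k : Type*} [Field k] (c : ι → k)
    (haniso : ∀ v : ι → k, ∑ i, c i * v i ^ 2 = 0 → ∀ i, v i = 0) (v : ι → k[X]) (d : ℕ)
    (hd : ∀ i, (v i).natDegree ≤ d) (i : ι) (hi : (v i).natDegree = d) (hi0 : v i ≠ 0) :
    (∑ i, C (c i) * v i ^ 2).natDegree = 2 * d ∧
      (∑ i, C (c i) * v i ^ 2).coeff (2 * d) = ∑ i, c i * (v i).coeff d ^ 2 ∧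
      (∑ i, C (c i) * v i ^ 2) ≠ 0 := by
  have h1 : (∑ i, C (c i) * v i ^ 2).coeff (2 * d) = ∑ i, c i * (v i).coeff d ^ 2 := by
    rw [finsetSum_coeff]
    refine Finset.sum_congr rfl fun j _ => ?_
    rw [coeff_C_mul, coeff_pow_of_natDegree_le (hd j)]
  have h2 : (∑ i, C (c i) * v i ^ 2).coeff (2 * d) ≠ 0 := by
    rw [h1]
    intro h0
    have := haniso _ h0 i
    rw [← hi] at this
    exact hi0 (leadingCoeff_eq_zero.1 this)
  refine ⟨le_antisymm ?_ (le_natDegree_of_ne_zero h2), h1, fun h => h2 (by rw [h]; simp)⟩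
  refine natDegree_sum_le_of_forall_le _ _ fun j _ => ?_
  refine (natDegree_C_mul_le _ _).trans ?_
  refine natDegree_pow_le.trans ?_
  exact Nat.mul_le_mul_left _ (hd j)

theorem pr_exists_max {ι : Type*} [Fintype ι] {k : Type*} [Field k] (v : ι → k[X])
    (hv : ∃ i, v i ≠ 0) : ∃ i, v i ≠ 0 ∧ ∀ j, (v j).natDegree ≤ (v i).natDegree := by
  classical
  obtain ⟨i0, h0⟩ := hv
  obtain ⟨i, hi, hmax⟩ := Finset.exists_max_image (Finset.univ.filter fun i => v i ≠ 0)
    (fun i => (v i).natDegree) ⟨i0, by simp [h0]⟩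
  simp only [Finset.mem_filter, Finset.mem_univ, true_and] at hi hmax
  refine ⟨i, hi, fun j => ?_⟩
  by_cases hj : v j = 0
  · simp [hj]
  · exact hmax j hj

theorem pr_cassels (f : ℚ[X]) : ∀ (n : ℕ) (b : ℚ[X]) (a : Fin 5 → ℚ[X]), b.natDegree = n → b ≠ 0 →
    f * b ^ 2 = ∑ i, a i ^ 2 → ∃ g : Fin 5 → ℚ[X], f = ∑ i, g i ^ 2 := by
  intro n
  induction n using Nat.strong_induction_on with
  | _ n ih =>
  intro b a hn hb h
  set q : Fin 5 → ℚ[X] := fun i => a i / b with hq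
  set r : Fin 5 → ℚ[X] := fun i => a i % b with hr
  have hqr : ∀ i, a i = b * q i + r i := fun i => (EuclideanDomain.div_add_mod (a i) b).symm
  by_cases hall : ∀ i, r i = 0
  · refine ⟨q, ?_⟩
    have : f * b ^ 2 = (∑ i, q i ^ 2) * b ^ 2 := by
      rw [h, Finset.sum_mul]
      refine Finset.sum_congr rfl fun i _ => ?_
      rw [hqr i, hall i]; ring
    exact mul_right_cancel₀ (pow_ne_zero 2 hb) this
  · push Not at hall
    obtain ⟨i, hi0, himax⟩ := pr_exists_max r hall
    have haniso : ∀ v : Fin 5 → ℚ, ∑ i, (1:ℚ) * v i ^ 2 = 0 → ∀ i, v i = 0 := by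
      intro v hv
      exact pr_sum_sq_eq_zero (algebraMap ℚ ℝ) v (by simpa using hv)
    obtain ⟨hdeg, -, hne⟩ := pr_diag_degree (fun _ : Fin 5 => (1:ℚ)) haniso r _ himax i rfl hi0
    simp only [map_one, one_mul] at hdeg hne
    set A : ℚ[X] := ∑ i, q i ^ 2 - f with hA
    set B : ℚ[X] := ∑ i, a i * q i - f * b with hB
    set b' : ℚ[X] := A * b - 2 * B with hb'
    have hbb : b * b' = ∑ i, r i ^ 2 := by
      have : ∀ i, r i ^ 2 = b ^ 2 * q i ^ 2 - 2 * b * (a i * q i) + a i ^ 2 := by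
        intro i
        have : r i = a i - b * q i := by rw [hqr i]; ring
        rw [this]; ring
      simp only [this, Finset.sum_add_distrib, Finset.sum_sub_distrib, ← Finset.mul_sum, ← h]
      rw [hb', hA, hB]; ring
    have hb'0 : b' ≠ 0 := by
      rintro h0; rw [h0, mul_zero] at hbb; exact hne hbb.symm
    have hri : (r i).natDegree < b.natDegree := by
      refine natDegree_lt_natDegree hi0 ?_
      exact EuclideanDomain.mod_lt (a i) hb
    have hdb' : b'.natDegree < n := by
      have := congrArg natDegree hbb
      rw [natDegree_mul hb hb'0, hdeg] at this
      omega
    refine ih _ hdb' b' (fun i => A * a i - 2 * B * q i) rfl hb'0 ?_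
    have : ∀ i, (A * a i - 2 * B * q i) ^ 2
        = A ^ 2 * a i ^ 2 - 4 * A * B * (a i * q i) + 4 * B ^ 2 * q i ^ 2 := by
      intro i; ring
    simp only [this, Finset.sum_add_distrib, Finset.sum_sub_distrib, ← Finset.mul_sum, ← h]
    have h1 : ∑ i, a i * q i = B + f * b := by rw [hB]; ring
    have h2 : ∑ i, q i ^ 2 = A + f := by rw [hA]; ring
    rw [h1, h2, hb']; ring

theorem pr_springer {ι : Type*} [Fintype ι] {k : Type*} [Field k] (c : ι → k)
    (haniso : ∀ v : ι → k, ∑ i, c i * v i ^ 2 = 0 → ∀ i, v i = 0) :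
    ∀ (n : ℕ) (p : k[X]), p.natDegree = n → Irreducible p → Odd n →
    ∀ v : ι → k[X], p ∣ ∑ i, C (c i) * v i ^ 2 → ∀ i, p ∣ v i := by
  classical
  intro n
  induction n using Nat.strong_induction_on with
  | _ n ih =>
  intro p hpn hp hodd
  -- reduced version
  have key : ∀ (d : ℕ) (v : ι → k[X]) , (∀ i, (v i).natDegree ≤ d) → d < n →
      p ∣ ∑ i, C (c i) * v i ^ 2 → ∀ i, v i = 0 := by
    intro d
    induction d using Nat.strong_induction_on with
    | _ d ihd =>
    intro v hvd hdn hdvd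
    by_contra hcon
    push Not at hcon
    obtain ⟨i, hi0, himax⟩ := pr_exists_max v hcon
    obtain ⟨hdeg, -, hne⟩ := pr_diag_degree c haniso v _ himax i rfl hi0
    obtain ⟨r, hr⟩ := hdvd
    have hr0 : r ≠ 0 := by rintro rfl; rw [mul_zero] at hr; exact hne hr
    have hdr : 2 * (v i).natDegree = n + r.natDegree := by
      rw [← hdeg, hr, natDegree_mul hp.ne_zero hr0, hpn]
    have hid := hvd i
    have hrodd : Odd r.natDegree := by
      obtain ⟨t, ht⟩ := hodd
      exact ⟨(v i).natDegree - t - 1, by omega⟩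
    -- odd-degree irreducible factor
    have hfac : ∀ (m : ℕ) (r : k[X]), r.natDegree = m → Odd m →
        ∃ p1, Irreducible p1 ∧ p1 ∣ r ∧ Odd p1.natDegree := by
      intro m
      induction m using Nat.strong_induction_on with
      | _ m ihm =>
      intro r hrm hm
      have hr0 : r ≠ 0 := by rintro rfl; simp at hrm; subst hrm; simp at hm
      have hru : ¬ IsUnit r := by
        intro hu
        have := natDegree_eq_zero_of_isUnit hu
        rw [hrm] at this; subst this; simp at hm
      obtain ⟨p1, hp1, s, hs⟩ := WfDvdMonoid.exists_irreducible_factor hru hr0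
      by_cases ho : Odd p1.natDegree
      · exact ⟨p1, hp1, ⟨s, hs⟩, ho⟩
      · have hs0 : s ≠ 0 := by rintro rfl; simp at hs; exact hr0 hs
        have hds : m = p1.natDegree + s.natDegree := by
          rw [← hrm, hs, natDegree_mul hp1.ne_zero hs0]
        have hp1pos := hp1.natDegree_pos
        obtain ⟨p2, h1, h2, h3⟩ := ihm s.natDegree (by omega) s rfl (by
          rw [hds, Nat.odd_add] at hm
          by_contra h
          exact ho (hm.2 (Nat.not_odd_iff_even.1 h)))
        exact ⟨p2, h1, h2.trans ⟨p1, by rw [hs]; ring⟩, h3⟩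
    obtain ⟨p1, hp1, hp1r, hp1o⟩ := hfac _ r rfl hrodd
    have hp1d : p1.natDegree ≤ r.natDegree := natDegree_le_of_dvd hp1r hr0
    have hlt : p1.natDegree < n := by omega
    have hall := ih _ hlt p1 rfl hp1 hp1o v (hr ▸ hp1r.mul_left p)
    choose w hw using hall
    have hwi0 : w i ≠ 0 := by intro h; apply hi0; rw [hw i, h, mul_zero]
    have hp1pos := hp1.natDegree_pos
    have hwd : ∀ j, (w j).natDegree ≤ (v i).natDegree - p1.natDegree := by
      intro j
      by_cases hj : w j = 0
      · simp [hj]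
      · have := himax j
        rw [hw j, natDegree_mul hp1.ne_zero hj] at this
        omega
    have hvid : p1.natDegree ≤ (v i).natDegree := by
      rw [hw i, natDegree_mul hp1.ne_zero hwi0]; omega
    refine hwi0 (ihd _ (by omega) w hwd (by omega) ?_ i)
    have hsum : ∑ i, C (c i) * v i ^ 2 = p1 ^ 2 * ∑ i, C (c i) * w i ^ 2 := by
      rw [Finset.mul_sum]
      refine Finset.sum_congr rfl fun j _ => ?_
      conv_lhs => rw [hw j]
      ring
    have hpd : p ∣ p1 ^ 2 * ∑ i, C (c i) * w i ^ 2 := by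
      rw [← hsum, hr]; exact dvd_mul_right _ _
    rcases hp.prime.dvd_or_dvd hpd with h | h
    · have := natDegree_le_of_dvd (hp.prime.dvd_of_dvd_pow h) hp1.ne_zero
      omega
    · exact h
  intro v hv i
  have hnpos : 0 < n := hodd.pos
  have h1 := key (n - 1) (fun i => v i % p) (fun j => by
      have := natDegree_mod_lt (v j) (q := p) (by omega)
      omega) (by omega) (by
      have : (∑ i, C (c i) * (v i % p) ^ 2) = ∑ i, C (c i) * v i ^ 2 -
          p * ∑ i, C (c i) * ((v i / p) * (v i + v i % p)) := by
        rw [Finset.mul_sum, ← Finset.sum_sub_distrib]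
        refine Finset.sum_congr rfl fun j _ => ?_
        have h2 : v j = p * (v j / p) + v j % p := (EuclideanDomain.div_add_mod (v j) p).symm
        generalize v j % p = R at *
        generalize v j / p = Q at *
        rw [h2]; ring
      rw [this]
      exact dvd_sub hv (dvd_mul_right _ _)) i
  exact (EuclideanDomain.mod_eq_zero).1 h1
end

section
open Polynomial
set_option linter.all false

theorem pr_odd_factor {k : Type*} [Field k] : ∀ (m : ℕ) (r : k[X]), r.natDegree = m → Odd m →
        ∃ p1, Irreducible p1 ∧ p1 ∣ r ∧ Odd p1.natDegree := by
  intro m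
  induction m using Nat.strong_induction_on with
  | _ m ihm =>
  intro r hrm hm
  have hr0 : r ≠ 0 := by rintro rfl; simp at hrm; subst hrm; simp at hm
  have hru : ¬ IsUnit r := by
    intro hu
    have := natDegree_eq_zero_of_isUnit hu
    rw [hrm] at this; subst this; simp at hm
  obtain ⟨p1, hp1, s, hs⟩ := WfDvdMonoid.exists_irreducible_factor hru hr0
  by_cases ho : Odd p1.natDegree
  · exact ⟨p1, hp1, ⟨s, hs⟩, ho⟩
  · have hs0 : s ≠ 0 := by rintro rfl; simp at hs; exact hr0 hs
    have hds : m = p1.natDegree + s.natDegree := by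
      rw [← hrm, hs, natDegree_mul hp1.ne_zero hs0]
    have hp1pos := hp1.natDegree_pos
    obtain ⟨p2, h1, h2, h3⟩ := ihm s.natDegree (by omega) s rfl (by
      rw [hds, Nat.odd_add] at hm
      by_contra h
      exact ho (hm.2 (Nat.not_odd_iff_even.1 h)))
    exact ⟨p2, h1, h2.trans ⟨p1, by rw [hs]; ring⟩, h3⟩

theorem pr_descent (F₀ : Type) [Field F₀] [NumberField F₀] (hodd : Odd (Module.finrank ℚ F₀))
    (f : ℚ[X]) (b : F₀[X]) (a : Fin 5 → F₀[X]) (hb : b ≠ 0)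
    (h : f.map (algebraMap ℚ F₀) * b ^ 2 = ∑ i, a i ^ 2) :
    ∃ (b' : ℚ[X]) (a' : Fin 5 → ℚ[X]), b' ≠ 0 ∧ f * b' ^ 2 = ∑ i, a' i ^ 2 := by
  classical
  by_contra hcon
  push Not at hcon
  let k := RatFunc ℚ
  let c : Option (Fin 5) → k := fun o => o.elim (-(algebraMap ℚ[X] k f)) (fun _ => 1)
  have hinj : Function.Injective (algebraMap ℚ[X] k) := IsFractionRing.injective ℚ[X] k
  have haniso : ∀ v : Option (Fin 5) → k, ∑ i, c i * v i ^ 2 = 0 → ∀ i, v i = 0 := by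
    intro v hv
    obtain ⟨d, hd⟩ := IsLocalization.exist_integer_multiples_of_finite (nonZeroDivisors ℚ[X]) v
    choose w hw using hd
    have hd0 : (d : ℚ[X]) ≠ 0 := nonZeroDivisors.ne_zero d.2
    have hdk : algebraMap ℚ[X] k d ≠ 0 := fun h => hd0 (hinj (by rw [h, map_zero]))
    have hw' : ∀ i, algebraMap ℚ[X] k (w i) = algebraMap ℚ[X] k d * v i := by
      intro i; rw [hw i, Algebra.smul_def]
    have h1 : f * w none ^ 2 = ∑ i, w (some i) ^ 2 := by
      apply hinj
      simp only [map_mul, map_pow, map_sum, hw', mul_pow]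
      rw [Fintype.sum_option] at hv
      simp only [c, Option.elim, one_mul] at hv
      rw [← Finset.mul_sum]
      have : ∑ i, v (some i) ^ 2 = algebraMap ℚ[X] k f * v none ^ 2 := by
        linear_combination hv
      rw [this]; ring
    have hn : w none = 0 := by
      by_contra hne
      exact hcon (w none) (fun i => w (some i)) hne h1
    have hs : ∀ i, w (some i) = 0 := by
      by_contra hne
      push Not at hne
      obtain ⟨i, hi0, himax⟩ := pr_exists_max (fun i => w (some i)) hne
      have han : ∀ v : Fin 5 → ℚ, ∑ i, (1:ℚ) * v i ^ 2 = 0 → ∀ i, v i = 0 := by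
        intro v hv
        exact pr_sum_sq_eq_zero (algebraMap ℚ ℝ) v (by simpa using hv)
      obtain ⟨-, -, h2⟩ := pr_diag_degree (fun _ : Fin 5 => (1:ℚ)) han _ _ himax i rfl hi0
      apply h2
      simp only [map_one, one_mul]
      rw [← h1, hn]; ring
    have hall : ∀ i, w i = 0 := by
      intro i; cases i with
      | none => exact hn
      | some i => exact hs i
    intro i
    have := hw' i
    rw [hall i, map_zero] at this
    rcases mul_eq_zero.1 this.symm with h | h
    · exact absurd h hdk
    · exact h
  let pb := Field.powerBasisOfFiniteOfSeparable ℚ F₀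
  have hpbdeg : (minpoly ℚ pb.gen).natDegree = Module.finrank ℚ F₀ := by
    rw [pb.natDegree_minpoly, pb.finrank]
  obtain ⟨p, hp, hpdvd, hpodd⟩ := pr_odd_factor _ ((minpoly ℚ pb.gen).map (algebraMap ℚ k)) rfl
    (by rw [natDegree_map, hpbdeg]; exact hodd)
  haveI : Fact (Irreducible p) := ⟨hp⟩
  let ψ : F₀ →ₐ[ℚ] AdjoinRoot p := pb.lift (AdjoinRoot.root p) (by
    obtain ⟨s, hs⟩ := hpdvd
    have h1 : aeval (AdjoinRoot.root p) ((minpoly ℚ pb.gen).map (algebraMap ℚ k)) = 0 := by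
      rw [hs, map_mul, AdjoinRoot.aeval_eq, AdjoinRoot.mk_self, zero_mul]
    rwa [aeval_map_algebraMap] at h1)
  let Ψ : F₀[X] →+* AdjoinRoot p := eval₂RingHom ψ.toRingHom (AdjoinRoot.of p RatFunc.X)
  have hΨinj : ∀ g : F₀[X], Ψ g = 0 → g = 0 := by
    intro g hg
    by_contra hg0
    letI : Algebra F₀ (AdjoinRoot p) := ψ.toRingHom.toAlgebra
    haveI : IsScalarTower ℚ F₀ (AdjoinRoot p) := IsScalarTower.of_algebraMap_eq' (by
      exact (ψ.comp_algebraMap).symm)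
    have h1 : IsAlgebraic F₀ (AdjoinRoot.of p RatFunc.X) := ⟨g, hg0, hg⟩
    have h2 : IsAlgebraic ℚ (AdjoinRoot.of p (RatFunc.X : k)) := h1.restrictScalars ℚ
    obtain ⟨q, hq0, hq⟩ := h2
    apply hq0
    apply hinj
    apply (AdjoinRoot.of p).injective
    rw [map_zero, map_zero, ← hq]
    rw [aeval_def, ← RatFunc.algebraMap_X]
    have : (algebraMap ℚ (AdjoinRoot p)) = (((AdjoinRoot.of p).comp (algebraMap ℚ[X] k)).comp C) :=
      Subsingleton.elim _ _
    rw [this]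
    change _ = eval₂ _ ((((AdjoinRoot.of p).comp (algebraMap ℚ[X] k))) X) q
    rw [← hom_eval₂, eval₂_C_X]; rfl
  have hsurj := AdjoinRoot.mk_surjective (g := p)
  choose L hL using hsurj
  have hsp := pr_springer c haniso _ p rfl hp hpodd
    (fun o => o.elim (L (Ψ b)) (fun i => L (Ψ (a i)))) (by
      rw [← AdjoinRoot.mk_eq_zero, Fintype.sum_option]
      simp only [c, Option.elim, map_add, map_mul, map_pow, map_sum, hL, map_one, one_mul]
      have h1 := congrArg Ψ h
      simp only [map_mul, map_pow, map_sum] at h1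
      rw [← h1]
      have : Ψ (f.map (algebraMap ℚ F₀)) = AdjoinRoot.mk p (C ((algebraMap ℚ[X] k) f)) := by
        change eval₂ ψ.toRingHom (AdjoinRoot.of p RatFunc.X) _ = _
        rw [eval₂_map, AdjoinRoot.mk_C, ← RatFunc.algebraMap_X]
        have : ψ.toRingHom.comp (algebraMap ℚ F₀) =
          (((AdjoinRoot.of p).comp (algebraMap ℚ[X] k)).comp C) := Subsingleton.elim _ _
        rw [this]
        change eval₂ _ ((((AdjoinRoot.of p).comp (algebraMap ℚ[X] k))) X) f = _
        rw [← hom_eval₂, eval₂_C_X]; rfl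
      rw [this, C_neg, map_neg]; ring) none
  have h3 : Ψ b = 0 := by
    rw [← hL (Ψ b)]
    exact AdjoinRoot.mk_eq_zero.2 hsp
  exact hb (hΨinj b h3)

/-! four squares -/

def IsS4 {R : Type*} [CommRing R] (x : R) : Prop := ∃ a b c d : R, x = a^2 + b^2 + c^2 + d^2

theorem IsS4.mul {R : Type*} [CommRing R] {x y : R} (hx : IsS4 x) (hy : IsS4 y) : IsS4 (x * y) := by
  obtain ⟨a, b, c, d, rfl⟩ := hx
  obtain ⟨x, y, z, w, rfl⟩ := hy
  exact ⟨a*x+b*y+c*z+d*w, a*y-b*x+c*w-d*z, a*z-c*x+d*y-b*w, a*w-d*x+b*z-c*y, by ring⟩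

theorem IsS4.sq {R : Type*} [CommRing R] (x : R) : IsS4 (x ^ 2) := ⟨x, 0, 0, 0, by ring⟩

theorem IsS4.map {R S : Type*} [CommRing R] [CommRing S] (φ : R →+* S) {x : R} (hx : IsS4 x) :
    IsS4 (φ x) := by
  obtain ⟨a, b, c, d, rfl⟩ := hx
  exact ⟨φ a, φ b, φ c, φ d, by simp⟩

theorem IsS4.inv {k : Type*} [Field k] {x : k} (hx : IsS4 x) : IsS4 x⁻¹ := by
  by_cases h : x = 0
  · subst h; simpa using hx
  · have : x⁻¹ = x * (x⁻¹) ^ 2 := by field_simp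
    rw [this]; exact hx.mul (IsS4.sq _)

/-- positive rationals are sums of four squares -/
theorem pr_rat_four (q : ℚ) (hq : 0 ≤ q) : IsS4 q := by
  obtain ⟨a, b, c, d, h⟩ := Nat.sum_four_squares (q.num.toNat * q.den)
  have h0 : (q.num.toNat : ℚ) = q.num := by
    have : (q.num.toNat : ℤ) = q.num := Int.toNat_of_nonneg (Rat.num_nonneg.2 hq)
    exact_mod_cast congrArg (Int.cast : ℤ → ℚ) this
  have hd : (q.den : ℚ) ≠ 0 := by exact_mod_cast q.den_nz
  have h1 : q = (q.num.toNat * q.den : ℚ) / (q.den : ℚ)^2 := by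
    rw [h0]; conv_lhs => rw [← Rat.num_div_den q]
    field_simp
  refine ⟨a / q.den, b / q.den, c / q.den, d / q.den, ?_⟩
  refine h1.trans ?_
  have h2 : ((q.num.toNat * q.den : ℕ) : ℚ) = a^2+b^2+c^2+d^2 := by rw [← h]; push_cast; ring
  push_cast at h2
  rw [h2]; field_simp

/-- sum of four squares up to a square denominator -/
def IsR4 {R : Type*} [CommRing R] (x : R) : Prop := ∃ d : R, d ≠ 0 ∧ IsS4 (x * d ^ 2)

theorem IsR4.mul {R : Type*} [CommRing R] [IsDomain R] {x y : R} (hx : IsR4 x) (hy : IsR4 y) :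
    IsR4 (x * y) := by
  obtain ⟨d, hd, h⟩ := hx
  obtain ⟨e, he, h'⟩ := hy
  exact ⟨d * e, mul_ne_zero hd he, by
    rw [show x * y * (d * e)^2 = (x * d^2) * (y * e^2) by ring]; exact h.mul h'⟩

theorem IsR4.cancel {R : Type*} [CommRing R] [IsDomain R] {x y : R} (hxy : IsR4 (x * y))
    (hy : IsR4 y) (hy0 : y ≠ 0) : IsR4 x := by
  obtain ⟨d, hd, h⟩ := hxy.mul hy
  exact ⟨y * d, mul_ne_zero hy0 hd, by
    rw [show x * (y * d)^2 = (x * y * y * d ^ 2) by ring]; exact h⟩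

theorem IsS4.r4 {R : Type*} [CommRing R] [IsDomain R] {x : R} (hx : IsS4 x) : IsR4 x :=
  ⟨1, one_ne_zero, by simpa using hx⟩

/-- level at most two modulo a polynomial -/
def LevTwo {k : Type*} [Field k] (p : k[X]) : Prop := ∃ a b : k[X], p ∣ a ^ 2 + b ^ 2 + 1

theorem LevTwo.of_dvd {k : Type*} [Field k] {p q : k[X]} (h : p ∣ q) (hq : LevTwo q) : LevTwo p := by
  obtain ⟨a, b, hab⟩ := hq
  exact ⟨a, b, h.trans hab⟩

theorem pr_monic_R4_of {k : Type*} [Field k] (n : ℕ)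
    (H : ∀ π : k[X], Irreducible π → π.Monic → π.natDegree < n → LevTwo π → IsR4 π) :
    ∀ (m : ℕ) (r : k[X]), r.natDegree = m → m < n → r.Monic →
      (∀ π, Irreducible π → π ∣ r → LevTwo π) → IsR4 r := by
  classical
  intro m
  induction m using Nat.strong_induction_on with
  | _ m ihm =>
  intro r hr hmn hmon hlev
  by_cases hu : IsUnit r
  · rw [hmon.isUnit_iff] at hu
    subst hu
    exact IsS4.r4 ⟨1, 0, 0, 0, by ring⟩
  · obtain ⟨π0, hπ0, s0, hs0⟩ := WfDvdMonoid.exists_irreducible_factor hu hmon.ne_zero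
    obtain ⟨π, hπ, hπm, s, hs⟩ : ∃ π : k[X], Irreducible π ∧ π.Monic ∧ π ∣ r := by
      refine ⟨normalize π0, ?_, monic_normalize hπ0.ne_zero, ?_⟩
      · exact (associated_normalize π0).irreducible hπ0
      · rw [normalize_dvd_iff]; exact ⟨s0, hs0⟩
    have hsm : s.Monic := hπm.of_mul_monic_left (hs ▸ hmon)
    have hdeg : m = π.natDegree + s.natDegree := by
      rw [← hr, hs, hπm.natDegree_mul hsm]
    have := hπ.natDegree_pos
    rw [hs]
    refine (H π hπ hπm (by omega) (hlev π hπ ⟨s, hs⟩)).mul ?_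
    exact ihm s.natDegree (by omega) s rfl (by omega) hsm
      (fun π' h1 h2 => hlev π' h1 (h2.trans ⟨π, by rw [hs]; ring⟩))

theorem pr_irred_R4 {k : Type*} [Field k] (φ : k →+* ℝ) : ∀ (n : ℕ) (π : k[X]), Irreducible π →
    π.Monic → π.natDegree < n → LevTwo π → IsR4 π := by
  intro n
  induction n with
  | zero => intro π _ _ h; exact absurd h (Nat.not_lt_zero _)
  | succ n ih =>
  intro π hπ hπm hdeg hlev
  obtain ⟨a0, b0, hab0⟩ := hlev
  obtain ⟨a, b, hab, hda, hdb⟩ : ∃ a b : k[X], π ∣ a ^ 2 + b ^ 2 + 1 ∧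
      a.natDegree < π.natDegree ∧ b.natDegree < π.natDegree := by
    have hpos := hπ.natDegree_pos
    refine ⟨a0 % π, b0 % π, ?_, natDegree_mod_lt _ (by omega), natDegree_mod_lt _ (by omega)⟩
    have h1 := (EuclideanDomain.div_add_mod a0 π)
    have h2 := (EuclideanDomain.div_add_mod b0 π)
    generalize a0 % π = A at *
    generalize b0 % π = B at *
    have : A ^ 2 + B ^ 2 + 1 = a0 ^ 2 + b0 ^ 2 + 1 - π * ((a0/π) * (a0 + A) + (b0/π) * (b0 + B)) := by
      linear_combination (A + a0) * h1 + (B + b0) * h2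
    rw [this]; exact dvd_sub hab0 (dvd_mul_right _ _)
  let v : Fin 3 → k[X] := ![a, b, 1]
  have hv : ∃ i, v i ≠ 0 := ⟨2, by simp [v]⟩
  obtain ⟨i, hi0, himax⟩ := pr_exists_max v hv
  have han : ∀ v : Fin 3 → k, ∑ i, (1:k) * v i ^ 2 = 0 → ∀ i, v i = 0 := by
    intro v hv
    exact pr_sum_sq_eq_zero φ v (by simpa using hv)
  obtain ⟨hd1, hd2, hd3⟩ := pr_diag_degree (fun _ => (1:k)) han v _ himax i rfl hi0
  have hsum : ∑ i, C ((fun _ : Fin 3 => (1:k)) i) * v i ^ 2 = a ^ 2 + b ^ 2 + 1 := by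
    simp [Fin.sum_univ_three, v]
  rw [hsum] at hd1 hd2 hd3
  have hlc : IsS4 (a ^ 2 + b ^ 2 + 1 : k[X]).leadingCoeff := by
    rw [leadingCoeff, hd1, hd2]
    refine ⟨(v 0).coeff (v i).natDegree, (v 1).coeff (v i).natDegree, (v 2).coeff (v i).natDegree, 0, ?_⟩
    rw [Fin.sum_univ_three]
    simp only [one_mul]
    ring
  have hvi : (v i).natDegree < π.natDegree := by
    have := hπ.natDegree_pos
    fin_cases i
    · exact hda
    · exact hdb
    · simpa [v] using this
  obtain ⟨r, hr⟩ := hab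
  have hr0 : r ≠ 0 := by rintro rfl; rw [mul_zero] at hr; exact hd3 hr
  have hrl : r.leadingCoeff = (a ^ 2 + b ^ 2 + 1 : k[X]).leadingCoeff := by
    rw [hr, leadingCoeff_mul, hπm.leadingCoeff, one_mul]
  have hrdeg : r.natDegree < n := by
    have := congrArg natDegree hr
    rw [hd1, natDegree_mul hπ.ne_zero hr0] at this
    omega
  have hlr0 : r.leadingCoeff ≠ 0 := leadingCoeff_ne_zero.2 hr0
  set r' : k[X] := C (r.leadingCoeff⁻¹) * r with hr'
  have hr'm : r'.Monic := by
    rw [Monic, hr', leadingCoeff_mul, leadingCoeff_C]; exact inv_mul_cancel₀ hlr0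
  have hrr' : r = C r.leadingCoeff * r' := by
    rw [hr', ← mul_assoc, ← C_mul, mul_inv_cancel₀ hlr0]; simp
  have hr'R : IsR4 r' := by
    refine pr_monic_R4_of n ih _ r' rfl ?_ hr'm ?_
    · rw [hr', natDegree_C_mul (inv_ne_zero hlr0)]; exact hrdeg
    · intro p _ hp
      refine ⟨a, b, ?_⟩
      rw [hr, hrr']
      exact (hp.mul_left _).mul_left _
  have hrR : IsR4 r := by
    rw [hrr', hrl]
    exact (IsS4.map C hlc).r4.mul hr'R
  refine IsR4.cancel (y := r) ?_ hrR hr0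
  rw [← hr]
  exact IsS4.r4 ⟨a, b, 1, 0, by ring⟩

theorem pr_D4 {k : Type*} [Field k] (φ : k →+* ℝ) (h : k[X]) (h0 : h ≠ 0)
    (hlc : IsS4 h.leadingCoeff) (hlev : ∀ π : k[X], Irreducible π → π ∣ h → LevTwo π) : IsR4 h := by
  have hl0 : h.leadingCoeff ≠ 0 := leadingCoeff_ne_zero.2 h0
  set r' : k[X] := C (h.leadingCoeff⁻¹) * h with hr'
  have hr'm : r'.Monic := by
    rw [Monic, hr', leadingCoeff_mul, leadingCoeff_C]; exact inv_mul_cancel₀ hl0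
  have hrr' : h = C h.leadingCoeff * r' := by
    rw [hr', ← mul_assoc, ← C_mul, mul_inv_cancel₀ hl0]; simp
  rw [hrr']
  refine (IsS4.map C hlc).r4.mul ?_
  refine pr_monic_R4_of (r'.natDegree + 1) (pr_irred_R4 φ _) _ r' rfl (Nat.lt_succ_self _) hr'm ?_
  intro π h1 h2
  exact hlev π h1 (h2.trans ⟨C h.leadingCoeff, by rw [mul_comm]; exact hrr'⟩)

theorem pr_five_of_R4 (F₀ : Type) [Field F₀] [NumberField F₀] (hodd : Odd (Module.finrank ℚ F₀))
    (f : ℚ[X]) (B A : F₀[X]) (hB : B ≠ 0)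
    (h : IsR4 (f.map (algebraMap ℚ F₀) * B ^ 2 - A ^ 2)) :
    ∃ g : Fin 5 → ℚ[X], f = ∑ i, g i ^ 2 := by
  obtain ⟨d, hd, x, y, z, w, hh⟩ := h
  obtain ⟨b', a', hb', h'⟩ := pr_descent F₀ hodd f (B * d) ![A * d, x, y, z, w]
    (mul_ne_zero hB hd) (by
      simp [Fin.sum_univ_five]
      linear_combination hh)
  exact pr_cassels f _ b' a' rfl hb' h'
end

section
open Polynomial
set_option linter.all false

/-! group theory -/

theorem pr_idx_add (A : Type) [AddCommGroup A] [Module.Finite ℤ A] :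
    (nsmulAddMonoidHom 2 : A →+ A).range.index =
      2 ^ (Module.finrank ℤ A) * Nat.card (nsmulAddMonoidHom 2 : A →+ A).ker := by
  haveI : AddGroup.FG A := Module.Finite.iff_addGroup_fg.1 inferInstance
  obtain ⟨n, ι, _, p, hp, e, ⟨f⟩⟩ := AddCommGroup.equiv_free_prod_directSum_zmod A
  classical
  haveI : ∀ i, NeZero (p i ^ e i) := fun i => ⟨pow_ne_zero _ (hp i).ne_zero⟩
  let T := (DirectSum ι fun i => ZMod (p i ^ e i))
  haveI hT : Finite T := by
    have : T ≃ (∀ i, ZMod (p i ^ e i)) := (DirectSum.addEquivProd _).toEquiv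
    exact Finite.of_equiv _ this.symm
  let F := Fin n → ℤ
  let g : A ≃+ F × T := f.trans ((Finsupp.linearEquivFunOnFinite ℤ ℤ (Fin n)).toAddEquiv.prodCongr
    (AddEquiv.refl T))
  -- finrank
  have hrk : Module.finrank ℤ A = n := by
    rw [LinearEquiv.finrank_eq g.toIntLinearEquiv]
    have h1 := (LinearMap.ker (LinearMap.fst ℤ F T)).finrank_quotient_add_finrank
    have h2 : Module.finrank ℤ (LinearMap.ker (LinearMap.fst ℤ F T)) = 0 := by
      refine (Module.finrank_eq_zero_iff_isTorsion (R := ℤ) (M := LinearMap.ker (LinearMap.fst ℤ F T))).2 ?_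
      intro x
      obtain ⟨m, hm, hx⟩ : ∃ m : ℕ, 0 < m ∧ m • x.1.2 = 0 := by
        have := isOfFinAddOrder_of_finite x.1.2
        rw [isOfFinAddOrder_iff_nsmul_eq_zero] at this
        exact this
      refine ⟨⟨(m : ℤ), mem_nonZeroDivisors_of_ne_zero (by exact_mod_cast hm.ne')⟩, ?_⟩
      apply Subtype.ext
      have hx1 : x.1.1 = 0 := x.2
      apply Prod.ext
      · change (m : ℤ) • x.1.1 = 0
        rw [hx1]; simp
      · change (m : ℤ) • x.1.2 = 0
        rw [natCast_zsmul]; exact hx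
    rw [h2, add_zero] at h1
    rw [← h1]
    have h3 := (LinearMap.quotKerEquivOfSurjective (LinearMap.fst ℤ F T)
      LinearMap.fst_surjective).finrank_eq
    rw [h3]
    simp [F]
  -- range
  have hr1 : (nsmulAddMonoidHom 2 : A →+ A).range =
      ((nsmulAddMonoidHom 2 : (F × T) →+ (F × T)).range).comap g.toAddMonoidHom := by
    ext x
    simp only [AddMonoidHom.mem_range, AddSubgroup.mem_comap, nsmulAddMonoidHom_apply]
    constructor
    · rintro ⟨y, rfl⟩; exact ⟨g y, by simp⟩
    · rintro ⟨y, hy⟩; exact ⟨g.symm y, g.injective (by simpa using hy)⟩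
  have hr2 : (nsmulAddMonoidHom 2 : (F × T) →+ (F × T)).range =
      (AddSubgroup.pi Set.univ (fun _ : Fin n => AddSubgroup.zmultiples (2:ℤ))).prod
        (nsmulAddMonoidHom 2 : T →+ T).range := by
    ext ⟨x, t⟩
    simp only [AddMonoidHom.mem_range, AddSubgroup.mem_prod, nsmulAddMonoidHom_apply,
      AddSubgroup.mem_pi, Int.mem_zmultiples_iff]
    constructor
    · rintro ⟨⟨y, s⟩, hy⟩
      have h1 := congrArg Prod.fst hy
      have h2 := congrArg Prod.snd hy
      refine ⟨fun i _ => ⟨y i, ?_⟩, s, h2⟩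
      have := congrFun h1 i
      simp at this
      exact this.symm
    · rintro ⟨h1, s, hs⟩
      choose y hy using fun i => h1 i (Set.mem_univ i)
      refine ⟨(y, s), Prod.ext ?_ hs⟩
      funext i
      change 2 • y i = x i
      rw [hy i]; simp
  have hk : Nat.card (nsmulAddMonoidHom 2 : A →+ A).ker = Nat.card (nsmulAddMonoidHom 2 : T →+ T).ker := by
    refine Nat.card_congr (Equiv.symm ?_)
    refine Equiv.ofBijective (fun t => ⟨g.symm (0, t.1), ?_⟩) ⟨?_, ?_⟩
    · rw [AddMonoidHom.mem_ker, nsmulAddMonoidHom_apply, ← map_nsmul]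
      have : 2 • t.1 = 0 := t.2
      rw [Prod.smul_mk, this]; simp
    · intro a b hab
      have := congrArg Subtype.val hab
      have := g.symm.injective this
      exact Subtype.ext (congrArg Prod.snd this)
    · rintro ⟨a, ha⟩
      have h1 : 2 • g a = 0 := by
        rw [← map_nsmul]; rw [AddMonoidHom.mem_ker, nsmulAddMonoidHom_apply] at ha
        rw [ha]; simp
      have h2 := congrArg Prod.fst h1
      have h3 := congrArg Prod.snd h1
      have h4 : (g a).1 = 0 := by
        funext i
        have : 2 • (g a).1 i = 0 := congrFun h2 i
        change (g a).1 i = 0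
        simpa using this
      refine ⟨⟨(g a).2, h3⟩, Subtype.ext ?_⟩
      change g.symm (0, (g a).2) = a
      rw [← h4]; simp
  rw [hr1, AddSubgroup.index_comap_of_surjective _ g.surjective, hr2, AddSubgroup.index_prod,
    AddSubgroup.index_pi, hrk, hk]
  haveI : (nsmulAddMonoidHom 2 : T →+ T).ker.FiniteIndex := AddSubgroup.finiteIndex_of_finite_quotient
  rw [AddSubgroup.index_range]
  simp [Int.index_zmultiples]

abbrev sqh (G : Type) [CommGroup G] : G →* G := powMonoidHom 2

theorem pr_idx (G : Type) [CommGroup G] [Module.Finite ℤ (Additive G)] :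
    (sqh G).range.index = 2 ^ (Module.finrank ℤ (Additive G)) * Nat.card (sqh G).ker :=
  pr_idx_add (Additive G)

noncomputable def rk (G : Type) [CommGroup G] : ℕ := Module.finrank ℤ (Additive G)

theorem rk_congr {G H : Type} [CommGroup G] [CommGroup H] (e : G ≃* H) : rk G = rk H :=
  LinearEquiv.finrank_eq (MulEquiv.toAdditive e).toIntLinearEquiv

theorem fin_congr {G H : Type} [CommGroup G] [CommGroup H] (e : G ≃* H)
    [Module.Finite ℤ (Additive G)] : Module.Finite ℤ (Additive H) :=
  Module.Finite.equiv (MulEquiv.toAdditive e).toIntLinearEquiv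

instance fin_subgroup {G : Type} [CommGroup G] [Module.Finite ℤ (Additive G)] (H : Subgroup G) :
    Module.Finite ℤ (Additive H) := by
  let i : Additive H →ₗ[ℤ] Additive G := (MonoidHom.toAdditive H.subtype).toIntLinearMap
  exact Module.Finite.of_injective i (fun a b h => Subtype.ext h)

theorem rk_ker_range {G H : Type} [CommGroup G] [CommGroup H] [Module.Finite ℤ (Additive G)]
    (f : G →* H) : rk G = rk f.ker + rk f.range := by
  let g : Additive G →ₗ[ℤ] Additive H := (MonoidHom.toAdditive f).toIntLinearMap
  have h1 := (LinearMap.ker g).finrank_quotient_add_finrank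
  have h2 := (g.quotKerEquivRange).finrank_eq
  have h3 : Module.finrank ℤ (LinearMap.ker g) = rk f.ker := rfl
  have h4 : Module.finrank ℤ (LinearMap.range g) = rk f.range := rfl
  rw [h2, h3, h4] at h1
  rw [← add_comm] at h1
  exact h1.symm

theorem fin_of_ker_range {G H : Type} [CommGroup G] [CommGroup H]
    (f : G →* H) [Module.Finite ℤ (Additive f.ker)] [Module.Finite ℤ (Additive f.range)] :
    Module.Finite ℤ (Additive G) := by
  let g : Additive G →ₗ[ℤ] Additive H := (MonoidHom.toAdditive f).toIntLinearMap
  haveI h3 : Module.Finite ℤ (LinearMap.ker g) := ‹Module.Finite ℤ (Additive f.ker)›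
  haveI h4 : Module.Finite ℤ (LinearMap.range g) := ‹Module.Finite ℤ (Additive f.range)›
  haveI : Module.Finite ℤ (Additive G ⧸ LinearMap.ker g) := Module.Finite.equiv g.quotKerEquivRange.symm
  exact Module.Finite.of_submodule_quotient (LinearMap.ker g)

/-- `[H : H²]` for a subgroup `H`. -/
theorem pr_idx_sub {G : Type} [CommGroup G] (H : Subgroup G) [Module.Finite ℤ (Additive H)]
    (ε : G) (hε : ε ∈ H) (hε1 : ε ≠ 1) (hε2 : ∀ x : G, x ^ 2 = 1 ↔ x = 1 ∨ x = ε) :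
    (H.map (sqh G)).relIndex H = 2 ^ (rk H + 1) := by
  have h1 := pr_idx H
  have h2 : (H.map (sqh G)).relIndex H = (sqh H).range.index := by
    rw [Subgroup.relIndex]
    congr 1
    ext x
    simp only [Subgroup.mem_subgroupOf, Subgroup.mem_map, MonoidHom.mem_range]
    constructor
    · rintro ⟨y, hy, h⟩; exact ⟨⟨y, hy⟩, Subtype.ext h⟩
    · rintro ⟨y, h⟩; exact ⟨y.1, y.2, congrArg Subtype.val h⟩
  have h3 : Nat.card (sqh H).ker = 2 := by
    rw [Nat.card_eq_two_iff]
    refine ⟨1, ⟨⟨ε, hε⟩, ?_⟩, ?_, ?_⟩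
    · rw [MonoidHom.mem_ker]; exact Subtype.ext ((hε2 ε).2 (Or.inr rfl))
    · intro h
      exact hε1 (congrArg (fun z => (z.1.1 : G)) h).symm
    · rw [Set.eq_univ_iff_forall]
      rintro ⟨⟨x, hx⟩, hx2⟩
      rw [MonoidHom.mem_ker] at hx2
      have := congrArg Subtype.val hx2
      rcases (hε2 x).1 this with h | h
      · left; exact Subtype.ext (Subtype.ext h)
      · right; exact Subtype.ext (Subtype.ext h)
  rw [h2, h1, h3]
  unfold rk
  ring

theorem pr_herbrand {A : Type} [CommGroup A] [Module.Finite ℤ (Additive A)] (σ : A →* A)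
    (hσ : ∀ x, σ (σ x) = x) (ε : A) (hε1 : ε ≠ 1) (hε2 : ∀ x : A, x ^ 2 = 1 ↔ x = 1 ∨ x = ε)
    (hσε : σ ε = ε) (B : Subgroup A) (hB : ∀ x, x ∈ B ↔ σ x = x)
    (H1 : ∀ x, x * σ x = 1 → ∃ y, x = y / σ y) :
    ((MonoidHom.id A * σ).range).relIndex B * 2 ^ rk A = 2 ^ (2 * rk B) := by
  set N : A →* A := MonoidHom.id A * σ with hN
  set D : A →* A := MonoidHom.id A / σ with hD
  have hNx : ∀ x, N x = x * σ x := fun x => rfl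
  have hDx : ∀ x, D x = x / σ x := fun x => rfl
  have hDker : D.ker = B := by
    ext x; rw [MonoidHom.mem_ker, hDx, hB, div_eq_one]; exact eq_comm
  set AN := N.ker with hAN
  have hDr : D.range = AN := by
    ext x
    rw [MonoidHom.mem_range, hAN, MonoidHom.mem_ker, hNx]
    constructor
    · rintro ⟨y, rfl⟩
      rw [hDx, _root_.map_div, hσ]; simp
    · intro h; obtain ⟨y, hy⟩ := H1 x h; exact ⟨y, hy.symm⟩
  have hrk : rk A = rk B + rk AN := by
    have := rk_ker_range D
    rwa [hDker, hDr] at this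
  have hcomap : (B.map (sqh A)).comap N = (AN.map (sqh A)).comap D := by
    ext x
    simp only [Subgroup.mem_comap, Subgroup.mem_map, powMonoidHom_apply, hNx, hDx]
    constructor
    · rintro ⟨b, hb, h⟩
      rw [hB] at hb
      refine ⟨x / b, ?_, ?_⟩
      · rw [hAN, MonoidHom.mem_ker, hNx, _root_.map_div, hb, div_mul_div_comm, ← h, sq, div_self']
      · rw [div_pow, h, sq, mul_div_mul_left_eq_div]
    · rintro ⟨c, hc, h⟩
      rw [hAN, MonoidHom.mem_ker, hNx] at hc
      have hc' : σ c = c⁻¹ := (eq_inv_of_mul_eq_one_right hc)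
      refine ⟨x / c, ?_, ?_⟩
      · rw [hB, _root_.map_div, hc', div_inv_eq_mul, eq_div_iff_mul_eq', mul_right_comm, mul_assoc, ← sq, h]
        simp
      · rw [div_pow, h, sq, mul_div_assoc, div_div_cancel]
  have hidx := congrArg Subgroup.index hcomap
  rw [Subgroup.index_comap, Subgroup.index_comap, hDr] at hidx
  have hεB : ε ∈ B := (hB ε).2 hσε
  have hεN : ε ∈ AN := by
    rw [hAN, MonoidHom.mem_ker, hNx, hσε, ← sq]; exact (hε2 ε).2 (Or.inr rfl)
  rw [pr_idx_sub AN ε hεN hε1 hε2] at hidx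
  have hle1 : B.map (sqh A) ≤ N.range := by
    rintro _ ⟨b, hb, rfl⟩
    exact ⟨b, by rw [hNx, (hB b).1 hb, powMonoidHom_apply, sq]⟩
  have hle2 : N.range ≤ B := by
    rintro _ ⟨b, rfl⟩
    rw [hB, hNx, map_mul, hσ, mul_comm]
  have hmul := Subgroup.relIndex_mul_relIndex _ _ _ hle1 hle2
  rw [hidx, pr_idx_sub B ε hεB hε1 hε2] at hmul
  have : 2 ^ (rk AN + 1) * (N.range.relIndex B * 2 ^ rk A) = 2 ^ (rk AN + 1) * 2 ^ (2 * rk B) := by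
    calc _ = (2 ^ (rk AN + 1) * N.range.relIndex B) * 2 ^ rk A := by ring
      _ = 2 ^ (rk B + 1) * 2 ^ (rk B + rk AN) := by rw [hmul, hrk]
      _ = _ := by ring
  exact Nat.eq_of_mul_eq_mul_left (by positivity) this
end

section
open Polynomial
set_option linter.all false
open IsDedekindDomain NumberField

abbrev Pl (K : Type) [Field K] := HeightOneSpectrum (𝓞 K)

section places
variable {K : Type} [Field K] [NumberField K]

noncomputable def od (v : Pl K) (x : K) : ℤ := - WithZero.log (v.valuation K x)

def OG (v : Pl K) (n : ℤ) (x : K) : Prop := v.valuation K x ≤ WithZero.exp (-n)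

theorem vl_eq (v : Pl K) {x : K} (hx : x ≠ 0) : v.valuation K x = WithZero.exp (-od v x) := by
  rw [od, neg_neg, WithZero.exp_log]
  exact (Valuation.ne_zero_iff _).2 hx

theorem OG_iff (v : Pl K) {x : K} (hx : x ≠ 0) {n : ℤ} : OG v n x ↔ n ≤ od v x := by
  rw [OG, vl_eq v hx, WithZero.exp_le_exp]; omega

theorem OG_zero (v : Pl K) (n : ℤ) : OG v n (0 : K) := by simp [OG]

theorem od_zero (v : Pl K) : od v (0:K) = 0 := by simp [od]

theorem OG.add {v : Pl K} {n : ℤ} {x y : K} (hx : OG v n x) (hy : OG v n y) : OG v n (x + y) :=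
  Valuation.map_add_le _ hx hy

theorem OG.neg {v : Pl K} {n : ℤ} {x : K} (hx : OG v n x) : OG v n (-x) := by
  rw [OG, Valuation.map_neg]; exact hx

theorem OG.sub {v : Pl K} {n : ℤ} {x y : K} (hx : OG v n x) (hy : OG v n y) : OG v n (x - y) := by
  rw [sub_eq_add_neg]; exact hx.add hy.neg

theorem OG.sum {v : Pl K} {n : ℤ} {ι : Type*} {s : Finset ι} {x : ι → K} (h : ∀ i ∈ s, OG v n (x i)) :
    OG v n (∑ i ∈ s, x i) := by
  classical
  induction s using Finset.induction_on with
  | empty => simpa using OG_zero v n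
  | insert a s ha ih =>
    rw [Finset.sum_insert ha]
    exact (h a (by simp)).add (ih fun i hi => h i (by simp [hi]))

theorem OG.mul {v : Pl K} {n m : ℤ} {x y : K} (hx : OG v n x) (hy : OG v m y) :
    OG v (n + m) (x * y) := by
  rw [OG, map_mul, neg_add, WithZero.exp_add]
  exact mul_le_mul' hx hy

theorem OG.mono {v : Pl K} {n m : ℤ} {x : K} (hx : OG v n x) (h : m ≤ n) : OG v m x :=
  le_trans hx (WithZero.exp_le_exp.2 (by omega))

theorem od_one (v : Pl K) : od v (1:K) = 0 := by simp [od]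

theorem od_mul (v : Pl K) {x y : K} (hx : x ≠ 0) (hy : y ≠ 0) : od v (x * y) = od v x + od v y := by
  rw [od, map_mul, WithZero.log_mul ((Valuation.ne_zero_iff _).2 hx) ((Valuation.ne_zero_iff _).2 hy),
    od, od]; ring

theorem od_inv (v : Pl K) (x : K) : od v x⁻¹ = - od v x := by
  rw [od, map_inv₀, WithZero.log_inv, od]

theorem od_neg (v : Pl K) (x : K) : od v (-x) = od v x := by
  rw [od, Valuation.map_neg, od]

theorem od_div (v : Pl K) {x y : K} (hx : x ≠ 0) (hy : y ≠ 0) : od v (x / y) = od v x - od v y := by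
  rw [div_eq_mul_inv, od_mul v hx (inv_ne_zero hy), od_inv]; ring

theorem od_pow (v : Pl K) (x : K) (n : ℕ) : od v (x ^ n) = n * od v x := by
  rw [od, map_pow, WithZero.log_pow, od]; simp

theorem od_zpow (v : Pl K) (x : K) (n : ℤ) : od v (x ^ n) = n * od v x := by
  rw [od, map_zpow₀, WithZero.log_zpow, od]; simp

theorem OG.pow {v : Pl K} {n : ℤ} {x : K} (hx : OG v n x) (k : ℕ) : OG v (k * n) (x ^ k) := by
  by_cases h0 : x = 0
  · subst h0
    rcases Nat.eq_zero_or_pos k with rfl | hk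
    · simp [OG]
    · rw [zero_pow hk.ne']; exact OG_zero _ _
  · rw [OG_iff v (pow_ne_zero k h0), od_pow]
    rw [OG_iff v h0] at hx
    gcongr

theorem od_OG (v : Pl K) (x : K) : OG v (od v x) x := by
  by_cases h0 : x = 0
  · subst h0; exact OG_zero _ _
  · exact (OG_iff v h0).2 le_rfl

theorem od_add_eq (v : Pl K) {x y : K} (hx : x ≠ 0) (hy : OG v (od v x + 1) y) :
    x + y ≠ 0 ∧ od v (x + y) = od v x := by
  have h0 : v.valuation K y < v.valuation K x := by
    refine lt_of_le_of_lt hy ?_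
    rw [vl_eq v hx, WithZero.exp_lt_exp]; omega
  have h1 : v.valuation K (x + y) = v.valuation K x := Valuation.map_add_eq_of_lt_left _ h0
  constructor
  · intro h
    rw [h, map_zero] at h1
    exact (Valuation.ne_zero_iff _).2 hx h1.symm
  · rw [od, h1, od]

theorem OG_one_one (v : Pl K) : OG v 0 (1:K) := by simp [OG]

theorem OG_int (v : Pl K) (a : 𝓞 K) : OG v 0 (a : K) := by
  rw [OG, neg_zero, WithZero.exp_zero]; exact v.valuation_le_one a

theorem OG_natCast (v : Pl K) (n : ℕ) : OG v 0 (n : K) := by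
  have := OG_int v (n : 𝓞 K)
  simpa using this

theorem OG_intCast (v : Pl K) (n : ℤ) : OG v 0 (n : K) := by
  have := OG_int v (n : 𝓞 K)
  simpa using this

theorem OG_pow_iff_mem (v : Pl K) (n : ℕ) (a : 𝓞 K) : OG v n (a : K) ↔ a ∈ v.asIdeal ^ n := by
  rw [← v.intValuation_le_pow_iff_mem, OG]
  exact Iff.of_eq (congrArg (· ≤ _) (v.valuation_of_algebraMap a))

theorem OG_one_iff_mem (v : Pl K) (a : 𝓞 K) : OG v 1 (a : K) ↔ a ∈ v.asIdeal := by
  have := OG_pow_iff_mem v 1 a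
  simpa using this

theorem od_eq_zero_of_notMem (v : Pl K) {a : 𝓞 K} (h : a ∉ v.asIdeal) : (a : K) ≠ 0 ∧ od v (a : K) = 0 := by
  have h0 : (a : K) ≠ 0 := by
    intro h0
    have : a = 0 := by exact_mod_cast h0
    exact h (this ▸ v.asIdeal.zero_mem)
  refine ⟨h0, ?_⟩
  rw [← OG_one_iff_mem, OG_iff v h0] at h
  have := (OG_iff v h0).1 (OG_int v a)
  omega

theorem exists_unif (v : Pl K) : ∃ p : 𝓞 K, (p : K) ≠ 0 ∧ od v (p : K) = 1 := by
  obtain ⟨p, hp⟩ := v.intValuation_exists_uniformizer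
  have h1 : v.valuation K (p : K) = WithZero.exp (-1 : ℤ) := (v.valuation_of_algebraMap p).trans hp
  refine ⟨p, ?_, ?_⟩
  · intro h; rw [h, map_zero] at h1; exact WithZero.exp_ne_zero h1.symm
  · rw [od, h1]; simp

theorem od_pos_of_OG {v : Pl K} {x : K} (hx : x ≠ 0) {n : ℤ} (h : OG v n x) : n ≤ od v x :=
  (OG_iff v hx).1 h

theorem exists_num_den (v : Pl K) {x : K} (hx : OG v 0 x) :
    ∃ a d : 𝓞 K, d ∉ v.asIdeal ∧ x * (d : K) = (a : K) := by
  rw [OG, neg_zero, WithZero.exp_zero] at hx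
  obtain ⟨n, d, h⟩ := v.exists_primeCompl_mul_eq_of_integer x hx
  exact ⟨n, d, d.2, h⟩

theorem int_of_OG {x : K} (h : ∀ v : Pl K, OG v 0 x) : ∃ a : 𝓞 K, (a : K) = x := by
  refine HeightOneSpectrum.mem_integers_of_valuation_le_one K x fun v => ?_
  have := h v
  rwa [OG, neg_zero, WithZero.exp_zero] at this

theorem finite_mem {a : 𝓞 K} (ha : a ≠ 0) : {v : Pl K | a ∈ v.asIdeal}.Finite := by
  have := Ideal.finite_factors (R := 𝓞 K) (I := Ideal.span {a}) (by simpa using ha)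
  refine this.subset fun v hv => ?_
  simpa [Ideal.dvd_span_singleton] using hv

theorem finite_supp {x : K} (hx : x ≠ 0) : {v : Pl K | od v x ≠ 0}.Finite := by
  obtain ⟨a, b, hb, rfl⟩ := IsFractionRing.div_surjective (A := 𝓞 K) x
  have hb0 : b ≠ 0 := nonZeroDivisors.ne_zero hb
  have ha0 : a ≠ 0 := by rintro rfl; simp at hx
  refine ((finite_mem ha0).union (finite_mem hb0)).subset fun v hv => ?_
  by_contra hcon
  simp only [Set.mem_union, Set.mem_setOf_eq, not_or] at hcon
  obtain ⟨h1, h2⟩ := od_eq_zero_of_notMem v hcon.1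
  obtain ⟨h3, h4⟩ := od_eq_zero_of_notMem v hcon.2
  apply hv
  change od v ((a : K) / (b : K)) = 0
  rw [od_div v h1 h3, h2, h4]; ring

theorem od_int_nonneg (v : Pl K) (a : 𝓞 K) : 0 ≤ od v (a : K) := by
  by_cases h : (a : K) = 0
  · rw [h, od_zero]
  · exact (OG_iff v h).1 (OG_int v a)

/-- weak approximation -/
theorem weak_approx (T : Finset (Pl K)) (x : Pl K → K) (n : ℕ) :
    ∃ y : K, ∀ v ∈ T, OG v n (y - x v) := by
  classical
  obtain ⟨d, hd⟩ := IsLocalization.exist_integer_multiples_of_finset (nonZeroDivisors (𝓞 K)) (T.image x)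
  have hd0 : (d : 𝓞 K) ≠ 0 := nonZeroDivisors.ne_zero d.2
  have hdK : ((d : 𝓞 K) : K) ≠ 0 := by exact_mod_cast hd0
  have hz : ∀ v : Pl K, ∃ z : 𝓞 K, v ∈ T → (z : K) = (d : 𝓞 K) * x v := by
    intro v
    by_cases hv : v ∈ T
    · obtain ⟨z, hz⟩ := hd (x v) (Finset.mem_image_of_mem _ hv)
      refine ⟨z, fun _ => ?_⟩
      exact hz
    · exact ⟨0, fun h => absurd h hv⟩
  choose z hz using hz
  obtain ⟨y, hy⟩ := IsDedekindDomain.exists_forall_sub_mem_ideal (s := T) (fun v : Pl K => v.asIdeal)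
    (fun v => n + (od v ((d : 𝓞 K) : K)).toNat) (fun v _ => v.prime)
    (fun v _ w _ hvw h => hvw (HeightOneSpectrum.ext h)) (fun v => z v)
  refine ⟨(y : K) / (d : 𝓞 K), fun v hv => ?_⟩
  have h1 := hy v hv
  rw [← OG_pow_iff_mem] at h1
  have h2 : ((y : K) / (d : 𝓞 K) - x v) = ((y - z v : 𝓞 K) : K) * ((d : 𝓞 K) : K)⁻¹ := by
    have h5 : ((y - z v : 𝓞 K) : K) = (y : K) - (z v : K) := rfl
    rw [h5, hz v hv]; field_simp
  rw [h2]
  have h3 := h1.mul (od_OG v (((d : 𝓞 K) : K)⁻¹))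
  refine h3.mono ?_
  rw [od_inv]
  have := od_int_nonneg v (d : 𝓞 K)
  push_cast
  omega

end places

section ext
variable {K M : Type} [Field K] [NumberField K] [Field M] [NumberField M] [Algebra K M]

noncomputable def und (K : Type) {M : Type} [Field K] [NumberField K] [Field M] [NumberField M] [Algebra K M]
    (w : Pl M) : Pl K where
  asIdeal := w.asIdeal.under (𝓞 K)
  isPrime := inferInstance
  ne_bot := by
    intro h
    exact w.ne_bot (Ideal.eq_bot_of_comap_eq_bot h)

noncomputable def ram (K : Type) {M : Type} [Field K] [NumberField K] [Field M] [NumberField M] [Algebra K M]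
    (w : Pl M) : ℕ := (und K w).asIdeal.ramificationIdx' w.asIdeal

instance (w : Pl M) : w.asIdeal.LiesOver (und K w).asIdeal := ⟨rfl⟩

theorem vl_und (w : Pl M) (x : K) :
    (und K w).valuation K x ^ ram K w = w.valuation M (algebraMap K M x) :=
  HeightOneSpectrum.valuation_liesOver (A := 𝓞 K) (B := 𝓞 M) M (und K w) w x

theorem ram_pos (w : Pl M) : 0 < ram K w := by
  refine Nat.pos_of_ne_zero ?_
  exact Ideal.IsDedekindDomain.ramificationIdx'_ne_zero_of_liesOver w.asIdeal (und K w).ne_bot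

theorem od_alg (w : Pl M) (x : K) : od w (algebraMap K M x) = ram K w * od (und K w) x := by
  rw [od, ← vl_und, WithZero.log_pow, od]; simp

theorem OG_alg (w : Pl M) {x : K} {n : ℤ} (h : OG (und K w) n x) :
    OG w (ram K w * n) (algebraMap K M x) := by
  by_cases h0 : x = 0
  · subst h0; rw [map_zero]; exact OG_zero _ _
  · rw [OG_iff w (by simpa using h0), od_alg]
    rw [OG_iff _ h0] at h
    gcongr

theorem exists_above (v : Pl K) : ∃ w : Pl M, und K w = v := by
  obtain ⟨Q, hQ1, hQ2⟩ := Ideal.exists_maximal_ideal_liesOver_of_isIntegral (S := 𝓞 M) v.asIdeal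
  refine ⟨⟨Q, hQ1.isPrime, ?_⟩, ?_⟩
  · rintro rfl
    apply v.ne_bot
    have := hQ2.over
    rw [this, Ideal.under_def]
    exact Ideal.comap_bot_of_injective _ (FaithfulSMul.algebraMap_injective _ _)
  · apply HeightOneSpectrum.ext
    exact hQ2.over.symm

theorem finite_above (v : Pl K) : {w : Pl M | und K w = v}.Finite := by
  have h := IsDedekindDomain.primesOver_finite v.asIdeal (𝓞 M)
  refine Set.Finite.of_finite_image (f := fun w : Pl M => w.asIdeal) (h.subset ?_) ?_
  · rintro _ ⟨w, hw, rfl⟩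
    refine ⟨w.isPrime, ⟨?_⟩⟩
    have : und K w = v := hw
    rw [← this]; rfl
  · intro a _ b _ hab; exact HeightOneSpectrum.ext hab

end ext
end

section
open Polynomial
set_option linter.all false
open IsDedekindDomain NumberField

section SUnits
variable {K : Type} [Field K] [NumberField K]

def PS (S : Finset (Pl K)) : Prop :=
  ∀ n : Pl K → ℤ, {v | n v ≠ 0}.Finite → ∃ a : K, a ≠ 0 ∧ ∀ v ∉ S, od v a = n v

theorem PS.mono {S T : Finset (Pl K)} (h : PS S) (hST : S ⊆ T) : PS T := by
  intro n hn
  obtain ⟨a, ha, h2⟩ := h n hn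
  exact ⟨a, ha, fun v hv => h2 v fun hS => hv (hST hS)⟩

theorem od_eq_of_span {I : Ideal (𝓞 K)} {a : 𝓞 K} (h : Ideal.span {a} = I) (ha : a ≠ 0) (v : Pl K) (n : ℕ)
    (h1 : v.asIdeal ^ n ∣ I) (h2 : ¬ v.asIdeal ^ (n + 1) ∣ I) : od v (a : K) = n := by
  have ha0 : (a : K) ≠ 0 := by exact_mod_cast ha
  rw [← h, Ideal.dvd_span_singleton, ← OG_pow_iff_mem, OG_iff v ha0] at h1 h2
  push_cast at h2
  omega

theorem pl_dvd_iff {v w : Pl K} (h : v.asIdeal ∣ w.asIdeal) : v = w := by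
  apply HeightOneSpectrum.ext
  exact (associated_iff_eq.1 (v.prime.associated_of_dvd w.prime h))

theorem exists_PS (T₀ : Finset (Pl K)) : ∃ S : Finset (Pl K), T₀ ⊆ S ∧ PS S := by
  classical
  choose I hI using ClassGroup.mk0_surjective (R := 𝓞 K)
  have hf : ∀ c, {v : Pl K | v.asIdeal ∣ (I c : Ideal (𝓞 K))}.Finite := fun c =>
    Ideal.finite_factors (nonZeroDivisors.ne_zero (I c).2)
  let S : Finset (Pl K) := T₀ ∪ Finset.univ.biUnion fun c => (hf c).toFinset
  refine ⟨S, Finset.subset_union_left, ?_⟩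
  have hS : ∀ v ∉ S, ∀ c, ¬ v.asIdeal ∣ (I c : Ideal (𝓞 K)) := by
    intro v hv c hd
    apply hv
    refine Finset.mem_union_right _ (Finset.mem_biUnion.2 ⟨c, Finset.mem_univ _, ?_⟩)
    simpa using hd
  have hone : ∀ v : Pl K, ∃ a : K, a ≠ 0 ∧ ∀ w ∉ S, od w a = if w = v then 1 else 0 := by
    intro v
    let c := ClassGroup.mk0 ⟨v.asIdeal, mem_nonZeroDivisors_of_ne_zero v.ne_bot⟩
    have h1 : ClassGroup.mk0 (I c⁻¹) = (ClassGroup.mk0 ⟨v.asIdeal, mem_nonZeroDivisors_of_ne_zero v.ne_bot⟩)⁻¹ := hI _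
    rw [ClassGroup.mk0_eq_mk0_inv_iff] at h1
    obtain ⟨x, hx, hx2⟩ := h1
    refine ⟨x, by exact_mod_cast hx, fun w hw => ?_⟩
    split_ifs with h
    · subst h
      refine (od_eq_of_span hx2.symm hx w 1 ?_ ?_).trans (by simp)
      · rw [pow_one]; exact Dvd.intro_left _ rfl
      · intro hd
        rw [pow_succ, pow_one] at hd
        exact hS w hw _ ((mul_dvd_mul_iff_right w.ne_bot).1 hd)
    · refine (od_eq_of_span hx2.symm hx w 0 ?_ ?_).trans (by simp)
      · simp
      · rw [zero_add, pow_one]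
        intro hd
        rcases w.prime.dvd_or_dvd hd with hd | hd
        · exact hS w hw _ hd
        · exact h (pl_dvd_iff hd)
  choose e he0 he using hone
  intro n hn
  refine ⟨∏ v ∈ hn.toFinset, e v ^ n v, Finset.prod_ne_zero_iff.2 fun v _ => zpow_ne_zero _ (he0 v), ?_⟩
  intro w hw
  have hp : ∀ T : Finset (Pl K), od w (∏ v ∈ T, e v ^ n v) = ∑ v ∈ T, if w = v then n v else 0 := by
    intro T
    induction T using Finset.induction_on with
    | empty => simp [od_one]
    | insert v T hv ih =>
      rw [Finset.prod_insert hv, Finset.sum_insert hv, od_mul w (zpow_ne_zero _ (he0 v))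
        (Finset.prod_ne_zero_iff.2 fun v _ => zpow_ne_zero _ (he0 v)), ih, od_zpow, he v w hw]
      simp
  rw [hp, Finset.sum_ite_eq]
  split_ifs with h
  · rfl
  · simp at h; exact h.symm

def SU (S : Finset (Pl K)) : Subgroup Kˣ where
  carrier := {x | ∀ v ∉ S, od v (x : K) = 0}
  one_mem' := fun v _ => by simpa using od_one v
  mul_mem' := fun {a b} ha hb v hv => by
    rw [Units.val_mul, od_mul v a.ne_zero b.ne_zero, ha v hv, hb v hv, add_zero]
  inv_mem' := fun {a} ha v hv => by
    rw [Units.val_inv_eq_inv_val, od_inv, ha v hv, neg_zero]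

theorem mem_SU {S : Finset (Pl K)} {x : Kˣ} : x ∈ SU S ↔ ∀ v ∉ S, od v (x : K) = 0 := Iff.rfl

theorem SU_mono {S T : Finset (Pl K)} (h : S ⊆ T) : SU S ≤ SU T :=
  fun x hx v hv => hx v fun h2 => hv (h h2)

noncomputable def SUval (S : Finset (Pl K)) : SU S →* Multiplicative (S → ℤ) where
  toFun x := Multiplicative.ofAdd fun v => od v.1 ((x : Kˣ) : K)
  map_one' := by
    apply Multiplicative.toAdd.injective
    funext v
    simpa using od_one v.1
  map_mul' x y := by
    apply Multiplicative.toAdd.injective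
    funext v
    simpa using od_mul v.1 (x : Kˣ).ne_zero (y : Kˣ).ne_zero

theorem od_unit (u : (𝓞 K)ˣ) (v : Pl K) : od v ((u : 𝓞 K) : K) = 0 := by
  refine (od_eq_zero_of_notMem v ?_).2
  intro h
  exact v.isPrime.ne_top (Ideal.eq_top_of_isUnit_mem _ h u.isUnit)

noncomputable def Uemb (S : Finset (Pl K)) : (𝓞 K)ˣ →* SU S :=
  (Units.map (algebraMap (𝓞 K) K : 𝓞 K →* K)).codRestrict (SU S) (fun u v _ => od_unit u v)

theorem Uemb_inj (S : Finset (Pl K)) : Function.Injective (Uemb S) := by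
  intro a b h
  have h1 : ((Uemb S a : Kˣ) : K) = ((Uemb S b : Kˣ) : K) := by rw [h]
  apply Units.ext
  have : ((a : 𝓞 K) : K) = ((b : 𝓞 K) : K) := h1
  exact_mod_cast this

theorem Uemb_range (S : Finset (Pl K)) : (Uemb S).range = (SUval S).ker := by
  ext x
  constructor
  · rintro ⟨u, rfl⟩
    rw [MonoidHom.mem_ker]
    apply Multiplicative.toAdd.injective
    funext v
    exact od_unit u v.1
  · intro hx
    rw [MonoidHom.mem_ker] at hx
    have h0 : ∀ v : Pl K, od v ((x : Kˣ) : K) = 0 := by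
      intro v
      by_cases hv : v ∈ S
      · exact congrFun (congrArg Multiplicative.toAdd hx) ⟨v, hv⟩
      · exact x.2 v hv
    obtain ⟨a, ha⟩ := int_of_OG (x := ((x : Kˣ) : K)) fun v => (OG_iff v (x : Kˣ).ne_zero).2 (h0 v).ge
    obtain ⟨b, hb⟩ := int_of_OG (x := ((x : Kˣ) : K)⁻¹) fun v =>
      (OG_iff v (inv_ne_zero (x : Kˣ).ne_zero)).2 (by rw [od_inv, h0 v]; rfl)
    have hab : a * b = 1 := by
      have : (a : K) * (b : K) = 1 := by rw [ha, hb]; exact mul_inv_cancel₀ (x : Kˣ).ne_zero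
      exact_mod_cast this
    refine ⟨⟨a, b, hab, by rw [mul_comm]; exact hab⟩, ?_⟩
    apply Subtype.ext
    apply Units.ext
    exact ha

theorem SU_fin (S : Finset (Pl K)) : Module.Finite ℤ (Additive (SU S)) := by
  haveI h1 : Module.Finite ℤ (Additive (SUval S).ker) := by
    rw [← Uemb_range]
    exact fin_congr (MonoidHom.ofInjective (Uemb_inj S))
  haveI : Module.Finite ℤ (Additive (Multiplicative (S → ℤ))) :=
    inferInstanceAs (Module.Finite ℤ (S → ℤ))
  exact fin_of_ker_range (SUval S)

instance (S : Finset (Pl K)) : Module.Finite ℤ (Additive (SU S)) := SU_fin S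

theorem exists_h_gen (v : Pl K) : ∃ (a : K), a ≠ 0 ∧ od v a = classNumber K ∧ ∀ w, w ≠ v → od w a = 0 := by
  have h0 : v.asIdeal ^ classNumber K ≠ 0 := pow_ne_zero _ v.ne_bot
  have h1 : ClassGroup.mk0 (⟨v.asIdeal ^ classNumber K, mem_nonZeroDivisors_of_ne_zero h0⟩ : nonZeroDivisors (Ideal (𝓞 K))) = 1 := by
    have : (⟨v.asIdeal ^ classNumber K, mem_nonZeroDivisors_of_ne_zero h0⟩ : nonZeroDivisors (Ideal (𝓞 K)))
      = ⟨v.asIdeal, mem_nonZeroDivisors_of_ne_zero v.ne_bot⟩ ^ classNumber K := rfl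
    rw [this, map_pow]
    exact pow_card_eq_one
  rw [ClassGroup.mk0_eq_one_iff] at h1
  obtain ⟨a, ha⟩ := h1
  have ha' : Ideal.span {a} = v.asIdeal ^ classNumber K := ha.symm
  have ha0 : a ≠ 0 := by
    rintro rfl
    apply h0
    rw [← ha']; simp
  refine ⟨a, by exact_mod_cast ha0, od_eq_of_span ha' ha0 v _ dvd_rfl ?_, fun w hw => ?_⟩
  · rw [pow_dvd_pow_iff v.ne_bot]
    · omega
    · exact v.prime.not_unit
  · refine (od_eq_of_span ha' ha0 w 0 (by simp) ?_).trans (by simp)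
    rw [zero_add, pow_one]
    intro hd
    exact hw (pl_dvd_iff (w.prime.dvd_of_dvd_pow hd))

theorem rk_SU (S : Finset (Pl K)) : rk (SU S) = S.card + Units.rank K := by
  classical
  rw [rk_ker_range (SUval S), ← Uemb_range, ← rk_congr (MonoidHom.ofInjective (Uemb_inj S))]
  have h1 : rk (𝓞 K)ˣ = Units.rank K := Units.finrank_eq K
  have h2 : rk (SUval S).range = S.card := by
    let g : Additive (SU S) →ₗ[ℤ] (S → ℤ) := (MonoidHom.toAdditive (SUval S)).toIntLinearMap
    have hg : rk (SUval S).range = Module.finrank ℤ (LinearMap.range g) := rfl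
    rw [hg]
    apply le_antisymm
    · refine (Submodule.finrank_le _).trans ?_
      simp
    · let L : (S → ℤ) →ₗ[ℤ] (S → ℤ) := (classNumber K : ℤ) • LinearMap.id
      have hL : Function.Injective L := by
        intro a b hab
        funext i
        have := congrFun hab i
        have h3 : (classNumber K : ℤ) * a i = (classNumber K : ℤ) * b i := this
        have h4 : (classNumber K : ℤ) ≠ 0 := by exact_mod_cast (classNumber_ne_zero K)
        exact mul_left_cancel₀ h4 h3
      have h3 : Module.finrank ℤ (LinearMap.range L) = S.card := by
        rw [LinearMap.finrank_range_of_inj hL]; simp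
      rw [← h3]
      apply Submodule.finrank_mono
      rintro _ ⟨n, rfl⟩
      have h5 : L n = ∑ i : S, n i • (Pi.single i (classNumber K : ℤ) : S → ℤ) := by
        funext j
        simp [L, Finset.sum_apply, Pi.single_apply, mul_comm]
      rw [h5]
      refine Submodule.sum_mem _ fun i _ => Submodule.smul_mem _ _ ?_
      obtain ⟨a, ha0, ha1, ha2⟩ := exists_h_gen i.1
      refine ⟨Additive.ofMul ⟨Units.mk0 a ha0, fun w hw => ha2 w fun h => hw (h ▸ i.2)⟩, ?_⟩
      funext j
      change od j.1 a = _
      by_cases hij : j = i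
      · subst hij; simp [ha1]
      · rw [ha2 _ fun h => hij (Subtype.ext h)]; simp [hij]
  rw [h1, h2, add_comm]

theorem sq_one_units (x : Kˣ) : x ^ 2 = 1 ↔ x = 1 ∨ x = -1 := by
  rw [Units.ext_iff, Units.ext_iff, Units.ext_iff]
  simp

theorem rank_TC (h : IsEmpty (K →+* ℝ)) : 2 * (Units.rank K + 1) = Module.finrank ℚ K := by
  classical
  have h1 := InfinitePlace.card_add_two_mul_card_eq_rank K
  have h2 : InfinitePlace.nrRealPlaces K = 0 := by
    rw [InfinitePlace.nrRealPlaces, Fintype.card_eq_zero_iff]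
    exact ⟨fun w => h.false (InfinitePlace.embedding_of_isReal w.2)⟩
  have h3 := InfinitePlace.card_eq_nrRealPlaces_add_nrComplexPlaces K
  have h4 : 0 < Module.finrank ℚ K := Module.finrank_pos
  rw [Units.rank]
  omega

end SUnits
end

section
open Polynomial
set_option linter.all false
open IsDedekindDomain NumberField

section Sq
variable {K : Type} [Field K] [NumberField K]

theorem four_ne (K : Type) [Field K] [NumberField K] : (4 : K) ≠ 0 := by norm_num
theorem two_ne (K : Type) [Field K] [NumberField K] : (2 : K) ≠ 0 := by norm_num

theorem od_two_nonneg (v : Pl K) : 0 ≤ od v (2:K) := by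
  have := OG_natCast v 2
  rw [OG_iff v (by norm_num)] at this
  exact_mod_cast this

theorem od_four (v : Pl K) : od v (4:K) = 2 * od v 2 := by
  have : (4:K) = 2 ^ 2 := by norm_num
  rw [this, od_pow]; norm_num

theorem od_four_nonneg (v : Pl K) : 0 ≤ od v (4:K) := by
  have := od_two_nonneg v
  rw [od_four]; omega

theorem one_add_unit (v : Pl K) {a : K} (h : OG v 1 a) : 1 + a ≠ 0 ∧ od v (1 + a) = 0 := by
  have := od_add_eq v (x := (1:K)) (y := a) one_ne_zero (by rw [od_one]; exact h)
  rwa [od_one] at this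

def SqV (v : Pl K) : Subgroup Kˣ where
  carrier := {x | ∃ y : Kˣ, OG v (od v 4 + 1) ((x : K) / (y : K) ^ 2 - 1)}
  one_mem' := ⟨1, by simpa using OG_zero v _⟩
  mul_mem' := by
    rintro a b ⟨y, hy⟩ ⟨z, hz⟩
    refine ⟨y * z, ?_⟩
    have h4 := od_four_nonneg v
    have hyz := (hy.mul hz).mono (m := od v 4 + 1) (by omega)
    have := (hy.add hz).add hyz
    convert this using 1
    have hy0 := y.ne_zero
    have hz0 := z.ne_zero
    push_cast
    field_simp
    ring
  inv_mem' := by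
    rintro a ⟨y, hy⟩
    refine ⟨y⁻¹, ?_⟩
    have h4 := od_four_nonneg v
    obtain ⟨h1, h2⟩ := one_add_unit v (hy.mono (m := 1) (by omega))
    have h3 := (hy.neg.mul (od_OG v (1 + ((a : K) / (y : K) ^ 2 - 1))⁻¹)).mono (m := od v 4 + 1)
      (by rw [od_inv, h2]; omega)
    convert h3 using 1
    have hy0 := y.ne_zero
    have ha0 := a.ne_zero
    push_cast
    have : (1 + ((a : K) / (y : K) ^ 2 - 1)) = (a : K) / (y : K) ^ 2 := by ring
    rw [this]
    field_simp
    ring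

theorem mem_SqV {v : Pl K} {x : Kˣ} :
    x ∈ SqV v ↔ ∃ y : Kˣ, OG v (od v 4 + 1) ((x : K) / (y : K) ^ 2 - 1) := Iff.rfl

theorem sq_mem_SqV (v : Pl K) (x : Kˣ) : x ^ 2 ∈ SqV v := by
  refine ⟨x, ?_⟩
  have : ((x ^ 2 : Kˣ) : K) / (x : K) ^ 2 - 1 = 0 := by
    have := x.ne_zero
    push_cast; field_simp; ring
  rw [this]; exact OG_zero _ _

theorem mem_SqV_of_OG {v : Pl K} {x : Kˣ} (h : OG v (od v 4 + 1) ((x : K) - 1)) : x ∈ SqV v :=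
  ⟨1, by simpa using h⟩

theorem even_of_SqV {v : Pl K} {x : Kˣ} (h : x ∈ SqV v) : ∃ k, od v (x : K) = 2 * k := by
  obtain ⟨y, hy⟩ := h
  have h4 := od_four_nonneg v
  obtain ⟨h1, h2⟩ := one_add_unit v (hy.mono (m := 1) (by omega))
  refine ⟨od v (y : K), ?_⟩
  have : (1 + ((x : K) / (y : K) ^ 2 - 1)) = (x : K) / (y : K) ^ 2 := by ring
  rw [this, od_div v x.ne_zero (pow_ne_zero 2 y.ne_zero), od_pow] at h2
  push_cast at h2
  omega

end Sq

section ext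
variable {K M : Type} [Field K] [NumberField K] [Field M] [NumberField M] [Algebra K M]

theorem SqV_alg (w : Pl M) {x : Kˣ} (h : x ∈ SqV (und K w)) :
    Units.map (algebraMap K M : K →* M) x ∈ SqV w := by
  obtain ⟨y, hy⟩ := h
  refine ⟨Units.map (algebraMap K M : K →* M) y, ?_⟩
  have h1 := OG_alg (M := M) w hy
  have h2 : od w (4 : M) = ram K w * od (und K w) (4 : K) := by
    rw [← od_alg, map_ofNat]
  have h3 := ram_pos (K := K) w
  rw [h2]
  have h4 : OG w (ram K w * od (und K w) (4:K) + 1) ((algebraMap K M) ((x : K) / (y : K) ^ 2 - 1)) := by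
    refine h1.mono ?_
    have : (1:ℤ) ≤ ram K w := by exact_mod_cast h3
    linarith
  simpa using h4

noncomputable def sgP (σ : M ≃+* M) (w : Pl M) : Pl M :=
  HeightOneSpectrum.comap (RingOfIntegers.mapRingEquiv σ) (RingOfIntegers.mapRingEquiv σ).surjective w

theorem od_sgP_int (σ : M ≃+* M) (w : Pl M) (a : 𝓞 M) (ha : (a : M) ≠ 0) :
    od (sgP σ w) (a : M) = od w (σ (a : M)) := by
  have hs : σ (a : M) ≠ 0 := by simpa using ha
  have h : ∀ n : ℕ, (n : ℤ) ≤ od (sgP σ w) (a : M) ↔ (n : ℤ) ≤ od w (σ (a : M)) := by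
    intro n
    rw [← OG_iff _ ha, ← OG_iff _ hs]
    have h1 := OG_pow_iff_mem w n (RingOfIntegers.mapRingEquiv σ a)
    rw [RingOfIntegers.mapRingEquiv_apply] at h1
    rw [h1, OG_pow_iff_mem]
    change a ∈ (w.asIdeal.comap (RingOfIntegers.mapRingEquiv σ)) ^ n ↔ a ∈ (w.asIdeal ^ n).comap (RingOfIntegers.mapRingEquiv σ)
    have e1 := Ideal.map_symm (I := w.asIdeal) (RingOfIntegers.mapRingEquiv σ)
    have e2 := Ideal.map_symm (I := w.asIdeal ^ n) (RingOfIntegers.mapRingEquiv σ)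
    have e3 := Ideal.map_pow ((RingOfIntegers.mapRingEquiv σ).symm : 𝓞 M →+* 𝓞 M) w.asIdeal n
    have e4 : (w.asIdeal.comap (RingOfIntegers.mapRingEquiv σ)) ^ n = (w.asIdeal ^ n).comap (RingOfIntegers.mapRingEquiv σ) := by
      rw [← e1, ← e2]; exact e3.symm
    rw [e4]
  have h1 := od_int_nonneg (sgP σ w) a
  have h2 : 0 ≤ od w (σ (a : M)) := by
    rw [← RingOfIntegers.mapRingEquiv_apply]; exact od_int_nonneg w _
  apply le_antisymm
  · have := (h (od (sgP σ w) (a : M)).toNat).1 (by omega)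
    omega
  · have := (h (od w (σ (a : M))).toNat).2 (by omega)
    omega

theorem od_sgP (σ : M ≃+* M) (w : Pl M) (x : M) : od (sgP σ w) x = od w (σ x) := by
  by_cases hx : x = 0
  · subst hx; rw [map_zero, od_zero, od_zero]
  obtain ⟨a, b, hb, rfl⟩ := IsFractionRing.div_surjective (A := 𝓞 M) x
  have hb0 : algebraMap (𝓞 M) M b ≠ 0 := by
    have := nonZeroDivisors.ne_zero hb
    simpa using this
  have ha0 : algebraMap (𝓞 M) M a ≠ 0 := by
    intro h; apply hx; rw [h, zero_div]
  rw [od_div _ ha0 hb0, _root_.map_div₀, od_div _ (by simpa using ha0) (by simpa using hb0)]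
  rw [od_sgP_int σ w a ha0, od_sgP_int σ w b hb0]

theorem und_sgP (σ : M ≃ₐ[K] M) (w : Pl M) : und K (sgP (σ : M ≃+* M) w) = und K w := by
  apply HeightOneSpectrum.ext
  ext a
  change RingOfIntegers.mapRingEquiv (σ : M ≃+* M) (algebraMap (𝓞 K) (𝓞 M) a) ∈ w.asIdeal ↔
    algebraMap (𝓞 K) (𝓞 M) a ∈ w.asIdeal
  have : RingOfIntegers.mapRingEquiv (σ : M ≃+* M) (algebraMap (𝓞 K) (𝓞 M) a) = algebraMap (𝓞 K) (𝓞 M) a := by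
    apply RingOfIntegers.ext
    exact σ.commutes (a : K)
  rw [this]

/-- places above a finite set -/
noncomputable def abv (M : Type) [Field M] [NumberField M] [Algebra K M] (S : Finset (Pl K)) : Finset (Pl M) :=
  (Set.Finite.biUnion (S.finite_toSet) (fun v _ => finite_above (M := M) v)).toFinset

theorem mem_abv {S : Finset (Pl K)} {w : Pl M} : w ∈ abv M S ↔ und K w ∈ S := by
  simp [abv]

structure QD (K M : Type) [Field K] [NumberField K] [Field M] [NumberField M] [Algebra K M] (u : K) where
  r : M
  hr : r ^ 2 = algebraMap K M u
  σ : M ≃ₐ[K] M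
  hσ : σ r = - r
  hσσ : ∀ x, σ (σ x) = x
  sp : ∀ x : M, ∃ c d : K, x = algebraMap K M c + algebraMap K M d * r
  fr : Module.finrank K M = 2
  ns : ∀ y : K, y ^ 2 ≠ u

variable {u : K}

theorem QD.r_ne (Q : QD K M u) : Q.r ≠ 0 := by
  intro h
  have := Q.hr
  rw [h, zero_pow two_ne_zero] at this
  have h2 : u = 0 := by
    have := this.symm
    simpa using this
  exact Q.ns 0 (by rw [h2]; norm_num)

theorem QD.u_ne (Q : QD K M u) : u ≠ 0 := by
  rintro rfl
  exact Q.ns 0 (by norm_num)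

theorem QD.norm_eq (Q : QD K M u) (c d : K) : (algebraMap K M c + algebraMap K M d * Q.r) * Q.σ (algebraMap K M c + algebraMap K M d * Q.r)
    = algebraMap K M (c ^ 2 - u * d ^ 2) := by
  rw [map_add, map_mul, AlgEquiv.commutes, AlgEquiv.commutes, Q.hσ]
  have := Q.hr
  rw [map_sub, map_mul, map_pow, map_pow, ← this]
  ring

theorem QD.sg_ne (Q : QD K M u) {x : M} (h : x ≠ 0) : Q.σ x ≠ 0 := by simpa using h

theorem QD.fixed (Q : QD K M u) {x : M} (h : Q.σ x = x) : ∃ c : K, x = algebraMap K M c := by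
  obtain ⟨c, d, rfl⟩ := Q.sp x
  refine ⟨c, ?_⟩
  rw [map_add, map_mul, AlgEquiv.commutes, AlgEquiv.commutes, Q.hσ] at h
  have h2 : (2 : M) * (algebraMap K M d * Q.r) = 0 := by linear_combination -h
  have h3 : algebraMap K M d * Q.r = 0 := by
    rcases mul_eq_zero.1 h2 with h | h
    · exact absurd h (two_ne M)
    · exact h
  rw [h3, add_zero]

theorem QD.split (Q : QD K M u) {v : Pl K} {uu : Kˣ} (huu : (uu : K) = u) (h : uu ∈ SqV v) :
    ∃ w w' : Pl M, w ≠ w' ∧ und K w = v ∧ und K w' = v := by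
  obtain ⟨w, hw⟩ := exists_above (M := M) v
  refine ⟨w, sgP (Q.σ : M ≃+* M) w, ?_, hw, by rw [und_sgP, hw]⟩
  intro hE
  have hsig : ∀ x : M, od w (Q.σ x) = od w x := by
    intro x
    have := od_sgP (Q.σ : M ≃+* M) w x
    rw [← hE] at this
    exact this.symm
  obtain ⟨y, hy⟩ := h
  rw [huu] at hy
  set c : K := (u / (y : K) ^ 2 - 1) / 4 with hc
  have hc1 : OG v 1 c := by
    have := hy.mul (od_OG v ((4:K)⁻¹))
    rw [← div_eq_mul_inv] at this
    refine this.mono ?_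
    rw [od_inv]; omega
  have hy0 := y.ne_zero
  have hc0 : c ≠ 0 := by
    intro h0
    rw [hc] at h0
    have h1 : u / (y : K) ^ 2 - 1 = 0 := by
      rcases div_eq_zero_iff.1 h0 with h | h
      · exact h
      · exact absurd h (four_ne K)
    apply Q.ns y
    field_simp at h1
    linear_combination -h1
  set d : K := (2 * (y : K))⁻¹ with hd
  set t : M := algebraMap K M (1/2) + algebraMap K M d * Q.r with ht
  have hN : t * Q.σ t = algebraMap K M (-c) := by
    rw [ht, Q.norm_eq]
    congr 1
    rw [hc, hd]
    field_simp
    ring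
  have hT : t + Q.σ t = 1 := by
    rw [ht, map_add, map_mul, AlgEquiv.commutes, AlgEquiv.commutes, Q.hσ]
    have : algebraMap K M (1/2) + algebraMap K M (1/2) = 1 := by
      rw [← map_add]; norm_num
    linear_combination this
  have ht0 : t ≠ 0 := by
    intro h0
    rw [h0, zero_mul] at hN
    have : -c = 0 := by
      have := hN.symm
      simpa using this
    exact hc0 (by simpa using this)
  have h1 : od w t + od w t = ram K w * od v c := by
    rw [← hw, ← od_neg (und K w), ← od_alg, ← hN, od_mul w ht0 (Q.sg_ne ht0), hsig]
  have h2 : 1 ≤ od v c := (OG_iff v hc0).1 hc1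
  have h3 : (1:ℤ) ≤ ram K w := by exact_mod_cast ram_pos (K := K) w
  have h4 : 1 ≤ od w t := by nlinarith
  have h5 : OG w 1 (t + Q.σ t) := by
    refine OG.add ((OG_iff w ht0).2 h4) ((OG_iff w (Q.sg_ne ht0)).2 ?_)
    rw [hsig]; exact h4
  rw [hT, OG_iff w one_ne_zero, od_one] at h5
  omega

theorem QD.card_abv (Q : QD K M u) {uu : Kˣ} (huu : (uu : K) = u) (S S₀ : Finset (Pl K)) (h0 : S₀ ⊆ S)
    (h : ∀ v ∈ S, v ∉ S₀ → uu ∈ SqV v) : 2 * S.card ≤ (abv M S).card + S₀.card := by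
  classical
  have h1 : (abv M S).card = ∑ v ∈ S, ((abv M S).filter fun w => und K w = v).card :=
    Finset.card_eq_sum_card_fiberwise fun w hw => mem_abv.1 hw
  have h2 : ∀ v ∈ S, 2 ≤ ((abv M S).filter fun w => und K w = v).card + if v ∈ S₀ then 1 else 0 := by
    intro v hv
    split_ifs with hv0
    · obtain ⟨w, hw⟩ := exists_above (M := M) v
      have : 0 < ((abv M S).filter fun w => und K w = v).card :=
        Finset.card_pos.2 ⟨w, by simp [mem_abv, hw, hv]⟩
      omega
    · obtain ⟨w, w', hne, hw, hw'⟩ := Q.split huu (h v hv hv0)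
      have : 1 < ((abv M S).filter fun w => und K w = v).card :=
        Finset.one_lt_card.2 ⟨w, by simp [mem_abv, hw, hv], w', by simp [mem_abv, hw', hv], hne⟩
      omega
  have h3 := Finset.sum_le_sum h2
  rw [Finset.sum_add_distrib, ← h1, ← Finset.sum_filter_add_sum_filter_not S (· ∈ S₀) (fun v => if v ∈ S₀ then 1 else 0)] at h3
  have h4 : (S.filter (· ∈ S₀)) = S₀ := by
    ext v; simp; exact fun h => h0 h
  rw [h4, Finset.sum_congr rfl (fun v hv => if_pos hv), Finset.sum_congr (s₁ := S.filter (¬ · ∈ S₀)) rfl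
    (fun v hv => if_neg (by simpa using (Finset.mem_filter.1 hv).2))] at h3
  simp at h3
  omega

theorem QD.key (Q : QD K M u) {S : Finset (Pl K)} (hd : ∀ v ∉ S, od v (2:K) = 0) (hu : ∀ v ∉ S, od v u = 0)
    {γ : M} (hγ : γ ≠ 0) (hβ : ∀ w ∉ abv M S, od w (Q.σ γ) = od w γ) {N : K}
    (hN : γ * Q.σ γ = algebraMap K M N) (w : Pl M) (hw : w ∉ abv M S) :
    ∃ k, od (und K w) N = 2 * k := by
  have hv : und K w ∉ S := fun h => hw (mem_abv.2 h)
  obtain ⟨c, d, hcd⟩ := Q.sp γ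
  have hr0 : od w Q.r = 0 := by
    have h1 : od w (Q.r ^ 2) = 0 := by rw [Q.hr, od_alg, hu _ hv, mul_zero]
    rw [od_pow] at h1
    push_cast at h1; omega
  have h20 : od w (2:M) = 0 := by
    have : (2:M) = algebraMap K M 2 := by rw [map_ofNat]
    rw [this, od_alg, hd _ hv, mul_zero]
  have hsγ : Q.σ γ = algebraMap K M c - algebraMap K M d * Q.r := by
    rw [hcd, map_add, map_mul, AlgEquiv.commutes, AlgEquiv.commutes, Q.hσ]; ring
  have g1 := od_OG w γ
  have g2 := od_OG w (Q.σ γ)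
  rw [hβ w hw] at g2
  have gc : OG w (od w γ) (algebraMap K M c) := by
    have := (g1.add g2).mul (od_OG w (2:M)⁻¹)
    rw [od_inv, h20] at this
    convert this using 1
    · ring
    · rw [hsγ, hcd]; field_simp; ring
  have gd : OG w (od w γ) (algebraMap K M d) := by
    have := (g1.sub g2).mul (od_OG w (2 * Q.r)⁻¹)
    rw [od_inv, od_mul w (two_ne M) Q.r_ne, h20, hr0] at this
    convert this using 1
    · ring
    · have := Q.r_ne
      rw [hsγ, hcd]; field_simp; ring
  have hρ : (1:ℤ) ≤ ram K w := by exact_mod_cast ram_pos (K := K) w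
  have hex : ∃ m, od w γ = ram K w * m := by
    by_contra hcon
    push Not at hcon
    have up : ∀ x : K, OG w (od w γ) (algebraMap K M x) → OG w (od w γ + 1) (algebraMap K M x) := by
      intro x hx
      by_cases h0 : x = 0
      · rw [h0, map_zero]; exact OG_zero _ _
      have h0' : algebraMap K M x ≠ 0 := by simpa using h0
      rw [OG_iff w h0', od_alg] at hx ⊢
      have := hcon (od (und K w) x)
      omega
    have : OG w (od w γ + 1) γ := by
      have e2 := (up d gd).mul (od_OG w Q.r)
      rw [hr0, add_zero] at e2
      have := (up c gc).add e2
      rwa [← hcd] at this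
    rw [OG_iff w hγ] at this
    omega
  obtain ⟨m, hm⟩ := hex
  refine ⟨m, ?_⟩
  have h1 : od w γ + od w γ = ram K w * od (und K w) N := by
    rw [← od_alg, ← hN, od_mul w hγ (Q.sg_ne hγ), hβ w hw]
  rw [hm] at h1
  have : (ram K w : ℤ) * (od (und K w) N) = ram K w * (2 * m) := by linarith
  exact mul_left_cancel₀ (by omega) this

/-- norm subgroup -/
def NK (u : K) : Subgroup Kˣ where
  carrier := {x | ∃ c d : K, (x : K) = c ^ 2 - u * d ^ 2}
  one_mem' := ⟨1, 0, by simp⟩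
  mul_mem' := by
    rintro a b ⟨c, d, h⟩ ⟨c', d', h'⟩
    refine ⟨c * c' + u * d * d', c * d' + c' * d, ?_⟩
    rw [Units.val_mul, h, h']; ring
  inv_mem' := by
    rintro a ⟨c, d, h⟩
    refine ⟨c / a, d / a, ?_⟩
    have ha := a.ne_zero
    rw [Units.val_inv_eq_inv_val]
    field_simp
    exact h

theorem QD.SU_alg (Q : QD K M u) {S : Finset (Pl K)} {x : Kˣ} :
    Units.map (algebraMap K M : K →* M) x ∈ SU (abv M S) ↔ x ∈ SU S := by
  constructor
  · intro h v hv
    obtain ⟨w, hw⟩ := exists_above (M := M) v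
    have h1 : od w (algebraMap K M (x : K)) = 0 := h w (by rw [mem_abv, hw]; exact hv)
    rw [od_alg, hw] at h1
    rcases mul_eq_zero.1 h1 with h | h
    · have := ram_pos (K := K) w
      omega
    · exact h
  · intro h w hw
    change od w (algebraMap K M (x : K)) = 0
    rw [od_alg, h _ (fun h => hw (mem_abv.2 h)), mul_zero]

theorem QD.sig_mem (Q : QD K M u) {S : Finset (Pl K)} {x : Mˣ} (hx : x ∈ SU (abv M S)) :
    Units.map ((Q.σ : M ≃+* M) : M →* M) x ∈ SU (abv M S) := by
  intro w hw
  change od w (Q.σ (x : M)) = 0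
  have := od_sgP (Q.σ : M ≃+* M) w (x : M)
  have h2 : od w (Q.σ (x : M)) = od (sgP (Q.σ : M ≃+* M) w) (x : M) := this.symm
  rw [h2]
  apply hx
  rw [mem_abv, und_sgP, ← mem_abv]
  exact hw

theorem QD.stepA (Q : QD K M u) (hTC : IsEmpty (K →+* ℝ)) {uu : Kˣ} (huu : (uu : K) = u) (S S₀ : Finset (Pl K)) (h0 : S₀ ⊆ S)
    (hPS : PS S) (hd : ∀ v ∉ S, od v (2:K) = 0) (hu : ∀ v ∉ S, od v u = 0)
    (h : ∀ v ∈ S, v ∉ S₀ → uu ∈ SqV v) :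
    (NK u).relIndex (SU S) ≠ 0 ∧ 2 * (NK u).relIndex (SU S) ≤ 2 ^ S₀.card := by
  classical
  let A := SU (abv M S)
  let σA : A →* A :=
    ((Units.map ((Q.σ : M ≃+* M) : M →* M)).comp A.subtype).codRestrict A (fun x => Q.sig_mem x.2)
  have hσA : ∀ x : A, (((σA x : A) : Mˣ) : M) = Q.σ ((x : Mˣ) : M) := fun x => rfl
  have hext : ∀ x y : A, ((x : Mˣ) : M) = ((y : Mˣ) : M) → x = y := fun x y h =>
    Subtype.ext (Units.ext h)
  let i : SU S →* A := ((Units.map (algebraMap K M : K →* M)).comp (SU S).subtype).codRestrict A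
    (fun x => Q.SU_alg.2 x.2)
  have hi : ∀ x : SU S, (((i x : A) : Mˣ) : M) = algebraMap K M ((x : Kˣ) : K) := fun x => rfl
  have hiinj : Function.Injective i := by
    intro x y hxy
    have : algebraMap K M ((x : Kˣ) : K) = algebraMap K M ((y : Kˣ) : K) := by
      rw [← hi, ← hi, hxy]
    exact Subtype.ext (Units.ext ((algebraMap K M).injective this))
  have hB : ∀ x, x ∈ i.range ↔ σA x = x := by
    intro x
    constructor
    · rintro ⟨y, rfl⟩
      apply hext
      rw [hσA, hi, AlgEquiv.commutes]
    · intro hx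
      have : Q.σ ((x : Mˣ) : M) = ((x : Mˣ) : M) := by rw [← hσA, hx]
      obtain ⟨c, hc⟩ := Q.fixed this
      have hc0 : c ≠ 0 := by
        rintro rfl
        apply (x : Mˣ).ne_zero; rw [hc, map_zero]
      have hx2 : (x : Mˣ) = Units.map (algebraMap K M : K →* M) (Units.mk0 c hc0) := Units.ext hc
      have hm : Units.mk0 c hc0 ∈ SU S := by
        rw [← Q.SU_alg, ← hx2]; exact x.2
      refine ⟨⟨_, hm⟩, ?_⟩
      apply hext
      rw [hi, hc]; rfl
  have hm1 : (-1 : Mˣ) ∈ A := by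
    intro w hw
    rw [Units.val_neg, Units.val_one, od_neg, od_one]
  have H := pr_herbrand σA (fun x => hext _ _ (by rw [hσA, hσA, Q.hσσ])) ⟨-1, hm1⟩ (by
      intro h
      have := congrArg (fun x : A => ((x : Mˣ) : M)) h
      simp at this
      have h2 : (2:M) = 0 := by linear_combination -this
      exact two_ne M h2) (by
      intro x
      have := sq_one_units (x : Mˣ)
      rw [Subtype.ext_iff, Subtype.ext_iff, Subtype.ext_iff]
      exact this) (by
      apply hext
      rw [hσA]
      simp) i.range hB (by
      intro x hx
      have hx' : ((x : Mˣ) : M) * Q.σ ((x : Mˣ) : M) = 1 := by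
        rw [← hσA]
        have := congrArg (fun x : A => ((x : Mˣ) : M)) hx
        simpa using this
      have hxg : ∃ γ : M, γ ≠ 0 ∧ γ = ((x : Mˣ) : M) * Q.σ γ := by
        by_cases hx1 : ((x : Mˣ) : M) = -1
        · exact ⟨Q.r, Q.r_ne, by rw [hx1, Q.hσ]; ring⟩
        · refine ⟨1 + ((x : Mˣ) : M), fun h => hx1 (by linear_combination h), ?_⟩
          rw [map_add, map_one, mul_add, hx']; ring
      obtain ⟨γ, hγ, hγx⟩ := hxg
      have hβ : ∀ w ∉ abv M S, od w (Q.σ γ) = od w γ := by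
        intro w hw
        conv_rhs => rw [hγx, od_mul w (x : Mˣ).ne_zero (Q.sg_ne hγ), x.2 w hw, zero_add]
      obtain ⟨N, hN⟩ := Q.fixed (x := γ * Q.σ γ) (by rw [map_mul, Q.hσσ, mul_comm])
      have hN0 : N ≠ 0 := by
        rintro rfl
        rw [map_zero] at hN
        exact mul_ne_zero hγ (Q.sg_ne hγ) hN
      have hev := Q.key hd hu hγ hβ hN
      obtain ⟨a, ha0, ha⟩ := hPS (fun v => od v N / 2) ((finite_supp hN0).subset (by
        intro v hv h0
        apply hv
        simp [h0]))
      have hymem : Units.mk0 (γ / algebraMap K M a) (div_ne_zero hγ (by simpa using ha0)) ∈ A := by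
        intro w hw
        have hv : und K w ∉ S := fun h => hw (mem_abv.2 h)
        change od w (γ / algebraMap K M a) = 0
        rw [od_div w hγ (by simpa using ha0), od_alg, ha _ hv]
        obtain ⟨k, hk⟩ := hev w hw
        have h1 : od w γ + od w γ = ram K w * od (und K w) N := by
          rw [← od_alg, ← hN, od_mul w hγ (Q.sg_ne hγ), hβ w hw]
        rw [hk] at h1 ⊢
        have h2 : (2 * k) / 2 = k := by omega
        rw [h2]
        linarith
      refine ⟨⟨_, hymem⟩, ?_⟩
      rw [eq_div_iff_mul_eq']
      apply hext
      change ((x : Mˣ) : M) * Q.σ (γ / algebraMap K M a) = γ / algebraMap K M a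
      rw [_root_.map_div₀, AlgEquiv.commutes]
      conv_rhs => rw [hγx]
      ring)
  have hle : ((MonoidHom.id A * σA).range).comap i ≤ (NK u).subgroupOf (SU S) := by
    rintro x ⟨y, hy⟩
    obtain ⟨c, d, hcd⟩ := Q.sp ((y : Mˣ) : M)
    refine ⟨c, d, ?_⟩
    have h1 : ((y : Mˣ) : M) * Q.σ ((y : Mˣ) : M) = algebraMap K M ((x : Kˣ) : K) := by
      rw [← hi, ← hy]; rfl
    rw [hcd, Q.norm_eq] at h1
    exact ((algebraMap K M).injective h1).symm
  have hidx : ((MonoidHom.id A * σA).range).relIndex i.range = (((MonoidHom.id A * σA).range).comap i).index := by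
    rw [← Subgroup.relIndex_top_right, Subgroup.relIndex_comap, ← MonoidHom.range_eq_map]
  have hdvd := Subgroup.index_dvd_of_le hle
  rw [hidx] at H
  have hrB : rk i.range = rk (SU S) := (rk_congr (MonoidHom.ofInjective hiinj)).symm
  have hrA : rk A = (abv M S).card + Units.rank M := rk_SU (abv M S)
  rw [hrB, hrA, rk_SU] at H
  set X := (((MonoidHom.id A * σA).range).comap i).index with hX
  have hX0 : X ≠ 0 := by
    intro h0
    rw [h0, zero_mul] at H
    exact absurd H.symm (by positivity)
  have hTCM : IsEmpty (M →+* ℝ) := ⟨fun φ => hTC.false (φ.comp (algebraMap K M))⟩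
  have r1 := rank_TC hTC
  have r2 := rank_TC hTCM
  have r3 := Module.finrank_mul_finrank ℚ K M
  rw [Q.fr] at r3
  have r4 : Units.rank M = 2 * Units.rank K + 1 := by omega
  have hcard := Q.card_abv huu S S₀ h0 h
  have hX2 : 2 * X ≤ 2 ^ S₀.card := by
    have h1 : 2 * X * 2 ^ ((abv M S).card + 2 * Units.rank K) = 2 ^ (2 * (S.card + Units.rank K)) := by
      rw [← H, r4]; ring
    have h2 : 2 ^ (2 * (S.card + Units.rank K)) ≤ 2 ^ S₀.card * 2 ^ ((abv M S).card + 2 * Units.rank K) := by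
      rw [← pow_add]
      exact Nat.pow_le_pow_right (by norm_num) (by omega)
    rw [← h1] at h2
    exact Nat.le_of_mul_le_mul_right h2 (by positivity)
  have hle2 : (NK u).relIndex (SU S) ≤ X := Nat.le_of_dvd (Nat.pos_of_ne_zero hX0) hdvd
  refine ⟨?_, by omega⟩
  intro h0
  apply hX0
  have : (NK u).relIndex (SU S) ∣ X := hdvd
  rw [h0] at this
  exact zero_dvd_iff.1 this

end ext

theorem exists_QD {K : Type} [Field K] [NumberField K] (u : K) (ns : ∀ y : K, y ^ 2 ≠ u) :
    ∃ (M : Type) (_ : Field M) (_ : NumberField M) (_ : Algebra K M), Nonempty (QD K M u) := by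
  have hirr : Irreducible (X ^ 2 - C u : K[X]) := by
    refine X_pow_sub_C_irreducible_of_prime Nat.prime_two ns
  haveI : Fact (Irreducible (X ^ 2 - C u : K[X])) := ⟨hirr⟩
  have hm : (X ^ 2 - C u : K[X]).Monic := monic_X_pow_sub_C u two_ne_zero
  let M := AdjoinRoot (X ^ 2 - C u : K[X])
  haveI : Module.Finite K M := hm.finite_adjoinRoot
  haveI : CharZero M := charZero_of_injective_algebraMap (algebraMap K M).injective
  haveI : Module.Finite ℚ M := Module.Finite.trans K M
  haveI : NumberField M := ⟨⟩
  have hr : (AdjoinRoot.root (X ^ 2 - C u : K[X])) ^ 2 = algebraMap K M u := by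
    have := AdjoinRoot.eval₂_root (X ^ 2 - C u : K[X])
    rw [eval₂_sub, eval₂_pow, eval₂_X, eval₂_C, sub_eq_zero] at this
    exact this
  let f : M →ₐ[K] M := AdjoinRoot.liftAlgHom (X ^ 2 - C u : K[X]) (Algebra.ofId K M) (- AdjoinRoot.root _) (by
    rw [eval₂_sub, eval₂_pow, eval₂_X, eval₂_C, sub_eq_zero, neg_sq, hr]; rfl)
  have hf : f (AdjoinRoot.root _) = - AdjoinRoot.root _ := by
    exact AdjoinRoot.liftAlgHom_root _ _ _ _
  have hff : f.comp f = AlgHom.id K M := by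
    apply AdjoinRoot.algHom_ext
    change f (f (AdjoinRoot.root _)) = AdjoinRoot.root _
    rw [hf, map_neg, hf, neg_neg]
  refine ⟨M, inferInstance, inferInstance, inferInstance, ⟨⟨AdjoinRoot.root _, hr, AlgEquiv.ofAlgHom f f hff hff, hf,
    fun x => AlgHom.congr_fun hff x, ?_, ?_, ns⟩⟩⟩
  · intro x
    obtain ⟨g, rfl⟩ := AdjoinRoot.mk_surjective x
    have h1 : AdjoinRoot.mk (X ^ 2 - C u : K[X]) g = AdjoinRoot.mk _ (g %ₘ (X ^ 2 - C u)) := by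
      conv_lhs => rw [← modByMonic_add_div g (X ^ 2 - C u : K[X])]
      rw [map_add, map_mul, AdjoinRoot.mk_self, zero_mul, add_zero]
    have h2 : (g %ₘ (X ^ 2 - C u)).natDegree ≤ 1 := by
      have := natDegree_modByMonic_lt g hm (by
        intro h
        have := congrArg natDegree h
        rw [natDegree_X_pow_sub_C, natDegree_one] at this
        omega)
      rw [natDegree_X_pow_sub_C] at this
      omega
    obtain ⟨a, b, hab⟩ := exists_eq_X_add_C_of_natDegree_le_one h2
    refine ⟨b, a, ?_⟩
    rw [h1, hab, map_add, map_mul, AdjoinRoot.mk_X, AdjoinRoot.mk_C, AdjoinRoot.mk_C, add_comm]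
    rfl
  · rw [PowerBasis.finrank (AdjoinRoot.powerBasis hm.ne_zero), AdjoinRoot.powerBasis_dim, natDegree_X_pow_sub_C]

theorem stepA {K : Type} [Field K] [NumberField K] (hTC : IsEmpty (K →+* ℝ)) (u : Kˣ) (ns : ∀ y : K, y ^ 2 ≠ u)
    (S S₀ : Finset (Pl K)) (h0 : S₀ ⊆ S)
    (hPS : PS S) (hd : ∀ v ∉ S, od v (2:K) = 0) (hu : ∀ v ∉ S, od v (u : K) = 0)
    (h : ∀ v ∈ S, v ∉ S₀ → u ∈ SqV v) :
    (NK (u : K)).relIndex (SU S) ≠ 0 ∧ 2 * (NK (u : K)).relIndex (SU S) ≤ 2 ^ S₀.card := by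
  obtain ⟨M, _, _, _, ⟨Q⟩⟩ := exists_QD (u : K) ns
  exact Q.stepA hTC rfl S S₀ h0 hPS hd hu h
end

section
open Polynomial
set_option linter.all false
open IsDedekindDomain NumberField

section W
variable {K : Type} [Field K] [NumberField K]

def UV (v : Pl K) : Subgroup Kˣ where
  carrier := {x | od v (x : K) = 0}
  one_mem' := by simpa using od_one v
  mul_mem' := fun {a b} ha hb => by
    have h1 : od v (a : K) = 0 := ha
    have h2 : od v (b : K) = 0 := hb
    change od v ((a * b : Kˣ) : K) = 0
    rw [Units.val_mul, od_mul v a.ne_zero b.ne_zero, h1, h2, add_zero]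
  inv_mem' := fun {a} ha => by
    have h1 : od v (a : K) = 0 := ha
    change od v ((a⁻¹ : Kˣ) : K) = 0
    rw [Units.val_inv_eq_inv_val, od_inv, h1, neg_zero]

theorem mem_UV {v : Pl K} {x : Kˣ} : x ∈ UV v ↔ od v (x : K) = 0 := Iff.rfl

noncomputable def Nm (v : Pl K) : ℕ := Ideal.absNorm v.asIdeal

theorem card_quot_pow (v : Pl K) (n : ℕ) : Nat.card (𝓞 K ⧸ v.asIdeal ^ n) = Nm v ^ n := by
  have := map_pow (Ideal.absNorm (S := 𝓞 K)) v.asIdeal n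
  rw [Nm, ← this, Ideal.absNorm_apply]
  rfl

theorem Nm_pos (v : Pl K) : 0 < Nm v := by
  refine Nat.pos_of_ne_zero ?_
  rw [Nm, Ne, Ideal.absNorm_eq_zero_iff]
  exact v.ne_bot

theorem card_G2 (v : Pl K) (e : ℕ) (he : od v (2:K) = e) :
    Nat.card (sqh (𝓞 K ⧸ v.asIdeal ^ (2 * e + 1))ˣ).ker ≤ 2 * Nm v ^ e := by
  classical
  have hle : v.asIdeal ^ (2 * e + 1) ≤ v.asIdeal ^ (e + 1) := Ideal.pow_le_pow_right (by omega)
  let π : (𝓞 K ⧸ v.asIdeal ^ (2 * e + 1)) →+* (𝓞 K ⧸ v.asIdeal ^ (e + 1)) := Ideal.Quotient.factor hle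
  have hπs : Function.Surjective π := Ideal.Quotient.factor_surjective hle
  haveI : Finite (𝓞 K ⧸ v.asIdeal ^ (2 * e + 1)) := by
    apply Nat.finite_of_card_ne_zero; rw [card_quot_pow]; exact (pow_pos (Nm_pos v) _).ne'
  have hk : Nat.card (RingHom.ker π) = Nm v ^ e := by
    have h1 := AddSubgroup.card_mul_index (π : (𝓞 K ⧸ v.asIdeal ^ (2 * e + 1)) →+ (𝓞 K ⧸ v.asIdeal ^ (e + 1))).ker
    rw [AddSubgroup.index_ker, card_quot_pow] at h1
    have h2 : Nat.card (π : (𝓞 K ⧸ v.asIdeal ^ (2 * e + 1)) →+ (𝓞 K ⧸ v.asIdeal ^ (e + 1))).range = Nm v ^ (e + 1) := by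
      have h9 : (π : (𝓞 K ⧸ v.asIdeal ^ (2 * e + 1)) →+ (𝓞 K ⧸ v.asIdeal ^ (e + 1))).range = ⊤ :=
        AddMonoidHom.range_eq_top.2 hπs
      rw [h9, AddSubgroup.card_top, card_quot_pow]
    rw [h2] at h1
    have h3 : Nat.card (RingHom.ker π) * Nm v ^ (e + 1) = Nm v ^ e * Nm v ^ (e + 1) := by
      rw [← pow_add]; rw [show e + (e + 1) = 2 * e + 1 by ring]; exact h1
    exact Nat.eq_of_mul_eq_mul_right (pow_pos (Nm_pos v) _) h3
  have hpm : ∀ x : (sqh (𝓞 K ⧸ v.asIdeal ^ (2 * e + 1))ˣ).ker,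
      π ((x : (𝓞 K ⧸ v.asIdeal ^ (2 * e + 1))ˣ) : 𝓞 K ⧸ v.asIdeal ^ (2 * e + 1)) = 1 ∨
      π ((x : (𝓞 K ⧸ v.asIdeal ^ (2 * e + 1))ˣ) : 𝓞 K ⧸ v.asIdeal ^ (2 * e + 1)) = -1 := by
    rintro ⟨x, hx⟩
    have hx2 : x ^ 2 = 1 := hx
    have hx3 : (x : 𝓞 K ⧸ v.asIdeal ^ (2 * e + 1)) ^ 2 = 1 := congrArg Units.val hx2
    change π (x : 𝓞 K ⧸ v.asIdeal ^ (2 * e + 1)) = 1 ∨ π (x : 𝓞 K ⧸ v.asIdeal ^ (2 * e + 1)) = -1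
    obtain ⟨a, ha⟩ := Ideal.Quotient.mk_surjective (x : 𝓞 K ⧸ v.asIdeal ^ (2 * e + 1))
    rw [← ha] at hx3 ⊢
    have h1 : a ^ 2 - 1 ∈ v.asIdeal ^ (2 * e + 1) := by
      rw [← Ideal.Quotient.eq_zero_iff_mem, map_sub, map_pow, hx3, map_one, sub_self]
    have h2 : π (Ideal.Quotient.mk _ a) = Ideal.Quotient.mk _ a := Ideal.Quotient.factor_mk hle a
    rw [h2]
    by_contra hcon
    push Not at hcon
    have h3 : a - 1 ∉ v.asIdeal ^ (e + 1) := by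
      intro h; apply hcon.1
      rw [← map_one (Ideal.Quotient.mk (v.asIdeal ^ (e + 1))), Ideal.Quotient.eq]; exact h
    have h4 : a + 1 ∉ v.asIdeal ^ (e + 1) := by
      intro h; apply hcon.2
      rw [← map_one (Ideal.Quotient.mk (v.asIdeal ^ (e + 1))), ← map_neg, Ideal.Quotient.eq, sub_neg_eq_add]; exact h
    have h5 : ((a - 1 : 𝓞 K) : K) ≠ 0 := by
      intro h
      have : a - 1 = 0 := RingOfIntegers.ext h
      apply h3; rw [this]; exact Ideal.zero_mem _
    have h6 : ((a + 1 : 𝓞 K) : K) ≠ 0 := by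
      intro h
      have : a + 1 = 0 := RingOfIntegers.ext h
      apply h4; rw [this]; exact Ideal.zero_mem _
    rw [← OG_pow_iff_mem, OG_iff v h5] at h3
    rw [← OG_pow_iff_mem, OG_iff v h6] at h4
    have h7 : a ^ 2 - 1 = (a - 1) * (a + 1) := by ring
    have h8 : (((a - 1) * (a + 1) : 𝓞 K) : K) = ((a - 1 : 𝓞 K) : K) * ((a + 1 : 𝓞 K) : K) := rfl
    rw [h7, ← OG_pow_iff_mem, h8, OG_iff v (mul_ne_zero h5 h6), od_mul v h5 h6] at h1
    push_cast at h1 h3 h4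
    omega
  let F : (sqh (𝓞 K ⧸ v.asIdeal ^ (2 * e + 1))ˣ).ker → Bool × RingHom.ker π := fun x =>
    if h : π ((x : (𝓞 K ⧸ v.asIdeal ^ (2 * e + 1))ˣ) : 𝓞 K ⧸ v.asIdeal ^ (2 * e + 1)) = 1 then
      (true, ⟨((x : (𝓞 K ⧸ v.asIdeal ^ (2 * e + 1))ˣ) : 𝓞 K ⧸ v.asIdeal ^ (2 * e + 1)) - 1, by
        rw [RingHom.mem_ker, map_sub, h, map_one, sub_self]⟩)
    else (false, ⟨((x : (𝓞 K ⧸ v.asIdeal ^ (2 * e + 1))ˣ) : 𝓞 K ⧸ v.asIdeal ^ (2 * e + 1)) + 1, by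
        rw [RingHom.mem_ker, map_add, (hpm x).resolve_left h, map_one, neg_add_cancel]⟩)
  have hF : Function.Injective F := by
    intro x y hxy
    simp only [F] at hxy
    split_ifs at hxy with h1 h2 h2
    · simp at hxy
      exact Subtype.ext (Units.ext hxy)
    · simp at hxy
    · simp at hxy
    · simp at hxy
      exact Subtype.ext (Units.ext hxy)
  have := Nat.card_le_card_of_injective F hF
  rw [Nat.card_prod, hk] at this
  simpa using this

theorem W_unit (v : Pl K) (e : ℕ) (he : od v (2:K) = e) :
    (SqV v).relIndex (UV v) ≠ 0 ∧ (SqV v).relIndex (UV v) ≤ 2 * Nm v ^ e := by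
  classical
  set I := v.asIdeal ^ (2 * e + 1) with hI
  haveI : Finite (𝓞 K ⧸ I) := by
    apply Nat.finite_of_card_ne_zero; rw [card_quot_pow]; exact (pow_pos (Nm_pos v) _).ne'
  let G := (𝓞 K ⧸ I)ˣ
  have h4 : od v (4:K) + 1 = ((2 * e + 1 : ℕ) : ℤ) := by rw [od_four, he]; push_cast; ring
  -- lifts
  have hlift : ∀ g : G, ∃ a : 𝓞 K, Ideal.Quotient.mk I a = (g : 𝓞 K ⧸ I) := fun g =>
    Ideal.Quotient.mk_surjective _
  choose l hl using hlift
  have hunit : ∀ (g : G) (a : 𝓞 K), Ideal.Quotient.mk I a = (g : 𝓞 K ⧸ I) → a ∉ v.asIdeal := by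
    intro g a ha hmem
    obtain ⟨b, hb⟩ := Ideal.Quotient.mk_surjective ((g⁻¹ : G) : 𝓞 K ⧸ I)
    have h1 : Ideal.Quotient.mk I (a * b) = Ideal.Quotient.mk I 1 := by
      rw [map_mul, ha, hb, ← Units.val_mul, mul_inv_cancel, map_one]; rfl
    rw [Ideal.Quotient.eq] at h1
    have h2 : a * b - 1 ∈ v.asIdeal := Ideal.pow_le_self (by omega) h1
    have h3 : (1 : 𝓞 K) ∈ v.asIdeal := by
      have := Ideal.sub_mem _ (Ideal.mul_mem_right b _ hmem) h2
      simpa using this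
    exact v.isPrime.ne_top ((Ideal.eq_top_iff_one _).2 h3)
  have hl0 : ∀ g, ((l g : 𝓞 K) : K) ≠ 0 := fun g => (od_eq_zero_of_notMem v (hunit g _ (hl g))).1
  have hcong : ∀ (a b : 𝓞 K) (ha : a ∉ v.asIdeal) (hb : b ∉ v.asIdeal) (ha0 : (a : K) ≠ 0) (hb0 : (b : K) ≠ 0),
      Ideal.Quotient.mk I a = Ideal.Quotient.mk I b →
      (Units.mk0 (a : K) ha0)⁻¹ * (Units.mk0 (b : K) hb0) ∈ SqV v := by
    intro a b ha hb ha0 hb0 hab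
    rw [eq_comm, Ideal.Quotient.eq, ← OG_pow_iff_mem, ← h4] at hab
    apply mem_SqV_of_OG
    have h1 := hab.mul (od_OG v ((a : K)⁻¹))
    rw [od_inv, (od_eq_zero_of_notMem v ha).2, neg_zero, add_zero] at h1
    convert h1 using 1
    have h5 : ((b - a : 𝓞 K) : K) = (b : K) - (a : K) := rfl
    rw [h5]
    push_cast
    simp only [Units.val_mk0]
    field_simp
  let f : G →* Kˣ ⧸ SqV v := MonoidHom.mk' (fun g => QuotientGroup.mk (Units.mk0 ((l g : 𝓞 K) : K) (hl0 g))) (by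
    intro g h
    rw [← QuotientGroup.mk_mul, eq_comm, QuotientGroup.eq]
    have h5 : Units.mk0 ((l g : 𝓞 K) : K) (hl0 g) * Units.mk0 ((l h : 𝓞 K) : K) (hl0 h)
      = Units.mk0 ((l g * l h : 𝓞 K) : K) (mul_ne_zero (hl0 g) (hl0 h)) := by
      apply Units.ext; rfl
    rw [h5]
    refine hcong _ _ (hunit (g * h) _ ?_) (hunit _ _ (hl _)) _ _ ?_
    · rw [map_mul, hl, hl]; rfl
    · rw [map_mul, hl, hl, hl]; rfl)
  let ψ : UV v →* Kˣ ⧸ SqV v := (QuotientGroup.mk' (SqV v)).comp (UV v).subtype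
  have hψk : ψ.ker = (SqV v).subgroupOf (UV v) := by
    ext x
    rw [MonoidHom.mem_ker, Subgroup.mem_subgroupOf]
    exact QuotientGroup.eq_one_iff _
  have hidx : (SqV v).relIndex (UV v) = Nat.card ψ.range := by
    rw [Subgroup.relIndex, ← hψk, Subgroup.index_ker]
  have hrange : ψ.range ≤ f.range := by
    rintro _ ⟨x, rfl⟩
    have hx0 : od v ((x : Kˣ) : K) = 0 := x.2
    obtain ⟨a, d, hd, had⟩ := exists_num_den v (x := ((x : Kˣ) : K)) ((OG_iff v (x : Kˣ).ne_zero).2 hx0.ge)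
    obtain ⟨hd0, hd1⟩ := od_eq_zero_of_notMem v hd
    have ha0 : (a : K) ≠ 0 := by rw [← had]; exact mul_ne_zero (x : Kˣ).ne_zero hd0
    have ha : a ∉ v.asIdeal := by
      intro h
      rw [← OG_one_iff_mem, OG_iff v ha0, ← had, od_mul v (x : Kˣ).ne_zero hd0, hx0, hd1] at h
      omega
    have had' : a * d ∉ v.asIdeal := fun h => (v.isPrime.mem_or_mem h).elim ha hd
    have hu : IsUnit (Ideal.Quotient.mk I (a * d)) := by
      have h6 : IsCoprime (Ideal.span {a * d}) I := by
        rw [hI]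
        apply IsCoprime.pow_right
        rw [Ideal.isCoprime_iff_sup_eq]
        have hmax : v.asIdeal.IsMaximal := v.isMaximal
        rw [sup_comm]
        by_contra hne
        have h7 := hmax.eq_of_le hne le_sup_left
        apply had'
        rw [h7]
        exact Ideal.mem_sup_right (Ideal.mem_span_singleton_self _)
      rw [Ideal.isCoprime_iff_exists] at h6
      obtain ⟨i, hi, j, hj, hij⟩ := h6
      obtain ⟨k, rfl⟩ := Ideal.mem_span_singleton'.1 hi
      refine IsUnit.of_mul_eq_one (Ideal.Quotient.mk I k) ?_
      rw [← map_mul, ← map_one (Ideal.Quotient.mk I), Ideal.Quotient.eq, ← hij]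
      have : a * d * k - (k * (a * d) + j) = -j := by ring
      rw [this]
      exact neg_mem hj
    refine ⟨hu.unit, ?_⟩
    change QuotientGroup.mk (Units.mk0 ((l hu.unit : 𝓞 K) : K) (hl0 hu.unit)) = QuotientGroup.mk (x : Kˣ)
    have h8 := hcong (l hu.unit) (a * d) (hunit _ _ (hl _)) had' (hl0 _) (mul_ne_zero ha0 hd0) (by rw [hl]; rfl)
    rw [QuotientGroup.eq]
    have h9 : (x : Kˣ) = Units.mk0 ((a * d : 𝓞 K) : K) (mul_ne_zero ha0 hd0) * ((Units.mk0 (d : K) hd0)⁻¹) ^ 2 := by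
      apply Units.ext
      have h5 : ((a * d : 𝓞 K) : K) = (a : K) * (d : K) := rfl
      push_cast
      simp only [Units.val_mk0, h5]
      have had2 : (a : K) = ((x : Kˣ) : K) * (d : K) := had.symm
      refine Eq.trans ?_ (congrArg (fun t => t * (d : K) * ((d : K)⁻¹) ^ 2) had2).symm
      field_simp
    rw [h9, ← mul_assoc]
    exact (SqV v).mul_mem h8 (sq_mem_SqV v _)
  have hkf : (sqh G).range ≤ f.ker := by
    rintro _ ⟨g, rfl⟩
    rw [MonoidHom.mem_ker]
    change f (g ^ 2) = 1
    rw [map_pow]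
    change (QuotientGroup.mk (Units.mk0 ((l g : 𝓞 K) : K) (hl0 g)) : Kˣ ⧸ SqV v) ^ 2 = 1
    rw [← QuotientGroup.mk_pow, QuotientGroup.eq_one_iff]
    exact sq_mem_SqV v _
  have hc1 : Nat.card f.range ≤ 2 * Nm v ^ e := by
    rw [← Subgroup.index_ker]
    have h1 : (sqh G).range.index = Nat.card (sqh G).ker := by
      haveI : (sqh G).ker.FiniteIndex := Subgroup.finiteIndex_of_finite_quotient
      rw [Subgroup.index_range]
    have h2 := Subgroup.index_dvd_of_le hkf
    rw [h1] at h2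
    exact (Nat.le_of_dvd Nat.card_pos h2).trans (card_G2 v e he)
  haveI : Finite f.range := (Set.finite_range f).to_subtype
  have hc2 : Nat.card ψ.range ≤ Nat.card f.range :=
    Nat.card_le_card_of_injective _ (Subgroup.inclusion_injective hrange)
  haveI : Finite ψ.range := Finite.of_injective _ (Subgroup.inclusion_injective hrange)
  rw [hidx]
  exact ⟨Nat.card_pos.ne', hc2.trans hc1⟩

theorem W_all (v : Pl K) (e : ℕ) (he : od v (2:K) = e) :
    (SqV v).index ≠ 0 ∧ (SqV v).index ≤ 4 * Nm v ^ e := by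
  let p : Kˣ →* Multiplicative (ZMod 2) :=
    { toFun := fun x => Multiplicative.ofAdd ((od v (x : K) : ℤ) : ZMod 2)
      map_one' := by simp [od_one]
      map_mul' := fun x y => by
        rw [Units.val_mul, od_mul v x.ne_zero y.ne_zero]; push_cast; rfl }
  have hp : ∀ x : Kˣ, x ∈ p.ker ↔ ∃ k, od v (x : K) = 2 * k := by
    intro x
    rw [MonoidHom.mem_ker]
    change ((od v (x : K) : ℤ) : ZMod 2) = 0 ↔ _
    rw [ZMod.intCast_zmod_eq_zero_iff_dvd]
    rfl
  have h1 : SqV v ≤ p.ker := fun x hx => (hp x).2 (even_of_SqV hx)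
  have h2 : p.ker ≤ UV v ⊔ SqV v := by
    intro x hx
    obtain ⟨k, hk⟩ := (hp x).1 hx
    obtain ⟨q, hq0, hq⟩ := exists_unif v
    have : x = (x * (Units.mk0 (q : K) hq0 ^ (-k)) ^ 2) * ((Units.mk0 (q : K) hq0) ^ k) ^ 2 := by
      rw [mul_assoc, ← mul_pow, ← zpow_add]; simp
    rw [this]
    refine Subgroup.mul_mem_sup ?_ (sq_mem_SqV v _)
    rw [mem_UV]
    push_cast
    rw [od_mul v x.ne_zero (by simpa using zpow_ne_zero (-k) hq0), od_pow, Units.val_mk0, od_zpow, hq, hk]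
    push_cast; ring
  have h3 : p.ker.index ∣ 2 := by
    rw [Subgroup.index_ker]
    have := Subgroup.card_subgroup_dvd_card p.range
    simpa using this
  obtain ⟨w1, w2⟩ := W_unit v e he
  have h4 : (SqV v).relIndex (UV v ⊔ SqV v) = (SqV v).relIndex (UV v) := by
    rw [Subgroup.relIndex_sup_right]
  have h40 : (SqV v).relIndex (UV v ⊔ SqV v) ≠ 0 := by rw [h4]; exact w1
  have h5 : (SqV v).relIndex p.ker ≤ (SqV v).relIndex (UV v ⊔ SqV v) :=
    Subgroup.relIndex_le_of_le_right h2 h40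
  have h6 : (SqV v).relIndex p.ker ≠ 0 := mt (Subgroup.relIndex_eq_zero_of_le_right h2) h40
  rw [← Subgroup.relIndex_mul_index h1]
  have h7 : p.ker.index ≤ 2 := Nat.le_of_dvd (by norm_num) h3
  have h8 : p.ker.index ≠ 0 := by
    intro h; rw [h] at h3; simp at h3
  refine ⟨mul_ne_zero h6 h8, ?_⟩
  calc _ ≤ (2 * Nm v ^ e) * 2 := Nat.mul_le_mul (h5.trans (h4.le.trans w2)) h7
    _ = _ := by ring

noncomputable def eo (v : Pl K) : ℕ := (od v (2:K)).toNat
theorem eo_eq (v : Pl K) : od v (2:K) = eo v := by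
  have := od_two_nonneg v
  rw [eo]; omega

theorem prod_Nm (S : Finset (Pl K)) : ∏ v ∈ S, Nm v ^ eo v ≤ 2 ^ Module.finrank ℚ K := by
  have h1 : ∏ v ∈ S, v.asIdeal ^ eo v ∣ Ideal.span {(2 : 𝓞 K)} := by
    apply Finset.prod_dvd_of_coprime
    · intro v _ w _ hvw
      apply IsCoprime.pow
      rw [Ideal.isCoprime_iff_sup_eq]
      haveI := v.isMaximal
      haveI := w.isMaximal
      exact Ideal.isCoprime_iff_sup_eq.1 (Ideal.isCoprime_of_isMaximal fun h => hvw (HeightOneSpectrum.ext h))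
    · intro v _
      rw [Ideal.dvd_span_singleton, ← OG_pow_iff_mem]
      have : ((2 : 𝓞 K) : K) = 2 := map_ofNat _ 2
      rw [this, ← eo_eq]
      exact od_OG v _
  have h2 := map_dvd (Ideal.absNorm (S := 𝓞 K)) h1
  rw [map_prod] at h2
  simp_rw [map_pow] at h2
  have h3 : Ideal.absNorm (Ideal.span {(2 : 𝓞 K)}) = 2 ^ Module.finrank ℚ K := by
    rw [Ideal.absNorm_span_singleton]
    have : (2 : 𝓞 K) = algebraMap ℤ (𝓞 K) 2 := by simp
    rw [this, Algebra.norm_algebraMap, RingOfIntegers.rank, Int.natAbs_pow]; rfl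
  rw [h3] at h2
  exact Nat.le_of_dvd (by positivity) h2

def SqS (S : Finset (Pl K)) : Subgroup Kˣ := ⨅ v : S, SqV v.1

theorem mem_SqS {S : Finset (Pl K)} {x : Kˣ} : x ∈ SqS S ↔ ∀ v ∈ S, x ∈ SqV v := by
  simp [SqS, Subgroup.mem_iInf]

theorem W_S (hTC : IsEmpty (K →+* ℝ)) (S : Finset (Pl K)) :
    (SqS S).index ≠ 0 ∧ (SqS S).index ≤ 2 ^ (2 * (S.card + Units.rank K + 1)) := by
  refine ⟨Subgroup.index_iInf_ne_zero fun v => (W_all v.1 _ (eo_eq v.1)).1, ?_⟩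
  refine (Subgroup.index_iInf_le _).trans ?_
  calc ∏ v : S, (SqV v.1).index ≤ ∏ v : S, 4 * Nm v.1 ^ eo v.1 :=
        Finset.prod_le_prod' fun v _ => (W_all v.1 _ (eo_eq v.1)).2
    _ = ∏ v ∈ S, (4 * Nm v ^ eo v) := Finset.prod_coe_sort S (fun v => 4 * Nm v ^ eo v)
    _ = 4 ^ S.card * ∏ v ∈ S, Nm v ^ eo v := by rw [Finset.prod_mul_distrib, Finset.prod_const]
    _ ≤ 4 ^ S.card * 2 ^ Module.finrank ℚ K := Nat.mul_le_mul_left _ (prod_Nm S)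
    _ = _ := by
      rw [← rank_TC hTC, show (4:ℕ) = 2 ^ 2 by norm_num, ← pow_mul, ← pow_add]
      congr 1; ring
end W
end

section
open Polynomial
set_option linter.all false
open IsDedekindDomain NumberField

theorem relidx_two {G : Type} [CommGroup G] {H A : Subgroup G} (h0 : H.relIndex A ≠ 0) (h2 : H.relIndex A ≤ 2)
    {a b : G} (ha : a ∈ A) (hb : b ∈ A) (ha' : a ∉ H) (hb' : b ∉ H) : a * b ∈ H := by
  have h1 : H.relIndex A ≠ 1 := by
    intro h
    rw [Subgroup.relIndex_eq_one] at h
    exact ha' (h ha)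
  have h3 : (H.subgroupOf A).index = 2 := by
    have : H.relIndex A = (H.subgroupOf A).index := rfl
    omega
  have := (Subgroup.mul_mem_iff_of_index_two h3 (a := ⟨a, ha⟩) (b := ⟨b, hb⟩))
  rw [Subgroup.mem_subgroupOf, Subgroup.mem_subgroupOf, Subgroup.mem_subgroupOf] at this
  exact this.2 ⟨fun h => absurd h ha', fun h => absurd h hb'⟩

section T
variable {K M : Type} [Field K] [NumberField K] [Field M] [NumberField M] [Algebra K M]

theorem exists_pl_notMem (T : Finset (Pl K)) : ∃ w : Pl K, w ∉ T := by
  set N : ℕ := ∏ v ∈ T, Nm v with hN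
  have hNp : 0 < N := Finset.prod_pos fun v _ => Nm_pos v
  have hnu : ¬ IsUnit ((N + 1 : ℕ) : 𝓞 K) := by
    intro h
    obtain ⟨a, ha⟩ := h.exists_right_inv
    have h1 := congrArg (Algebra.norm ℤ) ha
    have h2 : ((N + 1 : ℕ) : 𝓞 K) = algebraMap ℤ (𝓞 K) ((N + 1 : ℕ) : ℤ) := by simp
    rw [map_mul, h2, Algebra.norm_algebraMap, map_one] at h1
    have h3 : ((N + 1 : ℕ) : ℤ) ∣ 1 := by
      refine (dvd_pow_self _ ?_).trans (Dvd.intro _ h1)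
      rw [RingOfIntegers.rank]
      exact Module.finrank_pos.ne'
    have := Int.le_of_dvd one_pos h3
    push_cast at this; omega
  obtain ⟨m, hm, hmem⟩ := exists_max_ideal_of_mem_nonunits (mem_nonunits_iff.2 hnu)
  refine ⟨⟨m, hm.isPrime, ?_⟩, ?_⟩
  · rintro rfl
    have : ((N + 1 : ℕ) : 𝓞 K) = 0 := by simpa using hmem
    rw [Nat.cast_eq_zero] at this
    omega
  · intro h
    have h1 : ((N : ℕ) : 𝓞 K) ∈ m := by
      have h2 : ((Nm (⟨m, hm.isPrime, by
        rintro rfl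
        have : ((N + 1 : ℕ) : 𝓞 K) = 0 := by simpa using hmem
        rw [Nat.cast_eq_zero] at this
        omega⟩ : Pl K) : ℕ) : 𝓞 K) ∈ m := Ideal.absNorm_mem m
      have h3 := Finset.dvd_prod_of_mem Nm h
      obtain ⟨c, hc⟩ := h3
      rw [hN, hc, Nat.cast_mul]
      exact Ideal.mul_mem_right _ _ h2
    have h2 : (1 : 𝓞 K) ∈ m := by
      have := m.sub_mem hmem h1
      push_cast at this
      simpa using this
    exact hm.ne_top (m.eq_top_iff_one.2 h2)

theorem QD.sq_of {u : K} (Q : QD K M u) {a : K} {x : M} (h : x ^ 2 = algebraMap K M a) :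
    (∃ c : K, c ^ 2 = a) ∨ (∃ d : K, u * d ^ 2 = a) := by
  have h1 : (Q.σ x) ^ 2 = x ^ 2 := by rw [← map_pow, h, AlgEquiv.commutes]
  rcases sq_eq_sq_iff_eq_or_eq_neg.1 h1 with h2 | h2
  · obtain ⟨c, rfl⟩ := Q.fixed h2
    left; refine ⟨c, ?_⟩
    rw [← map_pow] at h
    exact (algebraMap K M).injective h
  · have h3 : Q.σ (x * Q.r) = x * Q.r := by rw [map_mul, h2, Q.hσ]; ring
    obtain ⟨c, hc⟩ := Q.fixed h3
    right; refine ⟨c / u, ?_⟩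
    have h4 : c ^ 2 = a * u := by
      apply (algebraMap K M).injective
      rw [map_pow, ← hc, mul_pow, h, Q.hr, map_mul]
    have := Q.u_ne
    field_simp
    linear_combination h4

noncomputable def supp (x : Kˣ) : Finset (Pl K) := (finite_supp x.ne_zero).toFinset
theorem mem_supp {x : Kˣ} {v : Pl K} : v ∈ supp x ↔ od v (x : K) ≠ 0 := by simp [supp]
noncomputable def dy (K : Type) [Field K] [NumberField K] : Finset (Pl K) := (finite_supp (two_ne K)).toFinset
theorem mem_dy {v : Pl K} : v ∈ dy K ↔ od v (2 : K) ≠ 0 := by simp [dy]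

abbrev ua (M : Type) [Field M] [Algebra K M] : Kˣ →* Mˣ := Units.map (algebraMap K M : K →* M)

theorem SqV_of_sq {v : Pl K} {x : Kˣ} {y : K} (h : y ^ 2 = x) : x ∈ SqV v := by
  have hy : y ≠ 0 := by rintro rfl; exact x.ne_zero (by rw [← h]; norm_num)
  have : x = (Units.mk0 y hy) ^ 2 := by ext; simp [h]
  rw [this]; exact sq_mem_SqV v _

theorem TC_ext (hTC : IsEmpty (K →+* ℝ)) : IsEmpty (M →+* ℝ) := ⟨fun f => hTC.false (f.comp (algebraMap K M))⟩

theorem odd_unit (v : Pl K) (h2 : od v (2:K) = 0) {a b : Kˣ} (ha : od v (a : K) = 0) (hb : od v (b : K) = 0)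
    (ha' : a ∉ SqV v) (hb' : b ∉ SqV v) : a * b ∈ SqV v := by
  have h := W_unit v 0 (by simpa using h2)
  exact relidx_two h.1 (by simpa using h.2) (A := UV v) ha hb ha' hb'

theorem lemT (hTC : IsEmpty (K →+* ℝ)) (hi : ∀ y : K, y ^ 2 ≠ -1) (u : Kˣ) (hu : ∀ y : K, y ^ 2 ≠ u)
    (hu' : ∀ y : K, y ^ 2 ≠ -u) (T : Finset (Pl K)) : ∃ v ∉ T, (-1 : Kˣ) ∈ SqV v ∧ u ∉ SqV v := by
  classical
  by_contra! hcon
  set T' := T ∪ dy K ∪ supp u with hT'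
  obtain ⟨L, _, _, _, ⟨Q⟩⟩ := exists_QD (-1 : K) hi
  have hneg : ∀ w : Pl L, (-1 : Lˣ) ∈ SqV w := fun w => SqV_of_sq (y := Q.r) (by rw [Q.hr]; simp)
  have h1 : ∀ w : Pl L, w ∉ abv L T' → ua L u ∈ SqV w := by
    intro w hw
    rw [mem_abv, hT', Finset.mem_union, Finset.mem_union, mem_dy, mem_supp] at hw
    push Not at hw
    by_cases hm : (-1 : Kˣ) ∈ SqV (und K w)
    · exact SqV_alg w (hcon _ hw.1.1 hm)
    by_cases hm2 : u ∈ SqV (und K w)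
    · exact SqV_alg w hm2
    have h3 := odd_unit _ hw.1.2 (a := -1) (by rw [Units.val_neg, od_neg, Units.val_one, od_one]) hw.2 hm hm2
    have h4 := SqV_alg w h3
    rw [map_mul] at h4
    have h5 := (SqV w).mul_mem (hneg w) h4
    have h6 : (-1 : Lˣ) * (ua L (-1 : Kˣ) * ua L u) = ua L u := by
      ext; simp
    rwa [h6] at h5
  have h2 : ∀ y : L, y ^ 2 ≠ (ua L u : Lˣ) := by
    intro y hy
    rcases Q.sq_of (a := (u : K)) hy with ⟨c, hc⟩ | ⟨d, hd⟩
    · exact hu c hc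
    · exact hu' d (by rw [← hd]; ring)
  obtain ⟨w0, hw0⟩ := exists_pl_notMem (abv L T')
  have hw0u : od w0 ((ua L u : Lˣ) : L) = 0 := by
    rw [mem_abv, hT', Finset.mem_union, Finset.mem_union, mem_dy, mem_supp] at hw0
    push Not at hw0
    change od w0 (algebraMap K L u) = 0
    rw [od_alg, hw0.2, mul_zero]
  obtain ⟨p, hp0, hp1⟩ := exists_unif w0
  obtain ⟨β, hβ⟩ := weak_approx (insert w0 (abv L T')) (fun w => if w = w0 then (p : L) else 1)
    ((∑ w ∈ abv L T', (od w (4 : L)).toNat) + 2)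
  have hβ0 : β ≠ 0 ∧ od w0 β = 1 := by
    have := hβ w0 (Finset.mem_insert_self _ _)
    rw [if_pos rfl] at this
    have := od_add_eq w0 hp0 (this.mono (by rw [hp1]; push_cast; have : (0:ℤ) ≤ ∑ w ∈ abv L T', ((od w (4 : L)).toNat : ℤ) := Finset.sum_nonneg fun _ _ => by positivity
                                            linarith))
    rw [add_sub_cancel, hp1] at this
    exact this
  set b : Lˣ := Units.mk0 β hβ0.1 with hb
  have hb2 : ∀ w ∈ abv L T', b ∈ SqV w := by
    intro w hw
    have h3 := hβ w (Finset.mem_insert_of_mem hw)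
    rw [if_neg (by rintro rfl; exact hw0 hw)] at h3
    refine mem_SqV_of_OG (h3.mono ?_)
    have := Finset.single_le_sum (f := fun w => (od w (4 : L)).toNat) (fun _ _ => Nat.zero_le _) hw
    have h4 := od_four_nonneg w

    omega
  have hns : ∀ y : L, y ^ 2 ≠ ((ua L u * b : Lˣ) : L) := by
    intro y hy
    have := congrArg (od w0) hy
    rw [od_pow, Units.val_mul, od_mul _ (Units.ne_zero _) (Units.ne_zero _), hw0u] at this
    have h4 : od w0 (b : L) = 1 := hβ0.2
    rw [h4] at this
    push_cast at this; omega
  obtain ⟨N, _, _, _, ⟨Q2⟩⟩ := exists_QD _ hns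
  have hUns : ∀ y : N, y ^ 2 ≠ (ua N (ua L u) : Nˣ) := by
    intro y hy
    rcases Q2.sq_of (a := ((ua L u : Lˣ) : L)) hy with ⟨c, hc⟩ | ⟨d, hd⟩
    · exact h2 c hc
    · have hd0 : d ≠ 0 := by
        rintro rfl
        rw [zero_pow two_ne_zero, mul_zero] at hd
        exact (Units.ne_zero _) hd.symm
      have := congrArg (od w0) hd
      have h4 : od w0 (b : L) = 1 := hβ0.2
      rw [od_mul _ (Units.ne_zero _) (pow_ne_zero 2 hd0), od_pow, Units.val_mul, od_mul _ (Units.ne_zero _) (Units.ne_zero _), hw0u, h4] at this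
      push_cast at this; omega
  have hall : ∀ W : Pl N, ua N (ua L u) ∈ SqV W := by
    intro W
    by_cases hW : und L W ∈ abv L T'
    · have h5 := SqV_alg W (hb2 _ hW)
      have h6 : ua N (ua L u * b) ∈ SqV W := SqV_of_sq (y := Q2.r) Q2.hr
      rw [map_mul] at h6
      exact (Subgroup.mul_mem_cancel_right _ h5).1 h6
    · exact SqV_alg W (h1 _ hW)
  obtain ⟨S, hS, hPS⟩ := exists_PS (dy N ∪ supp (ua N (ua L u)))
  have := stepA (TC_ext (K := L) (TC_ext (K := K) hTC)) (ua N (ua L u)) hUns S ∅ (Finset.empty_subset _) hPS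
    (fun v hv => by
      by_contra h
      exact hv (hS (Finset.mem_union_left _ (mem_dy.2 h))))
    (fun v hv => by
      by_contra h
      exact hv (hS (Finset.mem_union_right _ (mem_supp.2 h)))) (fun v _ _ => hall v)
  rw [Finset.card_empty, pow_zero] at this
  omega
end T
end

section
open Polynomial
set_option linter.all false
open IsDedekindDomain NumberField

theorem relidx_le_two {G : Type} [CommGroup G] {H A : Subgroup G} (c : G) (hc : c ∈ A)
    (h : ∀ a ∈ A, a ∈ H ∨ a * c ∈ H) : H.relIndex A ≠ 0 ∧ H.relIndex A ≤ 2 := by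
  by_cases hcH : c ∈ H
  · have : A ≤ H := by
      intro a ha
      rcases h a ha with h1 | h1
      · exact h1
      · exact (Subgroup.mul_mem_cancel_right _ hcH).1 h1
    rw [Subgroup.relIndex_eq_one.2 this]; norm_num
  · have : H.relIndex A = 2 := by
      rw [Subgroup.relIndex, Subgroup.index_eq_two_iff]
      refine ⟨⟨c, hc⟩, ?_⟩
      rintro ⟨b, hb⟩
      rw [Subgroup.mem_subgroupOf, Subgroup.mem_subgroupOf]
      by_cases hbH : b ∈ H
      · right
        refine ⟨hbH, fun h2 => hcH ((Subgroup.mul_mem_cancel_left _ hbH).1 h2)⟩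
      · left
        exact ⟨(h b hb).resolve_left hbH, hbH⟩
    rw [this]; norm_num

section core
variable {K : Type} [Field K] [NumberField K]

theorem SU_sq_idx (S : Finset (Pl K)) :
    ((SU S).map (sqh Kˣ)).relIndex (SU S) = 2 ^ (S.card + Units.rank K + 1) := by
  rw [pr_idx_sub (SU S) (-1) (fun v _ => by rw [Units.val_neg, od_neg, Units.val_one, od_one])
    (by intro h; have := congrArg Units.val h; norm_num at this) sq_one_units, rk_SU]

theorem SU_of_sq {S : Finset (Pl K)} {x y : Kˣ} (h : y ^ 2 = x) (hx : x ∈ SU S) : y ∈ SU S := by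
  intro v hv
  have := hx v hv
  rw [← h, Units.val_pow_eq_pow_val, od_pow] at this
  push_cast at this; omega

theorem SqS_insert [DecidableEq (Pl K)] (v : Pl K) (T : Finset (Pl K)) : SqS (insert v T) = SqV v ⊓ SqS T := by
  ext x
  rw [Subgroup.mem_inf, mem_SqS, mem_SqS, Finset.forall_mem_insert]

theorem SqV_rel {S : Finset (Pl K)} (hd : ∀ v ∉ S, od v (2:K) = 0) {v : Pl K} (hv : v ∉ S) (B : Subgroup Kˣ)
    (hB : B ≤ SU S) : (SqV v).relIndex B ≠ 0 ∧ (SqV v).relIndex B ≤ 2 := by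
  have h := W_unit v 0 (by simpa using hd v hv)
  have hle : B ≤ UV v := fun x hx => hB hx v hv
  refine ⟨fun h0 => h.1 (Subgroup.relIndex_eq_zero_of_le_right hle h0), ?_⟩
  exact (Subgroup.relIndex_le_of_le_right hle h.1).trans (by simpa using h.2)

theorem SqS_rel_union [DecidableEq (Pl K)] {S : Finset (Pl K)} (hd : ∀ v ∉ S, od v (2:K) = 0) (R R' : Finset (Pl K))
    (hR' : ∀ v ∈ R', v ∉ S) :
    (SqS (R' ∪ R)).relIndex (SU S) ≤ 2 ^ R'.card * (SqS R).relIndex (SU S) := by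
  induction R' using Finset.induction_on with
  | empty => simp
  | insert v T hv ih =>
    have ih := ih fun w hw => hR' w (Finset.mem_insert_of_mem hw)
    rw [Finset.insert_union, SqS_insert, ← Subgroup.relIndex_inf_mul_relIndex, Finset.card_insert_of_notMem hv, pow_succ]
    have h1 := (SqV_rel hd (hR' v (Finset.mem_insert_self _ _)) (SqS (T ∪ R) ⊓ SU S) inf_le_right).2
    calc _ ≤ 2 * (2 ^ T.card * (SqS R).relIndex (SU S)) := Nat.mul_le_mul h1 ih
      _ = _ := by ring

theorem exists_T (hTC : IsEmpty (K →+* ℝ)) (hi : ∀ y : K, y ^ 2 ≠ -1) (S : Finset (Pl K))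
    (hd : ∀ v ∉ S, od v (2:K) = 0) (j : ℕ) (hj : j ≤ S.card + Units.rank K) :
    ∃ T : Finset (Pl K), T.card = j ∧ (∀ v ∈ T, v ∉ S ∧ (-1 : Kˣ) ∈ SqV v) ∧
      (SqS T).relIndex (SU S) = 2 ^ j := by
  classical
  induction j with
  | zero =>
    refine ⟨∅, rfl, by simp, ?_⟩
    rw [pow_zero, Subgroup.relIndex_eq_one]
    intro x _
    rw [mem_SqS]; simp
  | succ j ih =>
    obtain ⟨T, hT1, hT2, hT3⟩ := ih (by omega)
    have hex : ∃ u ∈ SqS T ⊓ SU S, (∀ y : K, y ^ 2 ≠ (u : Kˣ)) ∧ (∀ y : K, y ^ 2 ≠ -(u : K)) := by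
      by_contra! hcon
      have h1 := relidx_le_two (H := (SU S).map (sqh Kˣ)) (A := SqS T ⊓ SU S) (-1) ⟨mem_SqS.2 fun v hv => (hT2 v hv).2, 
        (fun v _ => by rw [Units.val_neg, od_neg, Units.val_one, od_one])⟩ (by
          intro a ha
          by_cases h2 : ∃ y : K, y ^ 2 = (a : Kˣ)
          · left
            obtain ⟨y, hy⟩ := h2
            have hy0 : y ≠ 0 := by rintro rfl; exact a.ne_zero (by rw [← hy]; norm_num)
            have hy2 : (Units.mk0 y hy0) ^ 2 = a := by ext; simp [hy]
            exact ⟨_, SU_of_sq hy2 ha.2, hy2⟩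
          · right
            push Not at h2
            obtain ⟨y, hy⟩ := hcon a ha h2
            have hy0 : y ≠ 0 := by rintro rfl; exact a.ne_zero (neg_eq_zero.1 (by rw [← hy]; norm_num))
            have hy2 : (Units.mk0 y hy0) ^ 2 = a * -1 := by ext; simp [hy]
            refine ⟨_, SU_of_sq hy2 ?_, hy2⟩
            exact (SU S).mul_mem ha.2 (fun v _ => by rw [Units.val_neg, od_neg, Units.val_one, od_one]))
      have h3 : (SU S).map (sqh Kˣ) ≤ SqS T := by
        rintro _ ⟨y, hy, rfl⟩
        exact mem_SqS.2 fun v hv => sq_mem_SqV v y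
      have h4 := Subgroup.relIndex_inf_mul_relIndex ((SU S).map (sqh Kˣ)) (SqS T) (SU S)
      rw [inf_eq_left.2 h3, SU_sq_idx, hT3] at h4
      have h5 : 2 ^ (S.card + Units.rank K + 1) ≤ 2 * 2 ^ j := by
        rw [← h4]; exact Nat.mul_le_mul_right _ h1.2
      rw [← pow_succ', Nat.pow_le_pow_iff_right (by norm_num)] at h5
      omega
    obtain ⟨u, hu, hu1, hu2⟩ := hex
    obtain ⟨v, hv, hv1, hv2⟩ := lemT hTC hi u hu1 hu2 (S ∪ T)
    rw [Finset.mem_union, not_or] at hv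
    refine ⟨insert v T, by rw [Finset.card_insert_of_notMem hv.2, hT1], ?_, ?_⟩
    · rw [Finset.forall_mem_insert]
      exact ⟨⟨hv.1, hv1⟩, hT2⟩
    · rw [SqS_insert, ← Subgroup.relIndex_inf_mul_relIndex, hT3, pow_succ']
      have h1 := SqV_rel hd hv.1 (SqS T ⊓ SU S) inf_le_right
      have h2 : (SqV v).relIndex (SqS T ⊓ SU S) ≠ 1 := by
        intro h; rw [Subgroup.relIndex_eq_one] at h; exact hv2 (h hu)
      congr 1; omega

theorem norm_SqV {q : Pl K} (hq : od q (2:K) = 0) {u : K} (hu0 : u ≠ 0) (hu : Odd (od q u)) {x : Kˣ} (hx : od q (x : K) = 0)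
    (hN : x ∈ NK u) : x ∈ SqV q := by
  obtain ⟨c, d, h⟩ := hN
  have h4 : od q (4:K) = 0 := by rw [od_four, hq]; norm_num
  obtain ⟨m, hm⟩ := hu
  by_cases hd : d = 0
  · subst hd
    exact SqV_of_sq (y := c) (by rw [h]; ring)
  have hud : u * d ^ 2 ≠ 0 := mul_ne_zero hu0 (pow_ne_zero 2 hd)
  have ho : od q (u * d ^ 2) = od q u + 2 * od q d := by
    rw [od_mul q hu0 (pow_ne_zero 2 hd), od_pow]; norm_num
  by_cases hc : c = 0
  · exfalso
    subst hc
    have : (x : K) = -(u * d ^ 2) := by rw [h]; ring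
    rw [this, od_neg, ho] at hx
    omega
  have hc2 : od q (c ^ 2) = 2 * od q c := by rw [od_pow]; norm_num
  rcases lt_trichotomy (od q (c ^ 2)) (od q (u * d ^ 2)) with h1 | h1 | h1
  · have h2 := (od_add_eq q (pow_ne_zero 2 hc) (y := -(u * d ^ 2)) (((OG_iff q hud).2 (by omega)).neg)).2
    rw [← sub_eq_add_neg, ← h, hx] at h2
    refine ⟨Units.mk0 c hc, ?_⟩
    rw [h4]
    have h3 : (x : K) / ((Units.mk0 c hc : Kˣ) : K) ^ 2 - 1 = -(u * d ^ 2 / c ^ 2) := by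
      rw [Units.val_mk0, h]; field_simp; ring
    rw [h3]
    refine OG.neg ((OG_iff q (div_ne_zero hud (pow_ne_zero 2 hc))).2 ?_)
    rw [od_div q hud (pow_ne_zero 2 hc)]
    omega
  · omega
  · exfalso
    have h2 := (od_add_eq q (neg_ne_zero.2 hud) (y := c ^ 2) ((OG_iff q (pow_ne_zero 2 hc)).2 (by rw [od_neg]; omega))).2
    have h3 : -(u * d ^ 2) + c ^ 2 = x := by rw [h]; ring
    rw [h3, od_neg] at h2
    omega

theorem core (hTC : IsEmpty (K →+* ℝ)) (hi : ∀ y : K, y ^ 2 ≠ -1) (S : Finset (Pl K)) (hPS : PS S)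
    (hd : ∀ v ∉ S, od v (2:K) = 0) :
    ∃ S' : Finset (Pl K), S ⊆ S' ∧ (∀ v ∈ S', v ∉ S → (-1 : Kˣ) ∈ SqV v) ∧
      (SU S' ⊔ SqS S).index ≠ 0 ∧ (SU S' ⊔ SqS S).index ≤ 2 := by
  classical
  obtain ⟨T, hT1, hT2, hT3⟩ := exists_T hTC hi S hd (S.card + Units.rank K) le_rfl
  have hsub : ∀ R ⊆ T, 2 ^ R.card ≤ (SqS R).relIndex (SU S) := by
    intro R hR
    have h1 := SqS_rel_union hd R (T \ R) (fun v hv => (hT2 v (Finset.mem_sdiff.1 hv).1).1)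
    rw [Finset.sdiff_union_of_subset hR, hT3, ← hT1] at h1
    have h2 := Finset.card_sdiff_add_card_eq_card hR
    rw [← h2, pow_add] at h1
    exact Nat.le_of_mul_le_mul_left h1 (by positivity)
  have hinj : ∀ u ∈ SU (S ∪ T), u ∈ SqS S → ∃ y : K, y ^ 2 = (u : Kˣ) := by
    intro u hu huS
    by_contra! hns
    set R := T.filter (fun q => Odd (od q (u : K))) with hR
    have hev : ∀ v, v ∉ S → v ∉ R → ∃ k, od v (u : K) = 2 * k := by
      intro v hv hvR
      by_cases hvT : v ∈ T
      · have : ¬ Odd (od v (u : K)) := fun h => hvR (Finset.mem_filter.2 ⟨hvT, h⟩)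
        rw [Int.not_odd_iff_even] at this
        exact this.exists_two_nsmul _ |>.imp fun k hk => by rw [hk]; simp
      · exact ⟨0, by rw [hu v (by rw [Finset.mem_union, not_or]; exact ⟨hv, hvT⟩)]; norm_num⟩
    obtain ⟨a, ha0, ha⟩ := hPS (fun v => if v ∈ R then 0 else od v (u : K) / 2) (by
      refine (finite_supp u.ne_zero).subset ?_
      intro v hv h0
      apply hv
      show (if v ∈ R then (0:ℤ) else od v (u : K) / 2) = 0
      rw [h0]; simp)
    set u' : Kˣ := u * (Units.mk0 a ha0)⁻¹ ^ 2 with hu'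
    have hod : ∀ v, od v (u' : K) = od v (u : K) - 2 * od v a := by
      intro v
      have : (u' : K) = u / a ^ 2 := by rw [hu']; push_cast; rw [Units.val_mk0]; field_simp
      rw [this, od_div v u.ne_zero (pow_ne_zero 2 ha0), od_pow]; norm_num
    have hns' : ∀ y : K, y ^ 2 ≠ u' := by
      intro y hy
      apply hns (y * a)
      rw [mul_pow, hy, hu']; push_cast; rw [Units.val_mk0]; field_simp
    have hRS : ∀ v ∈ R, v ∉ S := fun v hv => (hT2 v (Finset.mem_filter.1 hv).1).1
    have hst := stepA hTC u' hns' (S ∪ R) R Finset.subset_union_right (hPS.mono Finset.subset_union_left)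
      (fun v hv => hd v fun h => hv (Finset.mem_union_left _ h))
      (fun v hv => by
        rw [Finset.mem_union, not_or] at hv
        obtain ⟨k, hk⟩ := hev v hv.1 hv.2
        rw [hod, ha v hv.1, if_neg hv.2, hk]
        omega)
      (fun v hv hvR => by
        have hvS := (Finset.mem_union.1 hv).resolve_right hvR
        exact (SqV v).mul_mem (mem_SqS.1 huS v hvS) (sq_mem_SqV v _))
    have h1 : (NK (u' : K)).relIndex (SU S) ≤ (NK (u' : K)).relIndex (SU (S ∪ R)) :=
      Subgroup.relIndex_le_of_le_right (SU_mono Finset.subset_union_left) hst.1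
    have h1' : (NK (u' : K)).relIndex (SU S) ≠ 0 := fun h0 =>
      hst.1 (Subgroup.relIndex_eq_zero_of_le_right (SU_mono Finset.subset_union_left) h0)
    have h2 : NK (u' : K) ⊓ SU S ≤ SqS R := by
      rintro x ⟨hx1, hx2⟩
      rw [mem_SqS]
      intro v hv
      refine norm_SqV (hd v (hRS v hv)) u'.ne_zero ?_ (hx2 v (hRS v hv)) hx1
      rw [hod, ha v (hRS v hv), if_pos hv]
      simpa using (Finset.mem_filter.1 hv).2
    have h3 := Subgroup.relIndex_dvd_of_le_left (SU S) h2
    rw [Subgroup.inf_relIndex_right] at h3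
    have h4 := Nat.le_of_dvd (Nat.pos_of_ne_zero h1') h3
    have h5 := hsub R (Finset.filter_subset _ _)
    have h6 : 0 < 2 ^ R.card := by positivity
    omega
  refine ⟨S ∪ T, Finset.subset_union_left, ?_, ?_⟩
  · intro v hv hvS
    exact (hT2 v ((Finset.mem_union.1 hv).resolve_left hvS)).2
  have hW := W_S hTC S
  have hr : (SqS S).relIndex (SU (S ∪ T)) = 2 ^ (2 * (S.card + Units.rank K) + 1) := by
    have h1 : (SqS S) ⊓ SU (S ∪ T) = (SU (S ∪ T)).map (sqh Kˣ) := by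
      ext x
      constructor
      · rintro ⟨hx1, hx2⟩
        obtain ⟨y, hy⟩ := hinj x hx2 hx1
        have hy0 : y ≠ 0 := by rintro rfl; exact x.ne_zero (by rw [← hy]; norm_num)
        have hy2 : (Units.mk0 y hy0) ^ 2 = x := by ext; simp [hy]
        exact ⟨_, SU_of_sq hy2 hx2, hy2⟩
      · rintro ⟨y, hy, rfl⟩
        exact ⟨mem_SqS.2 fun v _ => sq_mem_SqV v y, (SU (S ∪ T)).pow_mem hy 2⟩
    rw [← Subgroup.inf_relIndex_right, h1, SU_sq_idx, Finset.card_union_of_disjoint, hT1]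
    · congr 1; ring
    · rw [Finset.disjoint_left]
      intro v hv hvT
      exact (hT2 v hvT).1 hv
  have h1 := Subgroup.relIndex_mul_index (H := SqS S) (K := SU (S ∪ T) ⊔ SqS S) le_sup_right
  rw [Subgroup.relIndex_sup_right, hr] at h1
  refine ⟨fun h0 => hW.1 (by rw [← h1, h0, mul_zero]), ?_⟩
  have h2 := hW.2
  rw [← h1] at h2
  have h3 : 2 ^ (2 * (S.card + Units.rank K + 1)) = 2 ^ (2 * (S.card + Units.rank K) + 1) * 2 := by rw [← pow_succ]; rfl
  rw [h3] at h2
  exact Nat.le_of_mul_le_mul_left h2 (by positivity)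
end core
end

section
open Polynomial
set_option linter.all false
open IsDedekindDomain NumberField

/-- `2^k a / b` with `a, b` odd and `a ≡ b mod 4`. -/
def InE (q : ℚ) : Prop := ∃ (k a b : ℤ), Odd a ∧ Odd b ∧ (4 : ℤ) ∣ a - b ∧ q = 2 ^ k * a / b

theorem InE.mul {p q : ℚ} (hp : InE p) (hq : InE q) : InE (p * q) := by
  obtain ⟨k, a, b, ha, hb, h, rfl⟩ := hp
  obtain ⟨k', a', b', ha', hb', h', rfl⟩ := hq
  refine ⟨k + k', a * a', b * b', ha.mul ha', hb.mul hb', ?_, ?_⟩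
  · obtain ⟨c, hc⟩ := h
    obtain ⟨c', hc'⟩ := h'
    exact ⟨c * a' + b * c', by linear_combination a' * hc + b * hc'⟩
  · rw [zpow_add₀ (by norm_num)]; push_cast; ring

theorem odd_ne {a : ℤ} (h : Odd a) : (a : ℚ) ≠ 0 := by
  have : a ≠ 0 := by rintro rfl; simp at h
  exact_mod_cast this

theorem InE.inv {p : ℚ} (hp : InE p) : InE p⁻¹ := by
  obtain ⟨k, a, b, ha, hb, h, rfl⟩ := hp
  refine ⟨-k, b, a, hb, ha, by rw [← neg_sub]; exact h.neg_right, ?_⟩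
  rw [zpow_neg]
  have := odd_ne ha
  have := odd_ne hb
  field_simp

theorem InE.ne {p : ℚ} (hp : InE p) : p ≠ 0 := by
  obtain ⟨k, a, b, ha, hb, h, rfl⟩ := hp
  have := odd_ne ha
  have := odd_ne hb
  positivity

theorem InE_one : InE 1 := ⟨0, 1, 1, odd_one, odd_one, by norm_num, by norm_num⟩

theorem InE_odd {a b : ℤ} (ha : Odd a) (hb : Odd b) (h : (4:ℤ) ∣ a - b) : InE ((a : ℚ) / b) :=
  ⟨0, a, b, ha, hb, h, by norm_num⟩

theorem InE.pow {p : ℚ} (hp : InE p) (n : ℕ) : InE (p ^ n) := by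
  induction n with
  | zero => simpa using InE_one
  | succ n ih => rw [pow_succ]; exact ih.mul hp

theorem InE.zpow {p : ℚ} (hp : InE p) (n : ℤ) : InE (p ^ n) := by
  obtain ⟨m, rfl | rfl⟩ := n.eq_nat_or_neg
  · rw [zpow_natCast]; exact hp.pow m
  · rw [zpow_neg, zpow_natCast]; exact (hp.pow m).inv

theorem InE_two : InE 2 := ⟨1, 1, 1, odd_one, odd_one, by norm_num, by norm_num⟩

theorem InE_int_sq {a : ℤ} (h : Odd a) : InE ((a : ℚ) ^ 2) := by
  have h1 : (4:ℤ) ∣ a ^ 2 - 1 := by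
    obtain ⟨c, rfl⟩ := h
    exact ⟨c ^ 2 + c, by ring⟩
  have := InE_odd (h.pow (n := 2)) odd_one h1
  simpa using this

theorem exists_odd_part {a : ℤ} (h : a ≠ 0) : ∃ (n : ℕ) (b : ℤ), Odd b ∧ a = 2 ^ n * b := by
  obtain ⟨b, h2, hb⟩ := (FiniteMultiplicity.of_prime_left Int.prime_two h).exists_eq_pow_mul_and_not_dvd
  generalize multiplicity 2 a = n at h2
  exact ⟨n, b, by rw [← Int.not_even_iff_odd, even_iff_two_dvd]; exact hb, h2⟩

theorem InE_sq {q : ℚ} (h : q ≠ 0) : InE (q ^ 2) := by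
  have key : ∀ a : ℤ, a ≠ 0 → InE ((a : ℚ) ^ 2) := by
    intro a ha
    obtain ⟨n, b, hb, rfl⟩ := exists_odd_part ha
    push_cast
    rw [mul_pow]
    exact ((InE_two.pow n).pow 2).mul (InE_int_sq hb)
  rw [← Rat.num_div_den q, div_pow]
  have h1 := key q.num (by simpa using h)
  have h2 := key (q.den : ℤ) (by simp)
  rw [div_eq_mul_inv]
  exact h1.mul (by simpa using h2.inv)

theorem not_InE_neg_one : ¬ InE (-1) := by
  rintro ⟨k, a, b, ha, hb, h, h1⟩
  have hb0 := odd_ne hb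
  have ha0 := odd_ne ha
  have h2 : (2:ℚ) ^ k * a = -b := by field_simp at h1; linear_combination -h1
  obtain ⟨n, rfl | rfl⟩ := k.eq_nat_or_neg
  · rw [zpow_natCast] at h2
    have h3 : (2:ℤ) ^ n * a = -b := by exact_mod_cast h2
    rcases Nat.eq_zero_or_pos n with rfl | hn
    · obtain ⟨c, hc⟩ := hb
      obtain ⟨d, hd⟩ := h
      omega
    · obtain ⟨m, rfl⟩ : ∃ m, n = m + 1 := ⟨n - 1, by omega⟩
      obtain ⟨c, hc⟩ := hb
      rw [pow_succ] at h3
      have : (2:ℤ) ∣ 1 := ⟨-(2 ^ m * a) - c, by linear_combination h3 - hc⟩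
      norm_num at this
  · rw [zpow_neg, zpow_natCast] at h2
    have h4 : (a : ℚ) = - b * 2 ^ n := by field_simp at h2; linear_combination h2
    have h3 : a = -b * (2:ℤ) ^ n := by exact_mod_cast h4
    rcases Nat.eq_zero_or_pos n with rfl | hn
    · obtain ⟨c, hc⟩ := hb
      obtain ⟨d, hd⟩ := h
      omega
    · obtain ⟨m, rfl⟩ : ∃ m, n = m + 1 := ⟨n - 1, by omega⟩
      obtain ⟨c, hc⟩ := ha
      rw [pow_succ] at h3
      have : (2:ℤ) ∣ 1 := ⟨-(2 ^ m * b) - c, by linear_combination h3 - hc⟩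
      norm_num at this

section H
variable {K : Type} [Field K] [NumberField K]

theorem norm_mod (n : ℕ) (x a : 𝓞 K) : (n : ℤ) ∣ Algebra.norm ℤ (x + n * a) - Algebra.norm ℤ x := by
  classical
  set b := RingOfIntegers.basis K
  rw [← ZMod.intCast_zmod_eq_zero_iff_dvd, Int.cast_sub, sub_eq_zero]
  rw [Algebra.norm_eq_matrix_det b, Algebra.norm_eq_matrix_det b]
  have := RingHom.map_det (Int.castRingHom (ZMod n)) (Algebra.leftMulMatrix b (x + n * a))
  have h2 := RingHom.map_det (Int.castRingHom (ZMod n)) (Algebra.leftMulMatrix b x)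
  rw [eq_intCast] at this h2
  rw [this, h2]
  congr 1
  have h3 : Algebra.leftMulMatrix b (x + n * a) = Algebra.leftMulMatrix b x + (n : ℤ) • Algebra.leftMulMatrix b a := by
    rw [map_add, ← map_zsmul]
    congr 2
    simp
  rw [h3, map_add, map_zsmul]
  ext i j
  simp

theorem norm_odd {v0 : Pl K} (hv0 : ∀ v : Pl K, od v (2:K) ≠ 0 → v = v0) {d : 𝓞 K} (hd : d ∉ v0.asIdeal) :
    Odd (Algebra.norm ℤ d) := by
  have hc : IsCoprime d 2 := by
    rw [← Ideal.isCoprime_span_singleton_iff, Ideal.isCoprime_iff_sup_eq]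
    by_contra h
    obtain ⟨m, hm, hle⟩ := Ideal.exists_le_maximal _ h
    have hd2 : d ∈ m := hle (Ideal.mem_sup_left (Ideal.mem_span_singleton_self d))
    have h22 : (2 : 𝓞 K) ∈ m := hle (Ideal.mem_sup_right (Ideal.mem_span_singleton_self 2))
    have hmb : m ≠ ⊥ := by
      rintro rfl
      have h22 : (2 : 𝓞 K) = 0 := by simpa using h22
      norm_num at h22
    have : (⟨m, hm.isPrime, hmb⟩ : Pl K) = v0 := by
      apply hv0
      have h3 := (OG_one_iff_mem (⟨m, hm.isPrime, hmb⟩ : Pl K) 2).2 h22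
      have e : ((2 : 𝓞 K) : K) = 2 := map_ofNat _ 2
      rw [e, OG_iff _ (two_ne K)] at h3
      omega
    rw [← this] at hd
    exact hd hd2
  obtain ⟨x, y, hxy⟩ := hc
  have h1 := norm_mod 2 (1 : 𝓞 K) (-y)
  have h2 : (1 : 𝓞 K) + ((2 : ℕ) : 𝓞 K) * -y = x * d := by push_cast; linear_combination -hxy
  rw [h2, map_mul, map_one] at h1
  obtain ⟨c, hc⟩ := h1
  have h3 : Odd (Algebra.norm ℤ x * Algebra.norm ℤ d) := ⟨c, by push_cast at hc; linarith⟩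
  exact (Int.odd_mul.1 h3).2

theorem norm_one_add_four {v0 : Pl K} (hv0 : ∀ v : Pl K, od v (2:K) ≠ 0 → v = v0) (h0 : od v0 (2:K) ≠ 0) {c : K} (hc : OG v0 0 c) :
    InE (Algebra.norm ℚ (1 + 4 * c)) := by
  obtain ⟨a, d, hd, h⟩ := exists_num_den v0 hc
  have hd0 : (d : K) ≠ 0 := (od_eq_zero_of_notMem v0 hd).1
  have h1 := norm_odd hv0 hd
  have h2 := norm_mod 4 d a
  have h3 : ((d + ((4:ℕ) : 𝓞 K) * a : 𝓞 K) : K) = (1 + 4 * c) * d := by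
    have e : ((d + ((4:ℕ) : 𝓞 K) * a : 𝓞 K) : K) = (d : K) + 4 * (a : K) := by push_cast; rfl
    rw [e]
    linear_combination -4 * h
  have h4 : Odd (Algebra.norm ℤ (d + ((4:ℕ) : 𝓞 K) * a)) := by
    obtain ⟨k, hk⟩ := h2
    obtain ⟨m, hm⟩ := h1
    refine ⟨m + 2 * k, ?_⟩
    push_cast at hk ⊢
    linarith
  have h5 := InE_odd h4 h1 h2
  have h6 : (Algebra.norm ℚ) ((d + ((4:ℕ) : 𝓞 K) * a : 𝓞 K) : K) / Algebra.norm ℚ (d : K) = Algebra.norm ℚ (1 + 4 * c) := by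
    rw [h3, map_mul, mul_div_assoc, div_self, mul_one]
    rw [Algebra.norm_ne_zero_iff]; exact hd0
  rw [← h6]
  rw [Algebra.coe_norm_int, Algebra.coe_norm_int] at h5
  exact h5

theorem norm_SqV0 {v0 : Pl K} (hv0 : ∀ v : Pl K, od v (2:K) ≠ 0 → v = v0) (h0 : od v0 (2:K) ≠ 0) {x : Kˣ} (hx : x ∈ SqV v0) :
    InE (Algebra.norm ℚ (x : K)) := by
  obtain ⟨y, hy⟩ := hx
  have h1 : OG v0 0 (((x : K) / (y : K) ^ 2 - 1) / 4) := by
    have := hy.mul (od_OG v0 (4:K)⁻¹)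
    rw [od_inv] at this
    rw [div_eq_mul_inv]
    exact this.mono (by omega)
  have h2 := norm_one_add_four hv0 h0 h1
  have h3 : (x : K) = (1 + 4 * (((x : K) / (y : K) ^ 2 - 1) / 4)) * (y : K) ^ 2 := by
    have := y.ne_zero
    field_simp
    ring
  rw [h3, map_mul, map_pow]
  exact h2.mul (InE_sq (Algebra.norm_ne_zero_iff.2 y.ne_zero))

theorem norm_pos_TC (hTC : IsEmpty (K →+* ℝ)) {x : K} (hx : x ≠ 0) : 0 < Algebra.norm ℚ x := by
  classical
  have h0 : Algebra.norm ℚ x ≠ 0 := Algebra.norm_ne_zero_iff.2 hx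
  have h1 := Algebra.norm_eq_prod_embeddings ℚ ℂ x
  have h2 : ∏ σ : K →ₐ[ℚ] ℂ, σ x = ∏ φ : K →+* ℂ, φ x := by
    rw [← Equiv.prod_comp (RingHom.equivRatAlgHom K ℂ)]
    rfl
  rw [h2, ← Finset.prod_fiberwise (g := fun φ : K →+* ℂ => InfinitePlace.mk φ)] at h1
  have h3 : ∀ w : InfinitePlace K, ∏ φ : K →+* ℂ with InfinitePlace.mk φ = w, φ x = ((Complex.normSq (w.embedding x) : ℝ) : ℂ) := by
    intro w
    have hne : w.embedding ≠ ComplexEmbedding.conjugate w.embedding := by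
      intro h
      have : ComplexEmbedding.IsReal w.embedding := h.symm
      exact hTC.false this.embedding
    have h4 : (Finset.univ.filter fun φ : K →+* ℂ => InfinitePlace.mk φ = w) = {w.embedding, ComplexEmbedding.conjugate w.embedding} := by
      ext φ
      rw [Finset.mem_filter, Finset.mem_insert, Finset.mem_singleton]
      constructor
      · rintro ⟨_, h⟩
        rw [← InfinitePlace.mk_embedding w, InfinitePlace.mk_eq_iff] at h
        rcases h with h | h
        · left; exact h
        · right; rw [← h]; exact (star_star φ).symm
      · rintro (h | h)
        · rw [h, InfinitePlace.mk_embedding]; exact ⟨Finset.mem_univ _, rfl⟩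
        · rw [h, InfinitePlace.mk_conjugate_eq, InfinitePlace.mk_embedding]; exact ⟨Finset.mem_univ _, rfl⟩
    rw [h4, Finset.prod_pair hne, ComplexEmbedding.conjugate_coe_eq, Complex.mul_conj]
  simp_rw [h3] at h1
  have h5 : ((Algebra.norm ℚ x : ℚ) : ℝ) = ∏ w : InfinitePlace K, Complex.normSq (w.embedding x) := by
    have : ((Algebra.norm ℚ x : ℚ) : ℂ) = ∏ w : InfinitePlace K, ((Complex.normSq (w.embedding x) : ℝ) : ℂ) := h1
    exact_mod_cast this
  have h6 : (0:ℝ) ≤ (Algebra.norm ℚ x : ℚ) := by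
    rw [h5]; exact Finset.prod_nonneg fun w _ => Complex.normSq_nonneg _
  have h7 : 0 ≤ Algebra.norm ℚ x := by exact_mod_cast h6
  exact lt_of_le_of_ne h7 h0.symm

end H
end

section
open Polynomial
set_option linter.all false
open IsDedekindDomain NumberField

section H
variable {K : Type} [Field K] [NumberField K]

theorem fp_apply (w : FinitePlace K) {x : K} (hx : x ≠ 0) :
    w x = (((Nm w.maximalIdeal : ℚ) ^ (-od w.maximalIdeal x) : ℚ) : ℝ) := by
  conv_lhs => rw [← FinitePlace.mk_maximalIdeal w]
  rw [FinitePlace.mk_apply, FinitePlace.norm_embedding', vl_eq _ hx,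
    WithZeroMulInt.toNNReal_neg_apply _ WithZero.exp_ne_zero]
  push_cast
  rfl

theorem Nm_InE_even {v : Pl K} (h2 : od v (2:K) ≠ 0) : InE (Nm v) := by
  haveI : v.asIdeal.IsMaximal := v.isMaximal
  letI : Field (𝓞 K ⧸ v.asIdeal) := Ideal.Quotient.field v.asIdeal
  haveI : Finite (𝓞 K ⧸ v.asIdeal) := by
    apply Nat.finite_of_card_ne_zero
    have := card_quot_pow v 1
    rw [pow_one, pow_one] at this
    rw [this]; exact (Nm_pos v).ne'
  letI : Fintype (𝓞 K ⧸ v.asIdeal) := Fintype.ofFinite _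
  have h0 : (2 : 𝓞 K ⧸ v.asIdeal) = 0 := by
    have h3 : (2 : 𝓞 K) ∈ v.asIdeal := by
      rw [← OG_one_iff_mem]
      have e : ((2 : 𝓞 K) : K) = 2 := map_ofNat _ 2
      rw [e, OG_iff _ (two_ne K)]
      have := od_two_nonneg v
      omega
    have := Ideal.Quotient.eq_zero_iff_mem.2 h3
    rwa [map_ofNat] at this
  haveI : CharP (𝓞 K ⧸ v.asIdeal) 2 := CharTwo.of_one_ne_zero_of_two_eq_zero one_ne_zero h0
  obtain ⟨n, _, hn⟩ := FiniteField.card (𝓞 K ⧸ v.asIdeal) 2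
  have h4 : Nm v = 2 ^ (n : ℕ) := by
    rw [← hn, ← Nat.card_eq_fintype_card]
    have := card_quot_pow v 1
    rw [pow_one, pow_one] at this
    exact this.symm
  rw [h4]
  push_cast
  exact InE_two.pow _

theorem Nm_odd {v : Pl K} (h2 : od v (2:K) = 0) : Nm v % 2 = 1 ∧ ((-1 : Kˣ) ∈ SqV v → Nm v % 4 ≠ 3) := by
  haveI : v.asIdeal.IsMaximal := v.isMaximal
  letI : Field (𝓞 K ⧸ v.asIdeal) := Ideal.Quotient.field v.asIdeal
  haveI : Finite (𝓞 K ⧸ v.asIdeal) := by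
    apply Nat.finite_of_card_ne_zero
    have := card_quot_pow v 1
    rw [pow_one, pow_one] at this
    rw [this]; exact (Nm_pos v).ne'
  letI : Fintype (𝓞 K ⧸ v.asIdeal) := Fintype.ofFinite _
  have h4 : Nm v = Fintype.card (𝓞 K ⧸ v.asIdeal) := by
    rw [← Nat.card_eq_fintype_card]
    have := card_quot_pow v 1
    rw [pow_one, pow_one] at this
    exact this.symm
  have h3 : (2 : 𝓞 K) ∉ v.asIdeal := by
    rw [← OG_one_iff_mem]
    have e : ((2 : 𝓞 K) : K) = 2 := map_ofNat _ 2
    rw [e, OG_iff _ (two_ne K)]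
    omega
  constructor
  · rw [h4]
    apply FiniteField.odd_card_of_char_ne_two
    intro hc
    haveI := ringChar.of_eq hc
    apply h3
    rw [← Ideal.Quotient.eq_zero_iff_mem, map_ofNat]
    exact CharTwo.two_eq_zero
  · rintro ⟨y, hy⟩
    rw [h4]
    rw [← FiniteField.isSquare_neg_one_iff]
    have h40 : od v (4:K) = 0 := by rw [od_four, h2]; norm_num
    rw [h40, zero_add] at hy
    obtain ⟨_, h6⟩ := one_add_unit v hy
    rw [add_sub_cancel, Units.val_neg, Units.val_one, od_div v (by simp) (pow_ne_zero 2 y.ne_zero), od_neg, od_one, od_pow] at h6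
    have hy0 : od v (y : K) = 0 := by push_cast at h6; omega
    obtain ⟨a, d, hd, had⟩ := exists_num_den v (x := (y : K)) ((OG_iff v y.ne_zero).2 hy0.ge)
    have h7 : a ^ 2 + d ^ 2 ∈ v.asIdeal := by
      rw [← OG_one_iff_mem]
      have e : ((a ^ 2 + d ^ 2 : 𝓞 K) : K) = (a : K) ^ 2 + (d : K) ^ 2 := rfl
      rw [e, ← had]
      have h8 := (hy.neg.mul (od_OG v ((y : K) ^ 2 * (d : K) ^ 2)))
      have hd1 := od_eq_zero_of_notMem v hd
      rw [od_mul v (pow_ne_zero 2 y.ne_zero) (pow_ne_zero 2 hd1.1), od_pow, od_pow, hy0, hd1.2] at h8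
      convert h8 using 1
      · norm_num
      · have := y.ne_zero
        rw [Units.val_neg, Units.val_one]
        field_simp
        ring
    have h8 := Ideal.Quotient.eq_zero_iff_mem.2 h7
    have hd9 : Ideal.Quotient.mk v.asIdeal d ≠ 0 := by rwa [Ne, Ideal.Quotient.eq_zero_iff_mem]
    refine ⟨Ideal.Quotient.mk v.asIdeal a / Ideal.Quotient.mk v.asIdeal d, ?_⟩
    rw [map_add, map_pow, map_pow] at h8
    field_simp
    linear_combination -h8

theorem norm_even_InE (hTC : IsEmpty (K →+* ℝ)) {x : K} (hx : x ≠ 0)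
    (h : ∀ v : Pl K, od v (2:K) = 0 → (-1 : Kˣ) ∉ SqV v → Even (od v x)) : InE (Algebra.norm ℚ x) := by
  have h1 := FinitePlace.prod_eq_inv_abs_norm hx
  have h2 : ∃ q : ℚ, InE q ∧ (q : ℝ) = ∏ᶠ w : FinitePlace K, w x := by
    refine finprod_induction (fun r : ℝ => ∃ q : ℚ, InE q ∧ (q : ℝ) = r) ⟨1, InE_one, by norm_num⟩ ?_ ?_
    · rintro _ _ ⟨p, hp, rfl⟩ ⟨q, hq, rfl⟩
      exact ⟨p * q, hp.mul hq, by push_cast; rfl⟩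
    · intro w
      refine ⟨_, ?_, (fp_apply w hx).symm⟩
      set v := w.maximalIdeal
      by_cases h2 : od v (2:K) = 0
      · have h3 := Nm_odd h2
        by_cases h4 : Nm v % 4 = 3
        · obtain ⟨k, hk⟩ := h v h2 (fun h5 => h3.2 h5 h4)
          have : -od v x = (-k) * 2 := by omega
          rw [this, zpow_mul]
          have h6 : (Nm v : ℚ) ≠ 0 := by exact_mod_cast (Nm_pos v).ne'
          exact InE_sq (zpow_ne_zero _ h6)
        · apply InE.zpow
          have := InE_odd (a := Nm v) (b := 1) (by rw [Int.odd_iff]; omega) odd_one (by omega)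
          simpa using this
      · exact (Nm_InE_even h2).zpow _
  obtain ⟨q, hq, h3⟩ := h2
  rw [h1] at h3
  have h4 : q = (Algebra.norm ℚ x)⁻¹ := by
    have : q = |Algebra.norm ℚ x|⁻¹ := by exact_mod_cast h3
    rw [this, abs_of_pos (norm_pos_TC hTC hx)]
  rw [h4] at hq
  simpa using hq.inv

/-- even order at `I` -/
def PV (I : Finset (Pl K)) : Subgroup Kˣ where
  carrier := {x | ∀ v ∈ I, Even (od v (x : K))}
  one_mem' := fun v _ => by rw [Units.val_one, od_one]; exact Even.zero
  mul_mem' := fun {a b} ha hb v hv => by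
    rw [Units.val_mul, od_mul v a.ne_zero b.ne_zero]; exact (ha v hv).add (hb v hv)
  inv_mem' := fun {a} ha v hv => by
    rw [Units.val_inv_eq_inv_val, od_inv]; exact (ha v hv).neg

theorem PV_index (I : Finset (Pl K)) : (PV I).index = 2 ^ I.card := by
  classical
  let f : Kˣ →* Multiplicative (I → ZMod 2) :=
    { toFun := fun x => Multiplicative.ofAdd fun v => ((od v.1 (x : K) : ℤ) : ZMod 2)
      map_one' := by
        apply Multiplicative.toAdd.injective
        funext v; simp [od_one]
      map_mul' := fun a b => by
        apply Multiplicative.toAdd.injective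
        funext v
        simp only [toAdd_ofAdd, toAdd_mul, Pi.add_apply]
        rw [Units.val_mul, od_mul v.1 a.ne_zero b.ne_zero]; push_cast; rfl }
  have hk : PV I = f.ker := by
    ext x
    rw [MonoidHom.mem_ker]
    constructor
    · intro h
      apply Multiplicative.toAdd.injective
      funext v
      exact (ZMod.intCast_zmod_eq_zero_iff_dvd _ 2).2 (by exact_mod_cast even_iff_two_dvd.1 (h v.1 v.2))
    · intro h v hv
      have := congrFun (congrArg Multiplicative.toAdd h) ⟨v, hv⟩
      have := (ZMod.intCast_zmod_eq_zero_iff_dvd _ 2).1 this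
      exact even_iff_two_dvd.2 (by exact_mod_cast this)
  have hs : Function.Surjective f := by
    intro y
    choose p hp0 hp1 using fun v : Pl K => exists_unif v
    obtain ⟨z, hz⟩ := weak_approx I (fun v => if h : v ∈ I then (if Multiplicative.toAdd y ⟨v, h⟩ = 0 then 1 else (p v : K)) else 1) 2
    have key : ∀ v (hv : v ∈ I), z ≠ 0 ∧ ((od v z : ℤ) : ZMod 2) = Multiplicative.toAdd y ⟨v, hv⟩ := by
      intro v hv
      have h1 := hz v hv
      rw [dif_pos hv] at h1
      by_cases h0 : Multiplicative.toAdd y ⟨v, hv⟩ = 0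
      · rw [if_pos h0] at h1
        have := od_add_eq v (x := (1:K)) one_ne_zero (h1.mono (by rw [od_one]; norm_num))
        rw [add_sub_cancel, od_one] at this
        refine ⟨this.1, by rw [this.2, h0]; norm_num⟩
      · rw [if_neg h0] at h1
        have := od_add_eq v (hp0 v) (h1.mono (by rw [hp1]; norm_num))
        rw [add_sub_cancel, hp1] at this
        refine ⟨this.1, ?_⟩
        rw [this.2]
        have h5 : ∀ t : ZMod 2, t ≠ 0 → (((1:ℤ)) : ZMod 2) = t := by decide
        exact h5 _ h0
    by_cases hI : I.Nonempty
    · obtain ⟨v, hv⟩ := hI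
      refine ⟨Units.mk0 z (key v hv).1, ?_⟩
      apply Multiplicative.toAdd.injective
      funext w
      exact (key w.1 w.2).2
    · refine ⟨1, ?_⟩
      apply Multiplicative.toAdd.injective
      funext w
      exact absurd ⟨w.1, w.2⟩ hI
  rw [hk, Subgroup.index_ker, MonoidHom.range_eq_top.2 hs, Subgroup.card_top]
  simp [Nat.card_eq_fintype_card]

theorem norm_even {v : Pl K} (h2 : od v (2:K) = 0) (hm : (-1 : Kˣ) ∉ SqV v) {x : Kˣ} (hx : x ∈ NK (-1 : K)) :
    Even (od v (x : K)) := by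
  obtain ⟨c, d, h⟩ := hx
  have h : (x : K) = c ^ 2 + d ^ 2 := by rw [h]; ring
  have h4 : od v (4:K) = 0 := by rw [od_four, h2]; norm_num
  by_cases hc : c = 0
  · rw [h, hc, zero_pow two_ne_zero, zero_add, od_pow]; exact even_iff_two_dvd.2 (by simp)
  by_cases hd : d = 0
  · rw [h, hd, zero_pow two_ne_zero, add_zero, od_pow]; exact even_iff_two_dvd.2 (by simp)
  have oc : od v (c ^ 2) = 2 * od v c := by rw [od_pow]; norm_num
  have odd' : od v (d ^ 2) = 2 * od v d := by rw [od_pow]; norm_num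
  rcases lt_trichotomy (od v c) (od v d) with h1 | h1 | h1
  · have := (od_add_eq v (pow_ne_zero 2 hc) ((OG_iff v (pow_ne_zero 2 hd)).2 (by omega))).2
    rw [h, this, oc]; simp
  · have h5 : od v (c ^ 2) ≤ od v (x : K) := by
      rw [← OG_iff v x.ne_zero, h]
      exact (od_OG v _).add ((OG_iff v (pow_ne_zero 2 hd)).2 (by omega))
    rcases h5.lt_or_eq with h6 | h6
    · exfalso
      apply hm
      refine ⟨Units.mk0 (c / d) (div_ne_zero hc hd), ?_⟩
      rw [h4, zero_add]
      have h7 : ((-1 : Kˣ) : K) / ((Units.mk0 (c / d) (div_ne_zero hc hd) : Kˣ) : K) ^ 2 - 1 = -(x / c ^ 2) := by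
        rw [Units.val_mk0, h, Units.val_neg, Units.val_one]; field_simp; ring
      rw [h7]
      refine OG.neg ((OG_iff v (div_ne_zero x.ne_zero (pow_ne_zero 2 hc))).2 ?_)
      rw [od_div v x.ne_zero (pow_ne_zero 2 hc)]; omega
    · rw [← h6, oc]; simp
  · have := (od_add_eq v (pow_ne_zero 2 hd) ((OG_iff v (pow_ne_zero 2 hc)).2 (by omega))).2
    rw [h, add_comm, this, odd']; simp

theorem finish_idx {G : Type} [CommGroup G] {N P U : Subgroup G} (hNP : N ≤ P) (hN : N.relIndex U ≠ 0)
    (h : N.relIndex U ≤ P.relIndex U) : P ⊓ U ≤ N := by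
  have h1 := Subgroup.relIndex_inf_mul_relIndex N P U
  rw [inf_eq_left.2 hNP] at h1
  rw [← Subgroup.relIndex_eq_one]
  have h2 : N.relIndex (P ⊓ U) ≠ 0 := fun h0 => hN (by rw [← h1, h0, zero_mul])
  have h3 : P.relIndex U ≠ 0 := fun h0 => hN (by rw [← h1, h0, mul_zero])
  rw [← h1] at h
  by_contra h4
  have : 2 * P.relIndex U ≤ N.relIndex (P ⊓ U) * P.relIndex U := Nat.mul_le_mul_right _ (by omega)
  omega

theorem od_neg_one (v : Pl K) : od v ((-1 : Kˣ) : K) = 0 := by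
  rw [Units.val_neg, od_neg, Units.val_one, od_one]

/-- Case 0 -/
theorem levelA (hTC : IsEmpty (K →+* ℝ)) (h : ∀ v : Pl K, od v (2:K) ≠ 0 → (-1 : Kˣ) ∈ SqV v) :
    ∃ c d : K, c ^ 2 + d ^ 2 = -1 := by
  classical
  by_cases hi : ∃ y : K, y ^ 2 = -1
  · obtain ⟨y, hy⟩ := hi; exact ⟨y, 0, by rw [hy]; ring⟩
  push Not at hi
  obtain ⟨S, hS, hPS⟩ := exists_PS (dy K)
  have hd : ∀ v ∉ S, od v (2:K) = 0 := fun v hv => by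
    by_contra h; exact hv (hS (mem_dy.2 h))
  obtain ⟨S', hSS', hS'1, hS'2, hS'3⟩ := core hTC hi S hPS hd
  set I := S.filter fun v => (-1 : Kˣ) ∉ SqV v with hI
  have hI2 : ∀ v ∈ I, od v (2:K) = 0 := fun v hv => by
    by_contra h2; exact (Finset.mem_filter.1 hv).2 (h v h2)
  have hst := stepA hTC (-1 : Kˣ) (fun y => by simpa using hi y) S' I ((Finset.filter_subset _ _).trans hSS') (hPS.mono hSS')
    (fun v hv => hd v fun h => hv (hSS' h)) (fun v _ => od_neg_one v) (fun v hv hvI => by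
      by_cases hvS : v ∈ S
      · by_contra h2; exact hvI (Finset.mem_filter.2 ⟨hvS, h2⟩)
      · exact hS'1 v hv hvS)
  have e1 : ((-1 : Kˣ) : K) = -1 := by simp
  rw [e1] at hst
  have hNP : NK (-1 : K) ≤ PV I := fun x hx v hv => norm_even (hI2 v hv) (Finset.mem_filter.1 hv).2 hx
  have hSP : SqS S ≤ PV I := fun x hx v hv => by
    obtain ⟨k, hk⟩ := even_of_SqV (mem_SqS.1 hx v (Finset.mem_filter.1 hv).1)
    rw [hk]; simp
  have hidx : 2 ^ I.card ≤ 2 * (PV I).relIndex (SU S') := by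
    have h1 := Subgroup.relIndex_mul_index (H := PV I) (K := SU S' ⊔ PV I) le_sup_right
    rw [Subgroup.relIndex_sup_right, PV_index] at h1
    have h2 := Nat.le_of_dvd (Nat.pos_of_ne_zero hS'2) (Subgroup.index_dvd_of_le (sup_le_sup_left hSP (SU S')))
    rw [← h1, mul_comm]
    exact Nat.mul_le_mul_right _ (h2.trans hS'3)
  have hf := finish_idx hNP hst.1 (U := SU S') (by omega)
  have : (-1 : Kˣ) ∈ NK (-1 : K) := hf ⟨fun v _ => by rw [od_neg_one]; exact Even.zero, fun v _ => od_neg_one v⟩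
  obtain ⟨c, d, h⟩ := this
  exact ⟨c, d, by rw [e1] at h; linear_combination -h⟩

/-- Case 1 -/
theorem levelB (hTC : IsEmpty (K →+* ℝ)) {v0 : Pl K} (h0 : od v0 (2:K) ≠ 0) (hv0 : ∀ v : Pl K, od v (2:K) ≠ 0 → v = v0)
    (α : K) (hα0 : α ≠ 0) (hα : InE (-Algebra.norm ℚ α)) : ∃ c d : K, c ^ 2 + d ^ 2 = -1 := by
  classical
  by_cases hi : ∃ y : K, y ^ 2 = -1
  · obtain ⟨y, hy⟩ := hi; exact ⟨y, 0, by rw [hy]; ring⟩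
  push Not at hi
  obtain ⟨S, hS, hPS⟩ := exists_PS (dy K)
  have hd : ∀ v ∉ S, od v (2:K) = 0 := fun v hv => by
    by_contra h; exact hv (hS (mem_dy.2 h))
  obtain ⟨S', hSS', hS'1, hS'2, hS'3⟩ := core hTC hi S hPS hd
  have hv0S : v0 ∈ S := hS (mem_dy.2 h0)
  set I := S.filter fun v => (-1 : Kˣ) ∉ SqV v ∧ od v (2:K) = 0 with hI
  have hI2 : ∀ v ∈ I, od v (2:K) = 0 := fun v hv => (Finset.mem_filter.1 hv).2.2
  have hv0I : v0 ∉ I := fun h => h0 (hI2 _ h)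
  have hst := stepA hTC (-1 : Kˣ) (fun y => by simpa using hi y) S' (insert v0 I)
    (by
      intro v hv
      rcases Finset.mem_insert.1 hv with rfl | hv
      · exact hSS' hv0S
      · exact hSS' (Finset.filter_subset _ _ hv)) (hPS.mono hSS')
    (fun v hv => hd v fun h => hv (hSS' h)) (fun v _ => od_neg_one v) (fun v hv hvI => by
      rw [Finset.mem_insert, not_or] at hvI
      by_cases hvS : v ∈ S
      · by_contra h2
        refine hvI.2 (Finset.mem_filter.2 ⟨hvS, h2, ?_⟩)
        by_contra h3; exact hvI.1 (hv0 v h3)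
      · exact hS'1 v hv hvS)
  have e1 : ((-1 : Kˣ) : K) = -1 := by simp
  rw [e1, Finset.card_insert_of_notMem hv0I, pow_succ] at hst
  have hNP : NK (-1 : K) ≤ PV I := fun x hx v hv => norm_even (hI2 v hv) (Finset.mem_filter.1 hv).2.1 hx
  have hSP : SqS S ≤ PV I := fun x hx v hv => by
    obtain ⟨k, hk⟩ := even_of_SqV (mem_SqS.1 hx v (Finset.mem_filter.1 hv).1)
    rw [hk]; simp
  have htop : SU S' ⊔ PV I = ⊤ := by
    by_contra hne
    have hle : SU S' ⊔ SqS S ≤ SU S' ⊔ PV I := sup_le_sup_left hSP (SU S')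
    have h1 := Subgroup.relIndex_mul_index hle
    have h2 : (SU S' ⊔ PV I).index ≠ 1 := fun h => hne (Subgroup.index_eq_one.1 h)
    have h3 : (SU S' ⊔ PV I).index ≠ 0 := fun h => hS'2 (by rw [← h1, h, mul_zero])
    have h4 : (SU S' ⊔ SqS S).relIndex (SU S' ⊔ PV I) = 1 := by
      have h5 : (SU S' ⊔ SqS S).relIndex (SU S' ⊔ PV I) ≠ 0 := fun h => hS'2 (by rw [← h1, h, zero_mul])
      by_contra h6
      have : 2 * 2 ≤ (SU S' ⊔ SqS S).relIndex (SU S' ⊔ PV I) * (SU S' ⊔ PV I).index :=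
        Nat.mul_le_mul (by omega) (by omega)
      omega
    rw [Subgroup.relIndex_eq_one] at h4
    have hPA : PV I ≤ SU S' ⊔ SqS S := le_sup_right.trans h4
    obtain ⟨β, hβ⟩ := weak_approx (insert v0 I) (fun v => if v = v0 then α else 1) ((od v0 (4:K) + od v0 α + 1).toNat + 1)
    have hβv0 := hβ v0 (Finset.mem_insert_self _ _)
    rw [if_pos rfl] at hβv0
    have h4n := od_four_nonneg v0
    have hβ0 := od_add_eq v0 hα0 (hβv0.mono (by omega))
    rw [add_sub_cancel] at hβ0
    have hβP : (Units.mk0 β hβ0.1) ∈ PV I := by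
      intro v hv
      have h1 := hβ v (Finset.mem_insert_of_mem hv)
      rw [if_neg (by rintro rfl; exact hv0I hv)] at h1
      have := od_add_eq v (x := (1:K)) one_ne_zero (h1.mono (by rw [od_one]; omega))
      rw [add_sub_cancel, od_one] at this
      rw [Units.val_mk0, this.2]; exact Even.zero
    obtain ⟨u, hu, s, hs, hus⟩ := Subgroup.mem_sup.1 (hPA hβP)
    have hsE : InE (Algebra.norm ℚ (s : K)) := norm_SqV0 hv0 h0 (mem_SqS.1 hs v0 hv0S)
    have huE : InE (Algebra.norm ℚ (u : K)) := by
      refine norm_even_InE hTC u.ne_zero fun v hv2 hv => ?_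
      by_cases hvS : v ∈ S
      · have hvI : v ∈ I := Finset.mem_filter.2 ⟨hvS, hv, hv2⟩
        have : u = Units.mk0 β hβ0.1 * s⁻¹ := by rw [← hus]; group
        rw [this]
        exact (PV I).mul_mem hβP ((PV I).inv_mem (hSP hs)) v hvI
      · by_cases hvS' : v ∈ S'
        · exact absurd (hS'1 v hvS' hvS) hv
        · rw [hu v hvS']; exact Even.zero
    have hβE : InE (Algebra.norm ℚ β) := by
      have : β = (u : K) * (s : K) := by rw [← Units.val_mul, hus, Units.val_mk0]
      rw [this, map_mul]; exact huE.mul hsE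
    have hr : InE (Algebra.norm ℚ (β / α)) := by
      have h1 : Units.mk0 (β / α) (div_ne_zero hβ0.1 hα0) ∈ SqV v0 := by
        apply mem_SqV_of_OG
        have h2 := hβv0.mul (od_OG v0 α⁻¹)
        rw [od_inv] at h2
        have h3 : (β - α) * α⁻¹ = ((Units.mk0 (β / α) (div_ne_zero hβ0.1 hα0) : Kˣ) : K) - 1 := by
          rw [Units.val_mk0]; field_simp
        rw [h3] at h2
        exact h2.mono (by omega)
      exact norm_SqV0 hv0 h0 h1
    have h7 : InE (Algebra.norm ℚ α) := by
      have h8 : Algebra.norm ℚ β = Algebra.norm ℚ (β / α) * Algebra.norm ℚ α := by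
        rw [← map_mul, div_mul_cancel₀ _ hα0]
      have h10 : Algebra.norm ℚ α = Algebra.norm ℚ β * (Algebra.norm ℚ (β / α))⁻¹ := by
        rw [h8]; have := hr.ne; field_simp
      rw [h10]
      exact hβE.mul hr.inv
    have h9 := hα.mul h7.inv
    rw [neg_mul, mul_inv_cancel₀ h7.ne] at h9
    exact not_InE_neg_one h9
  have hidx : 2 ^ I.card ≤ (PV I).relIndex (SU S') := by
    have h1 := Subgroup.relIndex_mul_index (H := PV I) (K := SU S' ⊔ PV I) le_sup_right
    rw [Subgroup.relIndex_sup_right, PV_index, htop, Subgroup.index_top, mul_one] at h1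
    exact h1.ge
  have hf := finish_idx hNP hst.1 (U := SU S') (by omega)
  have : (-1 : Kˣ) ∈ NK (-1 : K) := hf ⟨fun v _ => by rw [od_neg_one]; exact Even.zero, fun v _ => od_neg_one v⟩
  obtain ⟨c, d, h⟩ := this
  exact ⟨c, d, by rw [e1] at h; linear_combination -h⟩

end H
end

section
open Polynomial
set_option linter.all false
open IsDedekindDomain NumberField

section TR
variable {K M : Type} [Field K] [NumberField K] [Field M] [NumberField M] [Algebra K M]

instance maxPl (v : Pl K) : v.asIdeal.IsMaximal := v.isPrime.isMaximal v.ne_bot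

noncomputable def inert (K : Type) {M : Type} [Field K] [NumberField K] [Field M] [NumberField M] [Algebra K M]
    (w : Pl M) : ℕ := (und K w).asIdeal.inertiaDeg' w.asIdeal

theorem inert_eq (w : Pl M) : inert K w = Module.finrank (𝓞 K ⧸ (und K w).asIdeal) (𝓞 M ⧸ w.asIdeal) :=
  Ideal.inertiaDeg'_algebraMap _ _

theorem inert_pos (w : Pl M) : 0 < inert K w :=
  Nat.pos_of_ne_zero (Ideal.inertiaDeg'_ne_zero _ _)

theorem TR0 (v : Pl K) (d : ℕ) (hd : 0 < d) (hle : Module.finrank K M ≤ d)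
    (h : ∀ w : Pl M, und K w = v → d ≤ ram K w * inert K w) :
    Module.finrank K M = d ∧ ∃ w : Pl M, und K w = v ∧ (∀ w', und K w' = v → w' = w) ∧ ram K w * inert K w = d := by
  have hs := Ideal.sum_ramification_inertia (𝓞 M) K M (p := v.asIdeal) v.ne_bot
  have key : ∀ P ∈ IsDedekindDomain.primesOverFinset v.asIdeal (𝓞 M),
      ∃ w : Pl M, w.asIdeal = P ∧ und K w = v := by
    intro P hP
    obtain ⟨h1, h2⟩ := (IsDedekindDomain.mem_primesOverFinset_iff v.ne_bot _).1 hP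
    refine ⟨⟨P, h1, ?_⟩, rfl, HeightOneSpectrum.ext h2.over.symm⟩
    rintro rfl
    apply v.ne_bot
    have := h2.over
    rw [this, Ideal.under_def]
    exact Ideal.comap_bot_of_injective _ (FaithfulSMul.algebraMap_injective _ _)
  have key2 : ∀ w : Pl M, und K w = v → w.asIdeal ∈ IsDedekindDomain.primesOverFinset v.asIdeal (𝓞 M) := by
    rintro w rfl
    exact (IsDedekindDomain.mem_primesOverFinset_iff (und K w).ne_bot _).2 ⟨w.isPrime, ⟨rfl⟩⟩
  obtain ⟨w, hw⟩ := exists_above (M := M) v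
  have hval : ∀ w : Pl M, und K w = v → v.asIdeal.ramificationIdx' w.asIdeal * v.asIdeal.inertiaDeg' w.asIdeal = ram K w * inert K w := by
    rintro w rfl; rfl
  have h3 : ∀ w' : Pl M, und K w' = v → w' = w := by
    intro w' hw'
    by_contra hne
    have hne' : w'.asIdeal ≠ w.asIdeal := fun h => hne (HeightOneSpectrum.ext h)
    have : ∑ P ∈ {w'.asIdeal, w.asIdeal}, v.asIdeal.ramificationIdx' P * v.asIdeal.inertiaDeg' P ≤ Module.finrank K M := by
      rw [← hs]
      apply Finset.sum_le_sum_of_subset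
      intro P hP
      rw [Finset.mem_insert, Finset.mem_singleton] at hP
      rcases hP with rfl | rfl
      · exact key2 _ hw'
      · exact key2 _ hw
    rw [Finset.sum_pair hne', hval _ hw, hval _ hw'] at this
    have := h w hw
    have := h w' hw'
    omega
  have h4 : IsDedekindDomain.primesOverFinset v.asIdeal (𝓞 M) = {w.asIdeal} := by
    ext P
    rw [Finset.mem_singleton]
    constructor
    · intro hP
      obtain ⟨w', rfl, hw'⟩ := key P hP
      rw [h3 w' hw']
    · rintro rfl; exact key2 _ hw
  rw [h4, Finset.sum_singleton, hval _ hw] at hs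
  have := h w hw
  exact ⟨by omega, w, hw, h3, by omega⟩

theorem exists_adj (p : K[X]) (hirr : Irreducible p) :
    ∃ (M : Type) (_ : Field M) (_ : NumberField M) (_ : Algebra K M) (θ : M), aeval θ p = 0 ∧
      Module.finrank K M = p.natDegree := by
  haveI : Fact (Irreducible p) := ⟨hirr⟩
  let M := AdjoinRoot p
  let pb := AdjoinRoot.powerBasis hirr.ne_zero
  haveI : Module.Finite K M := pb.finite
  haveI : CharZero M := charZero_of_injective_algebraMap (algebraMap K M).injective
  haveI : Module.Finite ℚ M := Module.Finite.trans K M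
  haveI : NumberField M := ⟨⟩
  refine ⟨M, inferInstance, inferInstance, inferInstance, AdjoinRoot.root p, ?_, ?_⟩
  · rw [aeval_def]; exact AdjoinRoot.eval₂_root p
  · exact pb.finrank.trans (AdjoinRoot.powerBasis_dim hirr.ne_zero)

end TR

/-- odd degree, unique dyadic place, odd absolute ramification -/
def Good (F : Type) [Field F] [NumberField F] (v : Pl F) : Prop :=
  Odd (Module.finrank ℚ F) ∧ Odd (od v (2:F)) ∧ ∀ w : Pl F, od w (2:F) ≠ 0 → w = v

section Good
variable {F : Type} [Field F] [NumberField F] {v : Pl F}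

theorem Good.two_pos (h : Good F v) : 0 < od v (2:F) := by
  have := od_two_nonneg v
  have := h.2.1
  rcases this with ⟨k, hk⟩
  omega

theorem Good.ext {M : Type} [Field M] [NumberField M] [Algebra F M] (h : Good F v) (d : ℕ) (hd : Odd d)
    (hle : Module.finrank F M ≤ d) (hw : ∀ w : Pl M, und F w = v → d ≤ ram F w * inert F w) :
    ∃ w : Pl M, Good M w ∧ und F w = v ∧ ram F w * inert F w = d := by
  obtain ⟨h1, w, h2, h3, h4⟩ := TR0 v d hd.pos hle hw
  refine ⟨w, ⟨?_, ?_, ?_⟩, h2, h4⟩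
  · rw [← Module.finrank_mul_finrank ℚ F M, h1]; exact h.1.mul hd
  · have : od w (2:M) = ram F w * od v (2:F) := by
      rw [← h2, ← od_alg, map_ofNat]
    rw [this]
    refine Odd.mul ?_ h.2.1
    rw [← h4] at hd
    exact_mod_cast (Nat.odd_mul.1 hd).1
  · intro w' hw'
    apply h3
    apply h.2.2
    intro h0
    apply hw'
    have : od w' (2:M) = ram F w' * od (und F w') (2:F) := by
      rw [← od_alg, map_ofNat]
    rw [this, h0, mul_zero]

/-- totally ramified extension -/
theorem lemR (h : Good F v) (q : ℕ) (hq : Odd q) :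
    ∃ (M : Type) (_ : Field M) (_ : NumberField M) (i : F →+* M) (w : Pl M), Good M w ∧
      ∀ x : F, od w (i x) = q * od v x := by
  obtain ⟨p, hp0, hp1⟩ := exists_unif v
  have hm : (X ^ q - C (p : F) : F[X]).Monic := monic_X_pow_sub_C _ hq.pos.ne'
  have hdeg : (X ^ q - C (p : F) : F[X]).natDegree = q := natDegree_X_pow_sub_C
  obtain ⟨π, hπ, hd⟩ := exists_irreducible_of_natDegree_pos (f := (X ^ q - C (p : F) : F[X])) (by rw [hdeg]; exact hq.pos)
  obtain ⟨M, _, _, _, θ, hθ, hfr⟩ := exists_adj π hπ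
  have hθq : θ ^ q = algebraMap F M p := by
    obtain ⟨r, hr⟩ := hd
    have := congrArg (aeval θ) hr
    rw [map_mul, hθ, zero_mul, map_sub, map_pow, aeval_X, aeval_C, sub_eq_zero] at this
    exact this
  have hram : ∀ w : Pl M, und F w = v → (q : ℤ) * od w θ = ram F w := by
    intro w hw
    rw [← od_pow, hθq, od_alg, hw]
    have : od v (algebraMap (𝓞 F) F p) = 1 := hp1
    rw [this, mul_one]
  have hram2 : ∀ w : Pl M, und F w = v → q ∣ ram F w := fun w hw => by
    have : (q : ℤ) ∣ ram F w := ⟨_, (hram w hw).symm⟩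
    exact_mod_cast this
  obtain ⟨w, hg, hw, hwd⟩ := h.ext (M := M) q hq (by rw [hfr, ← hdeg]; exact natDegree_le_of_dvd hd hm.ne_zero) (by
    intro w hw
    exact (Nat.le_of_dvd (ram_pos w) (hram2 w hw)).trans (Nat.le_mul_of_pos_right _ (inert_pos w)))
  refine ⟨M, _, _, algebraMap F M, w, hg, fun x => ?_⟩
  have : ram F w = q := by
    apply Nat.dvd_antisymm
    · exact ⟨_, hwd.symm⟩
    · exact hram2 w hw
  rw [od_alg, this, hw]

/-- unramified extension -/
theorem lemU (h : Good F v) (p : (𝓞 F ⧸ v.asIdeal)[X]) (hp : Irreducible p) (hodd : Odd p.natDegree) :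
    ∃ (M : Type) (_ : Field M) (_ : NumberField M) (i : 𝓞 F →+* 𝓞 M) (w : Pl M) (j : (𝓞 F ⧸ v.asIdeal) →+* (𝓞 M ⧸ w.asIdeal))
      (i' : F →+* M) (s : 𝓞 M), Good M w ∧
      (∀ x : F, od w (i' x) = od v x) ∧ (∀ x : 𝓞 F, i' (x : F) = (i x : M)) ∧
      (∀ x : 𝓞 F, j (Ideal.Quotient.mk _ x) = Ideal.Quotient.mk _ (i x)) ∧
      p.eval₂ j (Ideal.Quotient.mk _ s) = 0 := by
  letI : Field (𝓞 F ⧸ v.asIdeal) := Ideal.Quotient.field _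
  set p' := p * C p.leadingCoeff⁻¹ with hp'
  have hp'm : p'.Monic := monic_mul_leadingCoeff_inv hp.ne_zero
  have hp'd : p'.natDegree = p.natDegree := natDegree_mul_leadingCoeff_inv _ hp.ne_zero
  have hp'0 : p ∣ p' := ⟨_, rfl⟩
  have hp'i : Irreducible p' := by
    have : Associated p p' := by
      refine ⟨⟨C p.leadingCoeff⁻¹, C p.leadingCoeff, ?_, ?_⟩, rfl⟩
      · rw [← C_mul, inv_mul_cancel₀ (leadingCoeff_ne_zero.2 hp.ne_zero), C_1]
      · rw [← C_mul, mul_inv_cancel₀ (leadingCoeff_ne_zero.2 hp.ne_zero), C_1]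
    exact this.irreducible hp
  have hlift : p' ∈ lifts (Ideal.Quotient.mk v.asIdeal) := by
    rw [mem_lifts]
    exact map_surjective _ Ideal.Quotient.mk_surjective p'
  obtain ⟨P, hP1, hP2, hPm⟩ := lifts_and_natDegree_eq_and_monic hlift hp'm
  set r := p.natDegree with hr
  have hPF : (P.map (algebraMap (𝓞 F) F)).natDegree = r := by
    rw [hPm.natDegree_map, hP2, hp'd]
  obtain ⟨π, hπ, hd⟩ := exists_irreducible_of_natDegree_pos (f := P.map (algebraMap (𝓞 F) F)) (by rw [hPF]; exact hodd.pos)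
  obtain ⟨M, _, _, _, θ, hθ, hfr⟩ := exists_adj π hπ
  have hθP : aeval θ P = 0 := by
    obtain ⟨q, hq⟩ := hd
    have := congrArg (aeval θ) hq
    rw [map_mul, hθ, zero_mul, aeval_map_algebraMap] at this
    exact this
  have hθi : IsIntegral ℤ θ := by
    have : IsIntegral (𝓞 F) θ := ⟨P, hPm, by rw [← aeval_def]; exact hθP⟩
    exact isIntegral_trans (R := ℤ) θ this
  obtain ⟨s, hs⟩ : ∃ s : 𝓞 M, (s : M) = θ := ⟨⟨θ, hθi⟩, rfl⟩
  have hsP : aeval s P = 0 := by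
    apply RingOfIntegers.ext
    have : ((aeval s P : 𝓞 M) : M) = aeval (s : M) P := (aeval_algebraMap_apply M s P).symm
    rw [this, hs, hθP]; rfl
  have hroot : ∀ w : Pl M, aeval (Ideal.Quotient.mk w.asIdeal s) (P.map (Ideal.Quotient.mk (und F w).asIdeal)) = 0 := by
    intro w
    have : aeval (Ideal.Quotient.mk w.asIdeal s) (P.map (algebraMap (𝓞 F) (𝓞 F ⧸ (und F w).asIdeal))) = 0 := by
      rw [aeval_map_algebraMap]
      have : aeval (algebraMap (𝓞 M) (𝓞 M ⧸ w.asIdeal) s) P = 0 := by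
        rw [aeval_algebraMap_apply, hsP, map_zero]
      exact this
    exact this
  have hin : ∀ w : Pl M, und F w = v → r ≤ inert F w := by
    rintro w rfl
    letI : Field (𝓞 M ⧸ w.asIdeal) := Ideal.Quotient.field _
    rw [inert_eq]
    have h1 := hroot w
    rw [hP1] at h1
    have h2 := minpoly.eq_of_irreducible_of_monic hp'i h1 hp'm
    rw [← hp'd, h2]
    haveI : Module.Finite (𝓞 F ⧸ (und F w).asIdeal) (𝓞 M ⧸ w.asIdeal) := by
      haveI : Module.Finite (𝓞 F) (𝓞 M ⧸ w.asIdeal) := inferInstance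
      exact Module.Finite.of_restrictScalars_finite (𝓞 F) _ _
    exact minpoly.natDegree_le _
  obtain ⟨w, hg, hw, hwd⟩ := h.ext (M := M) r hodd (by rw [hfr, ← hPF]; exact natDegree_le_of_dvd hd (hPm.map _).ne_zero) (by
    intro w hw
    exact (hin w hw).trans (Nat.le_mul_of_pos_left _ (ram_pos w)))
  have hram : ram F w = 1 := by
    have h1 := hin w hw
    have h2 := ram_pos (K := F) w
    have h3 := inert_pos (K := F) w
    by_contra hne
    have h4 : 2 ≤ ram F w := by omega
    have := Nat.mul_le_mul h4 h1
    have hr0 := hodd.pos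
    nlinarith [Nat.mul_le_mul h4 (le_refl (inert F w))]
  subst hw
  refine ⟨M, _, _, algebraMap (𝓞 F) (𝓞 M), w, algebraMap _ _, algebraMap F M, s, hg, ?_, ?_, ?_, ?_⟩
  · intro x; rw [od_alg, hram]; simp
  · intro x; rfl
  · intro x; rfl
  · have h1 := hroot w
    rw [hP1, hp', map_mul, mul_eq_zero] at h1
    rcases h1 with h1 | h1
    · exact h1
    · exfalso
      rw [aeval_C] at h1
      have := (map_eq_zero _).1 h1
      exact inv_ne_zero (leadingCoeff_ne_zero.2 hp.ne_zero) this
end Good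
end

section
open Polynomial
set_option linter.all false
open IsDedekindDomain NumberField

def Goal {F : Type} [Field F] [NumberField F] (Ψ : F[X]) : Prop :=
  ∃ (M : Type) (_ : Field M) (_ : NumberField M) (i : F →+* M) (w : Pl M) (t g : M), Good M w ∧
    Odd (od w (Ψ.eval₂ i t - g ^ 2)) ∧ (g = 0 ∨ od w (Ψ.eval₂ i t - g ^ 2) < 2 * od w g + od w (2:M))

section G
variable {F : Type} [Field F] [NumberField F] {v : Pl F}

theorem Goal.comp {Ψ : F[X]} {s c : F} (h : Goal (Ψ.comp (C s + C c * X))) : Goal Ψ := by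
  obtain ⟨M, _, _, i, w, t, g, h1, h2, h3⟩ := h
  rw [eval₂_comp] at h2 h3
  exact ⟨M, _, _, i, w, _, g, h1, h2, h3⟩

theorem Goal.comp' {Ψ : F[X]} {c : F} (h : Goal (Ψ.comp (C c * X))) : Goal Ψ := by
  apply Goal.comp (s := 0) (c := c)
  rwa [C_0, zero_add]

theorem Goal.map {M : Type} [Field M] [NumberField M] {Ψ : F[X]} {i : F →+* M} (h : Goal (Ψ.map i)) : Goal Ψ := by
  obtain ⟨M, _, _, i, w, t, g, h1, h2, h3⟩ := h
  rw [eval₂_map] at h2 h3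
  exact ⟨M, _, _, _, w, _, g, h1, h2, h3⟩

/-- the coefficient `n` strictly dominates -/
def Vx (v : Pl F) (Ψ : F[X]) (n : ℕ) : Prop :=
  Ψ.coeff n ≠ 0 ∧ ∀ j, j ≠ n → OG v (od v (Ψ.coeff n) + 1) (Ψ.coeff j)

theorem Vx.eval {Ψ : F[X]} {n : ℕ} (h : Vx v Ψ n) : od v (Ψ.eval 1) = od v (Ψ.coeff n) := by
  rw [eval_eq_sum_range]
  have hn : n ∈ Finset.range (Ψ.natDegree + 1) := by
    rw [Finset.mem_range]
    have := le_natDegree_of_ne_zero h.1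
    omega
  rw [← Finset.add_sum_erase _ _ hn, one_pow, mul_one]
  refine (od_add_eq v h.1 ?_).2
  apply OG.sum
  intro j hj
  rw [one_pow, mul_one]
  exact h.2 j (Finset.ne_of_mem_erase hj)

theorem exists_unif' (v : Pl F) : ∃ p : F, p ≠ 0 ∧ od v p = 1 := by
  obtain ⟨p, h1, h2⟩ := exists_unif v
  exact ⟨_, h1, h2⟩

theorem slopeR (h : Good F v) (Ψ : F[X]) (i : ℕ) (hi : Ψ.coeff i ≠ 0) (A B : ℤ) (hB : 0 < B)
    (hle : ∀ j, Ψ.coeff j ≠ 0 → ((i : ℤ) - j) * A ≤ B * (od v (Ψ.coeff j) - od v (Ψ.coeff i)))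
    (hlt : ∀ j, j < i → Ψ.coeff j ≠ 0 → ((i : ℤ) - j) * A < B * (od v (Ψ.coeff j) - od v (Ψ.coeff i)))
    (ε : ℤ) :
    ∃ (M : Type) (_ : Field M) (_ : NumberField M) (ι : F →+* M) (w : Pl M) (c : M) (q : ℕ) (τ : ℤ), Good M w ∧ c ≠ 0 ∧
      Odd q ∧ Even (τ - ε) ∧ Vx w ((Ψ.map ι).comp (C c * X)) i ∧
      od w (((Ψ.map ι).comp (C c * X)).coeff i) = q * od v (Ψ.coeff i) + i * τ := by
  obtain ⟨b, rfl⟩ := Int.eq_ofNat_of_zero_le hB.le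
  obtain ⟨M, _, _, ι, w, hg, hod⟩ := lemR h (2 * (2 * b * i + b) + 1) ⟨_, rfl⟩
  set q : ℕ := 2 * (2 * b * i + b) + 1 with hq
  obtain ⟨τ, δ, hδ0, hδ1, hτ, hev⟩ : ∃ τ δ : ℤ, 0 < δ ∧ δ ≤ 2 * b ∧ b * τ = q * A + δ ∧ Even (τ - ε) := by
    have h1 := Int.emod_add_mul_ediv (q * A) b
    have h2 := Int.emod_nonneg (q * A) hB.ne'
    have h3 := Int.emod_lt_of_pos (q * A) hB
    rcases Int.even_or_odd ((q * A) / b + 1 - ε) with he | ho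
    · exact ⟨(q * A) / b + 1, b - (q * A) % b, by omega, by omega, by linear_combination h1, he⟩
    · refine ⟨(q * A) / b + 2, 2 * b - (q * A) % b, by omega, by omega, by linear_combination h1, ?_⟩
      have := ho.add_odd odd_one
      have e : (q * A) / b + 2 - ε = (q * A) / b + 1 - ε + 1 := by ring
      rw [e]; exact this
  obtain ⟨p, hp0, hp1⟩ := exists_unif' w
  have hc0 : p ^ τ ≠ 0 := zpow_ne_zero _ hp0
  have hco : ∀ j, Ψ.coeff j ≠ 0 → od w (((Ψ.map ι).comp (C (p ^ τ) * X)).coeff j) = q * od v (Ψ.coeff j) + j * τ := by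
    intro j hj
    rw [comp_C_mul_X_coeff, coeff_map, od_mul _ (by simpa using hj) (pow_ne_zero _ hc0), hod, od_pow, od_zpow, hp1, mul_one]
  have hco0 : ∀ j, Ψ.coeff j ≠ 0 → ((Ψ.map ι).comp (C (p ^ τ) * X)).coeff j ≠ 0 := by
    intro j hj
    rw [comp_C_mul_X_coeff, coeff_map]
    exact mul_ne_zero (by simpa using hj) (pow_ne_zero _ hc0)
  refine ⟨M, _, _, ι, w, p ^ τ, q, τ, hg, hc0, ⟨_, rfl⟩, hev, ⟨hco0 i hi, ?_⟩, hco i hi⟩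
  intro j hj
  by_cases hj0 : Ψ.coeff j = 0
  · have : ((Ψ.map ι).comp (C (p ^ τ) * X)).coeff j = 0 := by
      rw [comp_C_mul_X_coeff, coeff_map, hj0, map_zero, zero_mul]
    rw [this]; exact OG_zero _ _
  rw [OG_iff _ (hco0 j hj0), hco i hi, hco j hj0]
  have h1 := hle j hj0
  rcases lt_or_gt_of_ne hj with hlt' | hgt
  · have h2 := hlt j hlt' hj0
    set D := od v (Ψ.coeff j) - od v (Ψ.coeff i) with hD
    have hij : (1 : ℤ) ≤ i - j := by omega
    have hji : (i : ℤ) - j ≤ i := by omega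
    -- b * (q D - (i-j) τ) ≥ q - (i-j) δ ≥ b
    have h3 : (b : ℤ) * (q * D - (i - j) * τ) ≥ q - (i - j) * δ := by
      have : (q : ℤ) * ((i - j) * A + 1) ≤ q * (b * D) := by gcongr; omega
      nlinarith
    have h4 : ((i : ℤ) - j) * δ ≤ i * (2 * b) := by
      apply mul_le_mul hji hδ1 hδ0.le; omega
    have h5 : (q : ℤ) = 2 * (2 * b * i + b) + 1 := by rw [hq]; push_cast; ring
    have h6 : (b : ℤ) * (q * D - (i - j) * τ) > 0 := by
      have : (0:ℤ) ≤ i * b := by positivity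
      nlinarith
    have h7 := pos_of_mul_pos_right h6 hB.le
    rw [hD] at h7
    nlinarith
  · set D := od v (Ψ.coeff j) - od v (Ψ.coeff i) with hD
    have hij : (1 : ℤ) ≤ j - i := by omega
    have h6 : (b : ℤ) * (q * D - (i - j) * τ) > 0 := by
      have : (q : ℤ) * ((i - j) * A) ≤ q * (b * D) := by gcongr
      nlinarith [mul_le_mul hij hδ0.le (le_refl 0) (by omega)]
    have h7 := pos_of_mul_pos_right h6 hB.le
    rw [hD] at h7
    nlinarith

theorem vgoal (h : Good F v) (Ψ : F[X]) (i : ℕ) (hi : Ψ.coeff i ≠ 0) (A B : ℤ) (hB : 0 < B)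
    (hle : ∀ j, Ψ.coeff j ≠ 0 → ((i : ℤ) - j) * A ≤ B * (od v (Ψ.coeff j) - od v (Ψ.coeff i)))
    (hlt : ∀ j, j < i → Ψ.coeff j ≠ 0 → ((i : ℤ) - j) * A < B * (od v (Ψ.coeff j) - od v (Ψ.coeff i)))
    (ho : Odd i ∨ Odd (od v (Ψ.coeff i))) : Goal Ψ := by
  obtain ⟨M, _, _, ι, w, c, q, τ, hg, hc0, hq, hτ, hV, hod⟩ := slopeR h Ψ i hi A B hB hle hlt (od v (Ψ.coeff i) + 1)
  apply Goal.map (i := ι)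
  apply Goal.comp' (c := c)
  refine ⟨M, _, _, RingHom.id M, w, 1, 0, hg, ?_, Or.inl rfl⟩
  rw [eval₂_id, zero_pow two_ne_zero, sub_zero, hV.eval, hod]
  have hq' : Odd (q : ℤ) := by exact_mod_cast hq
  rcases Nat.even_or_odd i with hi | hi
  · have hi' : Even (i : ℤ) := by exact_mod_cast hi
    rcases ho with ho | ho
    · exact absurd ho (Nat.not_odd_iff_even.2 hi)
    · exact (hq'.mul ho).add_even (hi'.mul_right τ)
  · have hi' : Odd (i : ℤ) := by exact_mod_cast hi
    rcases Int.even_or_odd (od v (Ψ.coeff i)) with he | he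
    · refine (he.mul_left _).add_odd (hi'.mul ?_)
      have := hτ.add_odd (he.add_odd odd_one)
      rwa [sub_add_cancel] at this
    · refine (hq'.mul he).add_even (Even.mul_left ?_ _)
      have := hτ.add (he.add_odd odd_one)
      rwa [sub_add_cancel] at this

theorem Vx.goal (h : Good F v) {Ψ : F[X]} {i : ℕ} (hV : Vx v Ψ i) (ho : Odd i ∨ Odd (od v (Ψ.coeff i))) : Goal Ψ := by
  have key : ∀ j, j ≠ i → Ψ.coeff j ≠ 0 → 0 < od v (Ψ.coeff j) - od v (Ψ.coeff i) := by
    intro j hj hj0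
    have := (OG_iff v hj0).1 (hV.2 j hj)
    omega
  refine vgoal h Ψ i hV.1 0 1 one_pos ?_ ?_ ho
  · intro j hj0
    by_cases hj : j = i
    · subst hj; simp
    · have := key j hj hj0; omega
  · intro j hj hj0
    have := key j (by omega) hj0; omega
end G
end

section
open Polynomial
set_option linter.all false
open IsDedekindDomain NumberField

section G
variable {F : Type} [Field F] [NumberField F] {v : Pl F}

theorem mk_zero_iff (v : Pl F) (x : 𝓞 F) : Ideal.Quotient.mk v.asIdeal x = 0 ↔ OG v 1 (x : F) := by
  rw [Ideal.Quotient.eq_zero_iff_mem, OG_one_iff_mem]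

theorem mk_ne (v : Pl F) {x : 𝓞 F} (h : Ideal.Quotient.mk v.asIdeal x ≠ 0) : (x : F) ≠ 0 ∧ od v (x : F) = 0 := by
  apply od_eq_zero_of_notMem
  rwa [Ne, Ideal.Quotient.eq_zero_iff_mem] at h

/-- value at an element of order `-1` -/
theorem L1 {M : Type} [Field M] [NumberField M] {ι : F →+* M} {w : Pl M} {q : ℕ}
    (hod : ∀ x : F, od w (ι x) = q * od v x) {p : M} (hp0 : p ≠ 0) (hp : od w p = 1)
    (Θ : (𝓞 F)[X]) (h0 : Θ.map (Ideal.Quotient.mk v.asIdeal) ≠ 0) (hq : Θ.natDegree < q) :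
    od w ((Θ.map (algebraMap (𝓞 F) F)).eval₂ ι p⁻¹) = - ((Θ.map (Ideal.Quotient.mk v.asIdeal)).natDegree : ℤ) ∧
     (Θ.map (algebraMap (𝓞 F) F)).eval₂ ι p⁻¹ ≠ 0 := by
  set n := (Θ.map (Ideal.Quotient.mk v.asIdeal)).natDegree with hn
  have hΘn := mk_ne v (x := Θ.coeff n) (by
    rw [← coeff_map]
    exact leadingCoeff_ne_zero.2 h0)
  have hp' : p⁻¹ ≠ 0 := inv_ne_zero hp0
  have hnm : n ∈ Finset.range (Θ.natDegree + 1) := by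
    rw [Finset.mem_range]
    have : n ≤ Θ.natDegree := natDegree_map_le
    omega
  have e : (Θ.map (algebraMap (𝓞 F) F)).eval₂ ι p⁻¹ = ∑ j ∈ Finset.range (Θ.natDegree + 1), ι (Θ.coeff j : F) * p⁻¹ ^ j := by
    rw [eval₂_map, eval₂_eq_sum_range]; rfl
  rw [e, ← Finset.add_sum_erase _ _ hnm]
  have h1 : od w (ι (Θ.coeff n : F) * p⁻¹ ^ n) = - (n : ℤ) := by
    rw [od_mul _ (by simpa using hΘn.1) (pow_ne_zero _ hp'), hod, hΘn.2, od_pow, od_inv, hp]; ring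
  have h2 : ι (Θ.coeff n : F) * p⁻¹ ^ n ≠ 0 := mul_ne_zero (by simpa using hΘn.1) (pow_ne_zero _ hp')
  have h3 := od_add_eq w h2 (y := ∑ j ∈ (Finset.range (Θ.natDegree + 1)).erase n, ι (Θ.coeff j : F) * p⁻¹ ^ j) (by
    rw [h1]
    apply OG.sum
    intro j hj
    have hj1 := Finset.ne_of_mem_erase hj
    have hj2 := Finset.mem_range.1 (Finset.mem_of_mem_erase hj)
    by_cases h0 : (Θ.coeff j : F) = 0
    · rw [h0, map_zero, zero_mul]; exact OG_zero _ _
    rw [OG_iff _ (mul_ne_zero (by simpa using h0) (pow_ne_zero _ hp')), od_mul _ (by simpa using h0) (pow_ne_zero _ hp'),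
      hod, od_pow, od_inv, hp]
    rcases lt_or_gt_of_ne hj1 with hlt | hgt
    · have := mul_nonneg (Int.natCast_nonneg q) (od_int_nonneg v (Θ.coeff j))
      omega
    · have h4 : OG v 1 (Θ.coeff j : F) := by
        rw [← mk_zero_iff, ← coeff_map]
        exact coeff_eq_zero_of_natDegree_lt hgt
      have h5 := (OG_iff v h0).1 h4
      have h6 : (q : ℤ) * 1 ≤ q * od v (Θ.coeff j : F) := by gcongr
      omega)
  exact ⟨h3.2.trans h1, h3.1⟩

theorem charTwo_quot (h : Good F v) : CharP (𝓞 F ⧸ v.asIdeal) 2 := by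
  have h2 : (2 : 𝓞 F ⧸ v.asIdeal) = 0 := by
    have : Ideal.Quotient.mk v.asIdeal (2 : 𝓞 F) = 0 := by
      rw [mk_zero_iff]
      have e : ((2 : 𝓞 F) : F) = 2 := map_ofNat _ 2
      rw [e, OG_iff _ (two_ne F)]
      exact h.two_pos
    rwa [map_ofNat] at this
  exact CharTwo.of_one_ne_zero_of_two_eq_zero one_ne_zero h2

theorem finite_quot (v : Pl F) : Finite (𝓞 F ⧸ v.asIdeal) := by
  exact Ring.HasFiniteQuotients.finiteQuotient v.ne_bot

/-- square root of the even part -/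
theorem exists_half {k : Type} [Field k] [Finite k] [CharP k 2] (φ : k[X]) :
    ∃ g : k[X], (∀ j, (g ^ 2).coeff j = if Even j then φ.coeff j else 0) ∧ ∀ l, g.coeff l = 0 ↔ φ.coeff (2 * l) = 0 := by
  haveI : Fact (Nat.Prime 2) := ⟨Nat.prime_two⟩
  haveI : PerfectRing k 2 := inferInstance
  refine ⟨(contract 2 φ).map (frobeniusEquiv k 2).symm, ?_, ?_⟩
  · intro j
    rw [← map_frobenius_expand, coeff_map, coeff_expand two_pos, frobenius_def]
    by_cases hj : Even j
    · rw [if_pos hj, if_pos hj.two_dvd, coeff_map, coeff_contract two_ne_zero, Nat.div_mul_cancel hj.two_dvd]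
      exact frobeniusEquiv_symm_pow_p k 2 _
    · rw [if_neg hj, if_neg (fun h => hj ((even_iff_two_dvd).2 h)), zero_pow two_ne_zero]
  · intro l
    rw [coeff_map, coeff_contract two_ne_zero, mul_comm l 2]
    exact map_eq_zero_iff _ (frobeniusEquiv k 2).symm.injective

theorem lift_poly (v : Pl F) (g : (𝓞 F ⧸ v.asIdeal)[X]) : ∃ G : (𝓞 F)[X], G.map (Ideal.Quotient.mk v.asIdeal) = g :=
  map_surjective _ Ideal.Quotient.mk_surjective g

theorem lemB0 (h : Good F v) (β : F) (hβ : β ≠ 0) (Φ : (𝓞 F)[X])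
    (hn : Even (Φ.map (Ideal.Quotient.mk v.asIdeal)).natDegree)
    (j : ℕ) (hj : Odd j) (hΦj : (Φ.map (Ideal.Quotient.mk v.asIdeal)).coeff j ≠ 0) :
    Goal (C (β ^ 2) * Φ.map (algebraMap (𝓞 F) F)) := by
  letI : Field (𝓞 F ⧸ v.asIdeal) := Ideal.Quotient.field _
  haveI := finite_quot v
  haveI := charTwo_quot h
  set φ := Φ.map (Ideal.Quotient.mk v.asIdeal) with hφ
  obtain ⟨g, hg1, hg2⟩ := exists_half φ
  obtain ⟨G, hG⟩ := lift_poly v g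
  set Θ := Φ - G ^ 2 with hΘ
  have hθ : Θ.map (Ideal.Quotient.mk v.asIdeal) = φ - g ^ 2 := by
    rw [hΘ, Polynomial.map_sub, Polynomial.map_pow, hG]
  have hθc : ∀ j, (φ - g ^ 2).coeff j = if Even j then 0 else φ.coeff j := by
    intro j
    rw [coeff_sub, hg1]
    split_ifs <;> simp
  have hθ0 : φ - g ^ 2 ≠ 0 := by
    intro h0
    have := hθc j
    rw [h0, if_neg (Nat.not_even_iff_odd.2 hj), coeff_zero] at this
    exact hΦj this.symm
  have hodd : Odd (φ - g ^ 2).natDegree := by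
    rw [← Nat.not_even_iff_odd]
    intro he
    have := hθc (φ - g ^ 2).natDegree
    rw [if_pos he] at this
    exact hθ0 (leadingCoeff_eq_zero.1 this)
  have hφ0 : φ ≠ 0 := by rintro h0; rw [h0] at hΦj; simp at hΦj
  obtain ⟨n, hn'⟩ := hn
  have hgn : g.natDegree = n := by
    apply le_antisymm
    · rw [natDegree_le_iff_coeff_eq_zero]
      intro l hl
      rw [hg2]
      apply coeff_eq_zero_of_natDegree_lt; omega
    · apply le_natDegree_of_ne_zero
      rw [Ne, hg2, two_mul, ← hn']
      exact leadingCoeff_ne_zero.2 hφ0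
  have hg0 : g ≠ 0 := by
    rintro rfl
    have := (hg2 n).1 (by simp)
    rw [two_mul, ← hn'] at this
    exact hφ0 (leadingCoeff_eq_zero.1 this)
  obtain ⟨M, _, _, ι, w, hgd, hod⟩ := lemR h (2 * (Θ.natDegree + G.natDegree + n) + 1) ⟨_, rfl⟩
  obtain ⟨p, hp0, hp1⟩ := exists_unif' w
  have hD := L1 hod hp0 hp1 Θ (by rw [hθ]; exact hθ0) (by omega)
  have hGs := L1 hod hp0 hp1 G (by rw [hG]; exact hg0) (by omega)
  rw [hθ] at hD
  rw [hG, hgn] at hGs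
  have hβ' : ι β ≠ 0 := by simpa using hβ
  have e : (C (β ^ 2) * Φ.map (algebraMap (𝓞 F) F)).eval₂ ι p⁻¹ - (ι β * (G.map (algebraMap (𝓞 F) F)).eval₂ ι p⁻¹) ^ 2
     = ι β ^ 2 * (Θ.map (algebraMap (𝓞 F) F)).eval₂ ι p⁻¹ := by
    rw [hΘ, Polynomial.map_sub, eval₂_sub, Polynomial.map_pow, eval₂_pow, eval₂_mul, eval₂_C, map_pow]
    ring
  refine ⟨M, _, _, ι, w, p⁻¹, ι β * (G.map (algebraMap (𝓞 F) F)).eval₂ ι p⁻¹, hgd, ?_, Or.inr ?_⟩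
  · rw [e, od_mul _ (pow_ne_zero _ hβ') hD.2, hD.1, od_pow]
    have : Odd (((φ - g ^ 2).natDegree : ℕ) : ℤ) := by exact_mod_cast hodd
    refine Even.add_odd (Even.mul_right (by norm_num) _) this.neg
  · rw [e, od_mul _ (pow_ne_zero _ hβ') hD.2, hD.1, od_pow, od_mul _ hβ' hGs.2, hGs.1]
    have h2 : od w (2:M) = (2 * (Θ.natDegree + G.natDegree + n) + 1 : ℕ) * od v (2:F) := by
      rw [← hod, map_ofNat]
    have h3 := h.two_pos
    have h4 : ((2 * (Θ.natDegree + G.natDegree + n) + 1 : ℕ) : ℤ) * 1 ≤ od w (2:M) := by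
      rw [h2]; gcongr; omega
    push_cast at h4 ⊢
    omega

/-- an even-order element is `β² u` with `u` an integral unit -/
theorem even_split {γ : F} (h0 : γ ≠ 0) (he : Even (od v γ)) : ∃ (β : F) (u : 𝓞 F), β ≠ 0 ∧
    Ideal.Quotient.mk v.asIdeal u ≠ 0 ∧ γ = β ^ 2 * u := by
  obtain ⟨j, hj⟩ := he
  obtain ⟨p, hp0, hp1⟩ := exists_unif' v
  have h1 : od v (γ / (p ^ j) ^ 2) = 0 := by
    rw [od_div _ h0 (pow_ne_zero _ (zpow_ne_zero _ hp0)), od_pow, od_zpow, hp1, hj]; push_cast; ring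
  have h1' : γ / (p ^ j) ^ 2 ≠ 0 := div_ne_zero h0 (pow_ne_zero _ (zpow_ne_zero _ hp0))
  obtain ⟨a, d, hd, had⟩ := exists_num_den v ((OG_iff v h1').2 h1.ge)
  have hd1 := od_eq_zero_of_notMem v hd
  have hpj : p ^ j ≠ 0 := zpow_ne_zero _ hp0
  refine ⟨p ^ j / d, a * d, div_ne_zero hpj hd1.1, ?_, ?_⟩
  · rw [map_mul, mul_ne_zero_iff]
    constructor
    · rw [Ne, mk_zero_iff]
      have ha : (a : F) ≠ 0 := by rw [← had]; exact mul_ne_zero h1' hd1.1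
      rw [OG_iff _ ha, ← had, od_mul _ h1' hd1.1, h1, hd1.2]; norm_num
    · rwa [Ne, Ideal.Quotient.eq_zero_iff_mem]
  · have e : ((a * d : 𝓞 F) : F) = a * d := rfl
    rw [e, ← had]
    have := hd1.1
    field_simp

theorem lemB (h : Good F v) (γ : F) (hγ : γ ≠ 0) (hγe : Even (od v γ)) (Φ : (𝓞 F)[X])
    (hn : Even (Φ.map (Ideal.Quotient.mk v.asIdeal)).natDegree)
    (j : ℕ) (hj : Odd j) (hΦj : (Φ.map (Ideal.Quotient.mk v.asIdeal)).coeff j ≠ 0) :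
    Goal (C γ * Φ.map (algebraMap (𝓞 F) F)) := by
  obtain ⟨β, u, hβ, hu, rfl⟩ := even_split hγ hγe
  have e1 : (C u * Φ).map (Ideal.Quotient.mk v.asIdeal) = C (Ideal.Quotient.mk v.asIdeal u) * Φ.map (Ideal.Quotient.mk v.asIdeal) := by
    rw [Polynomial.map_mul, map_C]
  have := lemB0 h β hβ (C u * Φ) (by rwa [e1, natDegree_C_mul hu]) j hj (by
    rw [e1, coeff_C_mul]; exact mul_ne_zero hu hΦj)
  rw [Polynomial.map_mul, map_C, ← mul_assoc, ← C_mul] at this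
  exact this

theorem common_den (v : Pl F) (P : F[X]) (hP : ∀ j, OG v 0 (P.coeff j)) :
    ∃ (d : 𝓞 F) (Φ : (𝓞 F)[X]), d ∉ v.asIdeal ∧ C (d : F) * P = Φ.map (algebraMap (𝓞 F) F) := by
  choose a d hd had using fun j => exists_num_den v (hP j)
  refine ⟨∏ j ∈ Finset.range (P.natDegree + 1), d j,
    ∑ j ∈ Finset.range (P.natDegree + 1), monomial j (a j * ∏ i ∈ (Finset.range (P.natDegree + 1)).erase j, d i), ?_, ?_⟩
  · rw [Ideal.IsPrime.prod_mem_iff]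
    push Not
    intro j _; exact hd j
  · have hs := P.as_sum_range
    generalize hN : P.natDegree + 1 = N at hs ⊢
    conv_lhs => rw [hs]
    rw [Finset.mul_sum, Polynomial.map_sum]
    refine Finset.sum_congr rfl fun j hj => ?_
    rw [map_monomial, C_mul_monomial, ← Finset.mul_prod_erase _ _ hj]
    congr 1
    change algebraMap (𝓞 F) F _ * _ = _
    rw [map_mul, map_mul]
    have : P.coeff j * algebraMap (𝓞 F) F (d j) = algebraMap (𝓞 F) F (a j) := had j
    rw [← this]; ring

/-- reduction of a polynomial with dominating coefficient `n` -/
theorem reduce (v : Pl F) (Ψ : F[X]) (n : ℕ) (hn : Ψ.coeff n ≠ 0)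
    (h1 : ∀ j, OG v (od v (Ψ.coeff n)) (Ψ.coeff j)) :
    ∃ (γ : F) (Φ : (𝓞 F)[X]), γ ≠ 0 ∧ od v γ = od v (Ψ.coeff n) ∧ Ψ = C γ * Φ.map (algebraMap (𝓞 F) F) ∧
      ∀ j, (Φ.map (Ideal.Quotient.mk v.asIdeal)).coeff j = 0 ↔ OG v (od v (Ψ.coeff n) + 1) (Ψ.coeff j) := by
  obtain ⟨d, Φ, hd, hΦ⟩ := common_den v (C (Ψ.coeff n)⁻¹ * Ψ) (by
    intro j
    rw [coeff_C_mul]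
    have := (od_OG v (Ψ.coeff n)⁻¹).mul (h1 j)
    rwa [od_inv, neg_add_cancel] at this)
  have hd1 := od_eq_zero_of_notMem v hd
  have hγ0 : Ψ.coeff n / d ≠ 0 := div_ne_zero hn hd1.1
  have e : Ψ = C (Ψ.coeff n / d) * Φ.map (algebraMap (𝓞 F) F) := by
    rw [← hΦ, ← mul_assoc, ← mul_assoc, ← C_mul, ← C_mul]
    have : Ψ.coeff n / (d : F) * d * (Ψ.coeff n)⁻¹ = 1 := by
      have := hd1.1; field_simp
    rw [this, C_1, one_mul]
  have hod : od v (Ψ.coeff n / d) = od v (Ψ.coeff n) := by rw [od_div _ hn hd1.1, hd1.2, sub_zero]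
  refine ⟨Ψ.coeff n / d, Φ, hγ0, hod, e, ?_⟩
  intro j
  have e2 : Ψ.coeff j = Ψ.coeff n / d * (Φ.coeff j : F) := by
    conv_lhs => rw [e]
    rw [coeff_C_mul, coeff_map]
  have e3 : (Φ.coeff j : F) = (Ψ.coeff n / d)⁻¹ * Ψ.coeff j := by
    rw [e2, inv_mul_cancel_left₀ hγ0]
  rw [coeff_map, mk_zero_iff]
  constructor
  · intro h
    have := (od_OG v (Ψ.coeff n / d)).mul h
    rwa [hod, ← e2] at this
  · intro h
    have := (od_OG v (Ψ.coeff n / d)⁻¹).mul h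
    rw [od_inv, hod, ← e3] at this
    exact this.mono (by omega)
end G

theorem odd_mult {k : Type} [Field k] : ∀ (m : ℕ) (g : k[X]), g.natDegree = m → Odd m →
    ∃ (p h : k[X]) (μ : ℕ), Irreducible p ∧ Odd p.natDegree ∧ Odd μ ∧ g = p ^ μ * h ∧ ¬ p ∣ h := by
  intro m
  induction m using Nat.strong_induction_on with
  | _ m ih =>
    intro g hg hm
    have hg0 : g ≠ 0 := by rintro rfl; rw [natDegree_zero] at hg; subst hg; exact absurd hm (by decide)
    obtain ⟨p, hp, hpd, hpo⟩ := pr_odd_factor m g hg hm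
    obtain ⟨μ, h, hph, hgh⟩ := WfDvdMonoid.max_power_factor hg0 hp
    have hh0 : h ≠ 0 := by rintro rfl; simp at hph
    by_cases hμ : Odd μ
    · exact ⟨p, h, μ, hp, hpo, hμ, hgh, hph⟩
    have hμ' := Nat.not_odd_iff_even.1 hμ
    have hdeg : g.natDegree = μ * p.natDegree + h.natDegree := by
      rw [hgh, natDegree_mul (pow_ne_zero _ hp.ne_zero) hh0, natDegree_pow]
    have hμ0 : μ ≠ 0 := by
      rintro rfl
      rw [pow_zero, one_mul] at hgh
      exact hph (hgh ▸ hpd)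
    have hlt : h.natDegree < m := by
      have := Nat.mul_pos (Nat.pos_of_ne_zero hμ0) hpo.pos
      omega
    have hho : Odd h.natDegree := by
      rw [hg] at hdeg
      rw [hdeg] at hm
      exact (Nat.odd_add'.1 hm).2 (hμ'.mul_right _)
    obtain ⟨p', h', μ', hp', hpo', hμo', hgh', hph'⟩ := ih _ hlt h rfl hho
    refine ⟨p', p ^ μ * h', μ', hp', hpo', hμo', by rw [hgh, hgh']; ring, ?_⟩
    intro hd
    rcases hp'.prime.dvd_or_dvd hd with h1 | h1
    · have h2 := hp'.prime.dvd_of_dvd_pow h1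
      have h3 := hp'.dvd_symm hp h2
      apply hph
      rw [hgh']
      exact (h3.trans (dvd_pow_self p' hμo'.pos.ne')).mul_right _
    · exact hph' h1
end

section
open Polynomial
set_option linter.all false
open IsDedekindDomain NumberField

def HH (n : ℕ) : Prop := ∀ (F : Type) [Field F] [NumberField F] (v : Pl F), Good F v → ∀ Ψ : F[X], Ψ.Separable →
  Vx v Ψ n → Goal Ψ

theorem sep_comp {k : Type} [Field k] {Ψ : k[X]} (h : Ψ.Separable) (s : k) {c : k} (hc : c ≠ 0) :
    (Ψ.comp (C s + C c * X)).Separable := by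
  obtain ⟨a, b, hab⟩ := h
  refine ⟨a.comp (C s + C c * X), C c⁻¹ * b.comp (C s + C c * X), ?_⟩
  have := congrArg (fun P : k[X] => P.comp (C s + C c * X)) hab
  simp only [add_comp, mul_comp, one_comp] at this
  rw [derivative_comp]
  simp only [derivative_add, derivative_C, derivative_mul, derivative_X, zero_mul, zero_add, mul_one]
  rw [← this]
  have e : (C c⁻¹ * C c : k[X]) = 1 := by rw [← C_mul, inv_mul_cancel₀ hc, C_1]
  linear_combination (b.comp (C s + C c * X) * (derivative Ψ).comp (C s + C c * X)) * e

theorem sep_comp' {k : Type} [Field k] {Ψ : k[X]} (h : Ψ.Separable) {c : k} (hc : c ≠ 0) :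
    (Ψ.comp (C c * X)).Separable := by
  have := sep_comp h 0 hc
  rwa [C_0, zero_add] at this

theorem sep_comp1 {k : Type} [Field k] {Ψ : k[X]} (h : Ψ.Separable) (s : k) :
    (Ψ.comp (C s + X)).Separable := by
  have := sep_comp h s one_ne_zero
  rwa [C_1, one_mul] at this

section G
variable {F : Type} [Field F] [NumberField F] {v : Pl F}

theorem Goal.comp1 {Ψ : F[X]} {s : F} (h : Goal (Ψ.comp (C s + X))) : Goal Ψ := by
  apply Goal.comp (s := s) (c := 1)
  rwa [C_1, one_mul]

theorem slope_HH (h : Good F v) (Ψ : F[X]) (hsep : Ψ.Separable) (i : ℕ) (hH : HH i) (hi : Ψ.coeff i ≠ 0) (A B : ℤ) (hB : 0 < B)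
    (hle : ∀ j, Ψ.coeff j ≠ 0 → ((i : ℤ) - j) * A ≤ B * (od v (Ψ.coeff j) - od v (Ψ.coeff i)))
    (hlt : ∀ j, j < i → Ψ.coeff j ≠ 0 → ((i : ℤ) - j) * A < B * (od v (Ψ.coeff j) - od v (Ψ.coeff i))) : Goal Ψ := by
  obtain ⟨M, _, _, ι, w, c, q, τ, hg, hc0, hq, hτ, hV, hod⟩ := slopeR h Ψ i hi A B hB hle hlt 0
  apply Goal.map (i := ι)
  apply Goal.comp' (c := c)
  exact hH M w hg _ (sep_comp' (hsep.map) hc0) hV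

theorem semi_goal (h : Good F v) (Ψ : F[X]) (hsep : Ψ.Separable) (i : ℕ) (hH : HH i) (hi : Ψ.coeff i ≠ 0)
    (hle : ∀ j, OG v (od v (Ψ.coeff i)) (Ψ.coeff j)) (hlt : ∀ j, j < i → OG v (od v (Ψ.coeff i) + 1) (Ψ.coeff j)) : Goal Ψ := by
  refine slope_HH h Ψ hsep i hH hi 0 1 one_pos ?_ ?_
  · intro j hj
    have := (OG_iff v hj).1 (hle j)
    omega
  · intro j hj hj0
    have := (OG_iff v hj0).1 (hlt j hj)
    omega

theorem shift (v : Pl F) (γ : F) (hγ : γ ≠ 0) (Φ : (𝓞 F)[X]) (s : 𝓞 F) (n : ℕ) (R : (𝓞 F ⧸ v.asIdeal)[X])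
    (hΦ : Φ.map (Ideal.Quotient.mk v.asIdeal) = (X - C (Ideal.Quotient.mk v.asIdeal s)) ^ n * R)
    (hR : R.eval (Ideal.Quotient.mk v.asIdeal s) ≠ 0) (Ψ : F[X]) (hΨ : Ψ = C γ * Φ.map (algebraMap (𝓞 F) F)) :
    (Ψ.comp (C (s : F) + X)).coeff n ≠ 0 ∧ od v ((Ψ.comp (C (s : F) + X)).coeff n) = od v γ ∧
    (∀ j, OG v (od v γ) ((Ψ.comp (C (s : F) + X)).coeff j)) ∧ (∀ j, j < n → OG v (od v γ + 1) ((Ψ.comp (C (s : F) + X)).coeff j)) ∧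
    (R.natDegree = 0 → ∀ j, j ≠ n → OG v (od v γ + 1) ((Ψ.comp (C (s : F) + X)).coeff j)) := by
  set Φ₁ := Φ.comp (C s + X) with hΦ₁
  have e : Ψ.comp (C (s : F) + X) = C γ * Φ₁.map (algebraMap (𝓞 F) F) := by
    rw [hΨ, mul_comp, C_comp, hΦ₁, Polynomial.map_comp, Polynomial.map_add, map_C, map_X]
  have ec : ∀ j, (Ψ.comp (C (s : F) + X)).coeff j = γ * (Φ₁.coeff j : F) := by
    intro j; rw [e, coeff_C_mul, coeff_map]
  set R₁ := R.comp (C (Ideal.Quotient.mk v.asIdeal s) + X) with hR₁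
  have em : Φ₁.map (Ideal.Quotient.mk v.asIdeal) = X ^ n * R₁ := by
    rw [hΦ₁, Polynomial.map_comp, hΦ, mul_comp, pow_comp, sub_comp, X_comp, C_comp, Polynomial.map_add, map_C, map_X, add_sub_cancel_left]
  have emc : ∀ j, Ideal.Quotient.mk v.asIdeal (Φ₁.coeff j) = (X ^ n * R₁).coeff j := by
    intro j; rw [← em, coeff_map]
  have hn : Ideal.Quotient.mk v.asIdeal (Φ₁.coeff n) ≠ 0 := by
    rw [emc, coeff_X_pow_mul', if_pos le_rfl, Nat.sub_self, coeff_zero_eq_eval_zero, hR₁, eval_comp, eval_add, eval_C, eval_X, add_zero]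
    exact hR
  have hz : ∀ j, (X ^ n * R₁).coeff j = 0 → OG v (od v γ + 1) ((Ψ.comp (C (s : F) + X)).coeff j) := by
    intro j hj
    rw [← emc, mk_zero_iff] at hj
    rw [ec]
    exact (od_OG v γ).mul hj
  have hn' := mk_ne v hn
  refine ⟨?_, ?_, ?_, ?_, ?_⟩
  · rw [ec]; exact mul_ne_zero hγ hn'.1
  · rw [ec, od_mul _ hγ hn'.1, hn'.2, add_zero]
  · intro j
    rw [ec]
    have := (od_OG v γ).mul (OG_int v (Φ₁.coeff j))
    rwa [add_zero] at this
  · intro j hj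
    apply hz
    rw [coeff_X_pow_mul', if_neg (by omega)]
  · intro h0 j hj
    apply hz
    rw [coeff_X_pow_mul']
    split_ifs with hnj
    · apply coeff_eq_zero_of_natDegree_lt
      have : R₁.natDegree ≤ R.natDegree * (C (Ideal.Quotient.mk v.asIdeal s) + X).natDegree := natDegree_comp_le
      rw [h0, zero_mul] at this
      omega
    · rfl

theorem exists_simple {k l : Type} [Field k] [Finite k] [Field l] (j : k →+* l) (p h : k[X]) (hp : Irreducible p) (hph : ¬ p ∣ h)
    (s : l) (hs : p.eval₂ j s = 0) (μ : ℕ) :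
    ∃ R : l[X], (p ^ μ * h).map j = (X - C s) ^ μ * R ∧ R.eval s ≠ 0 := by
  have hsep : p.Separable := PerfectField.separable_of_irreducible hp
  have h1 : (p.map j).Separable := hsep.map
  have hroot : (p.map j).eval s = 0 := by rwa [eval_map]
  obtain ⟨r, hr⟩ := dvd_iff_isRoot.2 hroot
  have hr0 : r.eval s ≠ 0 := by
    intro h0
    have h2 := h1.eval₂_derivative_ne_zero (RingHom.id l) (x := s) (by rwa [eval₂_id])
    rw [eval₂_id, hr] at h2
    simp [h0] at h2
  have hh0 : (h.map j).eval s ≠ 0 := by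
    intro h0
    obtain ⟨a, b, hab⟩ := (hp.coprime_iff_not_dvd).2 hph
    have := congrArg (fun P : k[X] => (P.map j).eval s) hab
    simp [hroot, h0] at this
  refine ⟨r ^ μ * h.map j, ?_, ?_⟩
  · rw [Polynomial.map_mul, Polynomial.map_pow, hr, mul_pow]; ring
  · rw [eval_mul, eval_pow]
    exact mul_ne_zero (pow_ne_zero _ hr0) hh0

theorem stepL (h : Good F v) (n : ℕ) (hn4 : n % 4 = 2) (hIH : ∀ n', n' < n → n' % 4 = 2 → HH n')
    (Ψ : F[X]) (hsep : Ψ.Separable) (hn : Ψ.coeff n ≠ 0) (hle : ∀ j, OG v (od v (Ψ.coeff n)) (Ψ.coeff j))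
    (hgt : ∀ j, n < j → OG v (od v (Ψ.coeff n) + 1) (Ψ.coeff j)) (he : Even (od v (Ψ.coeff n)))
    (hex : ∃ j, j < n ∧ ¬ OG v (od v (Ψ.coeff n) + 1) (Ψ.coeff j)) :
    Goal Ψ ∨ (¬ OG v (od v (Ψ.coeff n) + 1) (Ψ.coeff (n - 2)) ∧
      ∃ s : 𝓞 F, Vx v (Ψ.comp (C (s : F) + X)) n ∧ od v ((Ψ.comp (C (s : F) + X)).coeff n) = od v (Ψ.coeff n)) := by
  letI : Field (𝓞 F ⧸ v.asIdeal) := Ideal.Quotient.field _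
  haveI := finite_quot v
  haveI := charTwo_quot h
  obtain ⟨γ, Φ, hγ0, hγ, hΨ, hΦ⟩ := reduce v Ψ n hn hle
  set φ := Φ.map (Ideal.Quotient.mk v.asIdeal) with hφ
  have hφn : φ.coeff n ≠ 0 := by
    rw [Ne, hΦ, OG_iff _ hn]; omega
  have hφdeg : φ.natDegree = n := by
    apply le_antisymm
    · rw [natDegree_le_iff_coeff_eq_zero]
      intro j hj; rw [hΦ]; exact hgt j hj
    · exact le_natDegree_of_ne_zero hφn
  have hneven : Even n := by rw [Nat.even_iff]; omega
  by_cases hoddc : ∃ j, Odd j ∧ φ.coeff j ≠ 0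
  · left
    obtain ⟨j, hj, hj0⟩ := hoddc
    rw [hΨ]
    exact lemB h γ hγ0 (by rw [hγ]; exact he) Φ (by rw [← hφ, hφdeg]; exact hneven) j hj hj0
  push Not at hoddc
  obtain ⟨g, hg1, hg2⟩ := exists_half φ
  have hg : g ^ 2 = φ := by
    ext j
    rw [hg1]
    split_ifs with hj
    · rfl
    · exact (hoddc j (Nat.not_even_iff_odd.1 hj)).symm
  have hgd : g.natDegree * 2 = n := by
    rw [← hφdeg, ← hg, natDegree_pow, mul_comm]
  obtain ⟨p, r, μ, hp, hpo, hμ, hgr, hpr⟩ := odd_mult g.natDegree g rfl (by rw [Nat.odd_iff]; omega)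
  have hr0 : r ≠ 0 := by rintro rfl; simp at hpr
  have hdeg : g.natDegree = μ * p.natDegree + r.natDegree := by
    rw [hgr, natDegree_mul (pow_ne_zero _ hp.ne_zero) hr0, natDegree_pow]
  have hφf : φ = p ^ (2 * μ) * r ^ 2 := by rw [← hg, hgr]; ring
  have hpr2 : ¬ p ∣ r ^ 2 := fun hd => hpr (hp.prime.dvd_of_dvd_pow hd)
  have hμle : μ ≤ μ * p.natDegree := Nat.le_mul_of_pos_right _ hpo.pos
  by_cases hμn : 2 * μ < n
  · left
    obtain ⟨M, _, _, i, w, j, i', s, hgM, hod, hii, hjj, hroot⟩ := lemU h p hp hpo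
    letI : Field (𝓞 M ⧸ w.asIdeal) := Ideal.Quotient.field _
    obtain ⟨R, hR1, hR2⟩ := exists_simple j p (r ^ 2) hp hpr2 (Ideal.Quotient.mk w.asIdeal s) hroot (2 * μ)
    apply Goal.map (i := i')
    apply Goal.comp1 (s := (s : M))
    have ejj : j.comp (Ideal.Quotient.mk v.asIdeal) = (Ideal.Quotient.mk w.asIdeal).comp i := RingHom.ext hjj
    have eii : i'.comp (algebraMap (𝓞 F) F) = (algebraMap (𝓞 M) M).comp i := RingHom.ext hii
    obtain ⟨h1, h2, h3, h4, -⟩ := shift w (i' γ) (by simpa using hγ0) (Φ.map i) s (2 * μ) R (by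
      rw [Polynomial.map_map, ← ejj, ← Polynomial.map_map, ← hφ, hφf, hR1]) hR2 (Ψ.map i') (by
      rw [hΨ, Polynomial.map_mul, map_C, Polynomial.map_map, Polynomial.map_map, eii])
    refine semi_goal hgM _ (sep_comp1 hsep.map _) (2 * μ) (hIH _ hμn ?_) h1 ?_ ?_
    · rcases hμ with ⟨a, ha⟩; omega
    · rw [h2]; exact h3
    · rw [h2]; exact h4
  · right
    have hp1 : p.natDegree = 1 := by
      have h1 : μ * p.natDegree ≤ μ * 1 := by omega
      have := Nat.le_of_mul_le_mul_left h1 hμ.pos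
      have := hpo.pos
      omega
    have hr1 : r.natDegree = 0 := by rw [hp1, mul_one] at hdeg; omega
    have hμn' : 2 * μ = n := by rw [hp1, mul_one] at hdeg; omega
    obtain ⟨a, ha, b, hab⟩ := natDegree_eq_one.1 hp1
    obtain ⟨c, hc⟩ := natDegree_eq_zero.1 hr1
    have hc0 : c ≠ 0 := by rintro rfl; rw [C_0] at hc; exact hr0 hc.symm
    obtain ⟨s, hs⟩ := Ideal.Quotient.mk_surjective (-b / a)
    have hφ2 : φ = (X - C (Ideal.Quotient.mk v.asIdeal s)) ^ n * C (a ^ n * c ^ 2) := by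
      have : p = C a * (X - C (Ideal.Quotient.mk v.asIdeal s)) := by
        rw [← hab, hs, mul_sub, ← C_mul, mul_div_cancel₀ _ ha, C_neg]; ring
      rw [hφf, this, hμn', ← hc, mul_pow, C_mul, C_pow, C_pow]; ring
    have hac : a ^ n * c ^ 2 ≠ 0 := mul_ne_zero (pow_ne_zero _ ha) (pow_ne_zero _ hc0)
    have hcoef : ∀ j, φ.coeff j = (-(Ideal.Quotient.mk v.asIdeal s)) ^ (n - j) * (n.choose j : (𝓞 F ⧸ v.asIdeal)) * (a ^ n * c ^ 2) := by
      intro j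
      rw [hφ2, coeff_mul_C, sub_eq_add_neg, ← C_neg, coeff_X_add_C_pow]
    have hs0 : Ideal.Quotient.mk v.asIdeal s ≠ 0 := by
      intro h0
      obtain ⟨j, hj, hj0⟩ := hex
      apply hj0
      rw [← hΦ, hcoef, h0, neg_zero, zero_pow (by omega), zero_mul, zero_mul]
    constructor
    · rw [← hΦ, hcoef]
      have hch : (n.choose (n - 2) : (𝓞 F ⧸ v.asIdeal)) ≠ 0 := by
        rw [Ne, CharP.cast_eq_zero_iff _ 2, Nat.choose_symm (by omega), Nat.choose_two_right]
        obtain ⟨l, hl⟩ : ∃ l, n = 4 * l + 2 := ⟨n / 4, by omega⟩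
        rw [hl, show (4 * l + 2) * (4 * l + 2 - 1) = 2 * ((2 * l + 1) * (4 * l + 1)) by
          rw [show 4 * l + 2 - 1 = 4 * l + 1 by omega]; ring, Nat.mul_div_cancel_left _ two_pos]
        rw [← even_iff_two_dvd, Nat.not_even_iff_odd]
        exact Odd.mul ⟨l, rfl⟩ ⟨2 * l, by ring⟩
      exact mul_ne_zero (mul_ne_zero (pow_ne_zero _ (neg_ne_zero.2 hs0)) hch) hac
    · obtain ⟨h1, h2, h3, h4, h5⟩ := shift v γ hγ0 Φ s n (C (a ^ n * c ^ 2)) hφ2 (by rw [eval_C]; exact hac) Ψ hΨ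
      refine ⟨s, ⟨h1, ?_⟩, h2.trans hγ⟩
      rw [h2]
      exact h5 (natDegree_C _)
end G
end

section
open Polynomial
set_option linter.all false
open IsDedekindDomain NumberField

section G
variable {F : Type} [Field F] [NumberField F] {v : Pl F}

theorem OG_eval_bound (v : Pl F) (u : F[X]) : ∃ C : ℤ, ∀ a, OG v 0 a → OG v (-C) (u.eval a) := by
  induction u using Polynomial.induction_on' with
  | add p q hp hq =>
    obtain ⟨C1, h1⟩ := hp
    obtain ⟨C2, h2⟩ := hq
    refine ⟨max C1 C2, fun a ha => ?_⟩
    rw [eval_add]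
    exact ((h1 a ha).mono (by omega)).add ((h2 a ha).mono (by omega))
  | monomial n c =>
    refine ⟨-od v c, fun a ha => ?_⟩
    rw [eval_monomial]
    have := (od_OG v c).mul (ha.pow n)
    simpa using this

theorem exists_slope (n : ℕ) (S : Finset ℕ) (hS : S.Nonempty) (hn : ∀ j ∈ S, j < n) (a : ℕ → ℤ) :
    ∃ i ∈ S, (∀ j ∈ S, a i * ((n:ℤ) - j) ≤ a j * ((n:ℤ) - i)) ∧ (∀ j ∈ S, j < i → a i * ((n:ℤ) - j) < a j * ((n:ℤ) - i)) := by
  obtain ⟨i, hi, hmin⟩ := S.exists_min_image (fun j => toLex ((a j : ℚ) / ((n:ℚ) - j), j)) hS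
  have hpos : ∀ j ∈ S, (0:ℚ) < (n:ℚ) - j := by
    intro j hj
    have := hn j hj
    have : (j:ℚ) < n := by exact_mod_cast this
    linarith
  refine ⟨i, hi, ?_, ?_⟩
  · intro j hj
    have h1 := hmin j hj
    rw [Prod.Lex.toLex_le_toLex] at h1
    have h2 : (a i : ℚ) / ((n:ℚ) - i) ≤ (a j : ℚ) / ((n:ℚ) - j) := by
      rcases h1 with h1 | h1
      · exact h1.le
      · exact h1.1.le
    rw [div_le_div_iff₀ (hpos i hi) (hpos j hj)] at h2
    exact_mod_cast h2
  · intro j hj hji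
    have h1 := hmin j hj
    rw [Prod.Lex.toLex_le_toLex] at h1
    have h2 : (a i : ℚ) / ((n:ℚ) - i) < (a j : ℚ) / ((n:ℚ) - j) := by
      rcases h1 with h1 | h1
      · exact h1
      · have := h1.2; simp at this; omega
    rw [div_lt_div_iff₀ (hpos i hi) (hpos j hj)] at h2
    exact_mod_cast h2

theorem stepR (h : Good F v) (n : ℕ) (hn4 : n % 4 = 2) (hIH : ∀ n', n' < n → n' % 4 = 2 → HH n')
    (Ψ : F[X]) (hsep : Ψ.Separable) (hV : Vx v Ψ n) (he : Even (od v (Ψ.coeff n))) (i : ℕ) (hin : i < n)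
    (hi : Ψ.coeff i ≠ 0) (ρ : ℤ) (hρ0 : 0 < ρ) (hρ : ρ * ((n:ℤ) - i) = od v (Ψ.coeff i) - od v (Ψ.coeff n))
    (hmin : ∀ j, j < n → Ψ.coeff j ≠ 0 → ρ * ((n:ℤ) - j) ≤ od v (Ψ.coeff j) - od v (Ψ.coeff n))
    (c : F) (hc0 : c ≠ 0) (hc : od v c = ρ) :
    Goal Ψ ∨ (od v (Ψ.coeff (n - 2)) - od v (Ψ.coeff n) = 2 * ρ ∧
      ∃ s : 𝓞 F, Vx v (Ψ.comp (C (c * (s : F)) + C c * X)) n ∧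
        od v ((Ψ.comp (C (c * (s : F)) + C c * X)).coeff n) = od v (Ψ.coeff n) + n * ρ) := by
  have hco : ∀ j, (Ψ.comp (C c * X)).coeff j = Ψ.coeff j * c ^ j := fun j => comp_C_mul_X_coeff
  have hod : ∀ j, Ψ.coeff j ≠ 0 → od v ((Ψ.comp (C c * X)).coeff j) = od v (Ψ.coeff j) + j * ρ := by
    intro j hj
    rw [hco, od_mul _ hj (pow_ne_zero _ hc0), od_pow, hc]
  have hne : ∀ j, Ψ.coeff j ≠ 0 → (Ψ.comp (C c * X)).coeff j ≠ 0 := by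
    intro j hj; rw [hco]; exact mul_ne_zero hj (pow_ne_zero _ hc0)
  have hz : ∀ j, Ψ.coeff j = 0 → (Ψ.comp (C c * X)).coeff j = 0 := by
    intro j hj; rw [hco, hj, zero_mul]
  have hbig : ∀ j, n < j → OG v (od v ((Ψ.comp (C c * X)).coeff n) + 1) ((Ψ.comp (C c * X)).coeff j) := by
    intro j hj
    by_cases h0 : Ψ.coeff j = 0
    · rw [hz j h0]; exact OG_zero _ _
    rw [OG_iff _ (hne j h0), hod j h0, hod n hV.1]
    have h1 := (OG_iff _ h0).1 (hV.2 j hj.ne')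
    have h2 : (n:ℤ) * ρ ≤ j * ρ := by
      apply mul_le_mul_of_nonneg_right _ hρ0.le
      exact_mod_cast hj.le
    linarith
  have hsm : ∀ j, j < n → OG v (od v ((Ψ.comp (C c * X)).coeff n)) ((Ψ.comp (C c * X)).coeff j) := by
    intro j hj
    by_cases h0 : Ψ.coeff j = 0
    · rw [hz j h0]; exact OG_zero _ _
    rw [OG_iff _ (hne j h0), hod j h0, hod n hV.1]
    have := hmin j hj h0
    linarith
  rcases stepL h n hn4 hIH (Ψ.comp (C c * X)) (sep_comp' hsep hc0) (hne n hV.1) (by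
      intro j
      rcases lt_trichotomy j n with hj | rfl | hj
      · exact hsm j hj
      · exact od_OG _ _
      · exact (hbig j hj).mono (by omega)) hbig (by
      rw [hod n hV.1]
      apply he.add
      have : Even (n:ℤ) := by rw [Int.even_iff]; omega
      exact this.mul_right _) ⟨i, hin, by
        rw [OG_iff _ (hne i hi), hod i hi, hod n hV.1]
        intro h'
        linarith⟩ with hG | ⟨h1, s, h2, h3⟩
  · left; exact Goal.comp' hG
  · right
    have h0 : Ψ.coeff (n - 2) ≠ 0 := by
      intro h0
      apply h1
      rw [hz _ h0]; exact OG_zero _ _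
    constructor
    · rw [OG_iff _ (hne _ h0), hod _ h0, hod n hV.1] at h1
      have h4 := hmin (n - 2) (by omega) h0
      have h5 : ((n - 2 : ℕ) : ℤ) = n - 2 := by push_cast [show 2 ≤ n by omega]; ring
      rw [h5] at h1 h4
      nlinarith
    · have e : (Ψ.comp (C c * X)).comp (C (s : F) + X) = Ψ.comp (C (c * (s : F)) + C c * X) := by
        rw [comp_assoc, mul_comp, C_comp, X_comp, mul_add, ← C_mul]
      rw [e] at h2 h3
      exact ⟨s, h2, h3.trans (hod n hV.1)⟩

/-- one step: either done, or a further blow up -/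
theorem stepV (h : Good F v) (n : ℕ) (hn4 : n % 4 = 2) (hIH : ∀ n', n' < n → n' % 4 = 2 → HH n')
    (Ψ : F[X]) (hsep : Ψ.Separable) (hV : Vx v Ψ n) :
    Goal Ψ ∨ ∃ (ρ : ℤ) (c : F) (s : 𝓞 F), 0 < ρ ∧ c ≠ 0 ∧ od v c = ρ ∧ Vx v (Ψ.comp (C (c * (s : F)) + C c * X)) n ∧
        od v ((Ψ.comp (C (c * (s : F)) + C c * X)).coeff n) = od v (Ψ.coeff n) + n * ρ := by
  classical
  rcases Int.even_or_odd (od v (Ψ.coeff n)) with he | ho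
  swap
  · left; exact hV.goal h (Or.inr ho)
  set S := (Finset.range n).filter (fun j => Ψ.coeff j ≠ 0) with hS
  have hmem : ∀ j, j ∈ S ↔ j < n ∧ Ψ.coeff j ≠ 0 := by
    intro j; rw [hS, Finset.mem_filter, Finset.mem_range]
  have hSne : S.Nonempty := by
    by_contra hcon
    rw [Finset.not_nonempty_iff_eq_empty] at hcon
    have h0 : ∀ j, j < n → Ψ.coeff j = 0 := by
      intro j hj
      by_contra h0
      have := (hmem j).2 ⟨hj, h0⟩
      rw [hcon] at this; simp at this
    have hd : X * X ∣ Ψ := by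
      rw [← pow_two, X_pow_dvd_iff]
      intro d hd; exact h0 d (by omega)
    exact not_isUnit_X (hsep.squarefree X hd)
  obtain ⟨i, hi, hmin, hmin'⟩ := exists_slope n S hSne (fun j hj => ((hmem j).1 hj).1) (fun j => od v (Ψ.coeff j) - od v (Ψ.coeff n))
  obtain ⟨hin, hi0⟩ := (hmem i).1 hi
  have hgt : ∀ j, j ≠ n → Ψ.coeff j ≠ 0 → od v (Ψ.coeff n) + 1 ≤ od v (Ψ.coeff j) := by
    intro j hj h0; exact (OG_iff _ h0).1 (hV.2 j hj)
  set γ := od v (Ψ.coeff n) with hγ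
  obtain ⟨A, hA⟩ : ∃ A, A = od v (Ψ.coeff i) - γ := ⟨_, rfl⟩
  obtain ⟨B, hB⟩ : ∃ B : ℤ, B = (n:ℤ) - i := ⟨_, rfl⟩
  have hA0 : 0 < A := by have := hgt i hin.ne hi0; omega
  have hB0 : 0 < B := by omega
  have hle : ∀ j, Ψ.coeff j ≠ 0 → ((i : ℤ) - j) * A ≤ B * (od v (Ψ.coeff j) - od v (Ψ.coeff i)) := by
    intro j hj
    rcases lt_trichotomy j n with hjn | rfl | hjn
    · have := hmin j ((hmem j).2 ⟨hjn, hj⟩)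
      simp only [← hA, ← hB] at this
      nlinarith
    · rw [← hγ]
      nlinarith
    · have h1 := hgt j hjn.ne' hj
      have h2 : (n:ℤ) < j := by exact_mod_cast hjn
      nlinarith [mul_pos hA0 (sub_pos.2 h2), mul_pos hB0 (show 0 < od v (Ψ.coeff j) - γ by omega)]
  have hlt : ∀ j, j < i → Ψ.coeff j ≠ 0 → ((i : ℤ) - j) * A < B * (od v (Ψ.coeff j) - od v (Ψ.coeff i)) := by
    intro j hji hj
    have := hmin' j ((hmem j).2 ⟨by omega, hj⟩) hji
    simp only [← hA, ← hB] at this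
    nlinarith
  by_cases ho : Odd i ∨ Odd (od v (Ψ.coeff i))
  · left; exact vgoal h Ψ i hi0 A B hB0 hle hlt ho
  push Not at ho
  obtain ⟨ho1, ho2⟩ := ho
  rw [Nat.not_odd_iff_even] at ho1
  rw [Int.not_odd_iff_even] at ho2
  by_cases hi2 : i % 4 = 2
  · left; exact slope_HH h Ψ hsep i (hIH i hin hi2) hi0 A B hB0 hle hlt
  have hi4 : i % 4 = 0 := by rw [Nat.even_iff] at ho1; omega
  have hAe : Even A := by rw [hA]; exact ho2.sub he
  obtain ⟨A₂, hA₂⟩ := hAe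
  obtain ⟨q, hq⟩ : ∃ q : ℕ, B = 2 * q := ⟨(n - i) / 2, by omega⟩
  have hqo : Odd q := by rw [Nat.odd_iff]; omega
  -- ramified step
  have key : Goal Ψ ∨ (q:ℤ) * (od v (Ψ.coeff (n - 2)) - γ) = A := by
    obtain ⟨M, _, _, ι, w, hgM, hodM⟩ := lemR h q hqo
    obtain ⟨p, hp0, hp1⟩ := exists_unif' w
    have hodc : ∀ j, od w ((Ψ.map ι).coeff j) = q * od v (Ψ.coeff j) := by
      intro j; rw [coeff_map, hodM]
    have hq0 : (0:ℤ) < q := by exact_mod_cast hqo.pos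
    have hVM : Vx w (Ψ.map ι) n := by
      refine ⟨by rw [coeff_map]; simpa using hV.1, fun j hj => ?_⟩
      by_cases h0 : Ψ.coeff j = 0
      · rw [coeff_map, coeff_map, h0, map_zero]; exact OG_zero _ _
      rw [OG_iff _ (by rw [coeff_map]; simpa using h0), hodc, hodc]
      have := hgt j hj h0
      rw [← hγ]
      nlinarith
    rcases stepR hgM n hn4 hIH (Ψ.map ι) hsep.map hVM (by rw [hodc]; exact he.mul_left _) i hin
      (by rw [coeff_map]; simpa using hi0) A₂ (by omega) (by
        rw [hodc, hodc, ← hB, ← hγ]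
        have : od v (Ψ.coeff i) = A + γ := by omega
        rw [this, hq, hA₂]; ring) (by
        intro j hj hj0
        rw [coeff_map] at hj0
        have hj0' : Ψ.coeff j ≠ 0 := by intro h0; rw [h0, map_zero] at hj0; exact hj0 rfl
        rw [hodc, hodc, ← hγ]
        have := hmin j ((hmem j).2 ⟨hj, hj0'⟩)
        simp only [← hA, ← hB] at this
        rw [hq, hA₂] at this
        nlinarith) (p ^ A₂) (zpow_ne_zero _ hp0) (by rw [od_zpow, hp1, mul_one]) with hG | ⟨h1, -⟩
    · left; exact hG.map
    · right
      rw [hodc, hodc, ← hγ] at h1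
      linarith
  rcases key with hG | key
  · left; exact hG
  have hρe : Even (od v (Ψ.coeff (n - 2)) - γ) := by
    have h1 : Even ((q:ℤ) * (od v (Ψ.coeff (n - 2)) - γ)) := by rw [key, hA₂]; exact ⟨_, rfl⟩
    rcases Int.even_mul.1 h1 with h2 | h2
    · have : Odd (q:ℤ) := by exact_mod_cast hqo
      exact absurd h2 (Int.not_even_iff_odd.2 this)
    · exact h2
  obtain ⟨ρ, hρ⟩ := hρe
  rw [hρ] at key
  have hρB : ρ * B = A := by rw [hq]; linarith
  have hρ0 : 0 < ρ := by
    by_contra hcon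
    push Not at hcon
    nlinarith
  obtain ⟨p, hp0, hp1⟩ := exists_unif' v
  have hcod : od v (p ^ ρ) = ρ := by rw [od_zpow, hp1, mul_one]
  rcases stepR h n hn4 hIH Ψ hsep hV he i hin hi0 ρ hρ0 (by rw [← hB, ← hγ, hρB, hA]) (by
      intro j hj hj0
      have := hmin j ((hmem j).2 ⟨hj, hj0⟩)
      simp only [← hA, ← hB] at this
      rw [← hρB] at this
      rw [← hγ]
      refine le_of_mul_le_mul_right (?_ : _ * B ≤ _ * B) hB0
      linarith) (p ^ ρ) (zpow_ne_zero _ hp0) hcod with hG | ⟨-, s, h2, h3⟩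
  · left; exact hG
  · right
    exact ⟨ρ, p ^ ρ, s, hρ0, zpow_ne_zero _ hp0, hcod, h2, h3⟩

theorem inner (h : Good F v) (n : ℕ) (hn4 : n % 4 = 2) (hIH : ∀ n', n' < n → n' % 4 = 2 → HH n')
    (Ψ : F[X]) (hsep : Ψ.Separable) (γ C0 : ℤ)
    (hC : ∀ a, OG v 0 a → OG v (C0 + 1) (Ψ.eval a) → OG v (C0 + 1) ((derivative Ψ).eval a) → False) (N : ℕ) :
    ∀ a b : F, OG v 0 a → OG v 0 b → b ≠ 0 → Vx v (Ψ.comp (C a + C b * X)) n →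
      od v ((Ψ.comp (C a + C b * X)).coeff n) = γ + n * od v b → C0 - (γ + (n - 1) * od v b) ≤ N → Goal Ψ := by
  induction N with
  | zero =>
    intro a b ha hb hb0 hV hod hN
    exfalso
    have hob : 0 ≤ od v b := (OG_iff _ hb0).1 hb
    push_cast at hN
    have e0 : (Ψ.comp (C a + C b * X)).coeff 0 = Ψ.eval a := by
      rw [coeff_zero_eq_eval_zero, eval_comp]; simp
    have e1 : (Ψ.comp (C a + C b * X)).coeff 1 = (derivative Ψ).eval a * b := by
      have h1 := coeff_derivative (Ψ.comp (C a + C b * X)) 0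
      rw [coeff_zero_eq_eval_zero, derivative_comp] at h1
      simp [eval_comp] at h1
      rw [← h1]; ring
    have h0 := hV.2 0 (by omega)
    have h1 := hV.2 1 (by omega)
    rw [e0, hod] at h0
    rw [e1, hod] at h1
    apply hC a ha
    · exact h0.mono (by nlinarith)
    · have := h1.mul (od_OG v b⁻¹)
      rw [mul_assoc, mul_inv_cancel₀ hb0, mul_one, od_inv] at this
      exact this.mono (by nlinarith)
  | succ N ih =>
    intro a b ha hb hb0 hV hod hN
    rcases stepV h n hn4 hIH _ (sep_comp hsep a hb0) hV with hG | ⟨ρ, c, s, hρ0, hc0, hc, h1, h2⟩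
    · exact hG.comp
    · have hc' : OG v 0 c := by rw [OG_iff _ hc0]; omega
      have e : (Ψ.comp (C a + C b * X)).comp (C (c * (s : F)) + C c * X) = Ψ.comp (C (a + b * (c * (s : F))) + C (b * c) * X) := by
        rw [comp_assoc]
        congr 1
        simp only [add_comp, mul_comp, C_comp, X_comp, C_add, C_mul]; ring
      rw [e] at h1 h2
      have hbc : od v (b * c) = od v b + ρ := by rw [od_mul _ hb0 hc0, hc]
      refine ih _ _ ?_ ?_ (mul_ne_zero hb0 hc0) h1 ?_ ?_
      · have h3 := hb.mul (hc'.mul (OG_int v s))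
        rw [add_zero, add_zero] at h3
        exact ha.add h3
      · have h3 := hb.mul hc'
        rwa [add_zero] at h3
      · rw [h2, hod, hbc]; ring
      · rw [hbc]
        push_cast at hN
        have : (2:ℤ) ≤ n := by omega
        nlinarith
end G

theorem HH_all (n : ℕ) (hn4 : n % 4 = 2) : HH n := by
  induction n using Nat.strong_induction_on with
  | _ n ih =>
  intro F _ _ v hg Ψ hsep hV
  obtain ⟨a, b, hab⟩ := id hsep
  obtain ⟨C1, h1⟩ := OG_eval_bound v a
  obtain ⟨C2, h2⟩ := OG_eval_bound v b
  have hc : Ψ.comp (C 0 + C 1 * X) = Ψ := by rw [C_0, C_1, zero_add, one_mul, comp_X]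
  refine inner hg n hn4 (fun n' hn' h' => ih n' hn' h') Ψ hsep (od v (Ψ.coeff n)) (max C1 C2) ?_
    (max C1 C2 - od v (Ψ.coeff n)).toNat 0 1 (OG_zero _ _) (OG_one_one v) one_ne_zero (by rwa [hc]) (by rw [hc, od_one]; ring) ?_
  · intro x hx h3 h4
    have h5 := congrArg (Polynomial.eval x) hab
    rw [eval_add, eval_mul, eval_mul, eval_one] at h5
    have h6 := (((h1 x hx).mul h3).mono (m := 1) (by omega)).add (((h2 x hx).mul h4).mono (m := 1) (by omega))
    rw [h5, OG_iff _ one_ne_zero, od_one] at h6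
    omega
  · rw [od_one, mul_zero, add_zero]
    exact Int.self_le_toNat _
end

section
open Polynomial
set_option linter.all false
open IsDedekindDomain NumberField

theorem good_rat : ∃ v : Pl ℚ, Good ℚ v ∧ od v (2:ℚ) = 1 := by
  let e := Rat.ringOfIntegersEquiv
  have hp : Prime (2 : 𝓞 ℚ) := by
    rw [← MulEquiv.prime_iff e.toMulEquiv]
    have : e.toMulEquiv 2 = (2:ℤ) := map_ofNat e 2
    rw [this]; exact Int.prime_two
  have hp0 : (2 : 𝓞 ℚ) ≠ 0 := hp.ne_zero
  let v : Pl ℚ := ⟨Ideal.span {2}, (Ideal.span_singleton_prime hp0).2 hp, by simpa using hp0⟩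
  have c2 : ((2 : 𝓞 ℚ) : ℚ) = 2 := map_ofNat _ 2
  have h1 : OG v 1 (2:ℚ) := by
    rw [← c2, OG_one_iff_mem]; exact Ideal.mem_span_singleton_self _
  have h2 : ¬ OG v (2:ℕ) (2:ℚ) := by
    rw [← c2, OG_pow_iff_mem]
    change ¬ (2 : 𝓞 ℚ) ∈ Ideal.span {2} ^ 2
    rw [Ideal.span_singleton_pow, Ideal.mem_span_singleton]
    intro hd
    have := map_dvd e hd
    rw [map_pow, map_ofNat e 2] at this
    revert this; decide
  rw [OG_iff _ two_ne_zero] at h1 h2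
  have h3 : od v (2:ℚ) = 1 := by push_cast at h2; omega
  refine ⟨v, ⟨by simp, by rw [h3]; exact odd_one, ?_⟩, h3⟩
  intro w hw
  have hm : (2 : 𝓞 ℚ) ∈ w.asIdeal := by
    by_contra hcon
    apply hw
    rw [← c2]
    exact (od_eq_zero_of_notMem w hcon).2
  apply HeightOneSpectrum.ext
  symm
  apply v.isMaximal.eq_of_le w.isPrime.ne_top
  change Ideal.span {2} ≤ _
  rw [Ideal.span_le]
  simpa using hm

theorem goal_rat (f : ℚ[X]) (hf : Squarefree f) (hd : f.natDegree % 4 = 2) : Goal f := by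
  obtain ⟨v, hg, h2⟩ := good_rat
  have hsep : f.Separable := PerfectField.separable_iff_squarefree.2 hf
  set n := f.natDegree with hn
  have hn0 : f.coeff n ≠ 0 := by
    rw [hn, coeff_natDegree, leadingCoeff_ne_zero]; exact hf.ne_zero
  obtain ⟨N, hN⟩ : ∃ N : ℕ, ∀ j, j ≤ n → od v (f.coeff n) + 1 - od v (f.coeff j) ≤ N := by
    refine ⟨∑ j ∈ Finset.range (n+1), (od v (f.coeff n) + 1 - od v (f.coeff j)).natAbs, fun j hj => ?_⟩
    refine le_trans (Int.le_natAbs) ?_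
    have := Finset.single_le_sum (f := fun j => (od v (f.coeff n) + 1 - od v (f.coeff j)).natAbs) (fun i _ => Nat.zero_le _)
      (Finset.mem_range.2 (Nat.lt_succ_of_le hj))
    exact_mod_cast this
  have hc0 : ((2:ℚ) ^ (-(N:ℤ))) ≠ 0 := zpow_ne_zero _ two_ne_zero
  have hc : od v ((2:ℚ) ^ (-(N:ℤ))) = -N := by rw [od_zpow, h2, mul_one]
  generalize (2:ℚ) ^ (-(N:ℤ)) = c at hc0 hc
  apply Goal.comp' (c := c)
  apply HH_all n hd ℚ v hg _ (sep_comp' hsep hc0)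
  have hco : ∀ j, (f.comp (C c * X)).coeff j = f.coeff j * c ^ j := fun j => comp_C_mul_X_coeff
  refine ⟨by rw [hco]; exact mul_ne_zero hn0 (pow_ne_zero _ hc0), fun j hj => ?_⟩
  rw [hco, hco]
  by_cases h0 : f.coeff j = 0
  · rw [h0, zero_mul]; exact OG_zero _ _
  have hjn : j < n := lt_of_le_of_ne (le_natDegree_of_ne_zero h0) hj
  rw [OG_iff _ (mul_ne_zero h0 (pow_ne_zero _ hc0)), od_mul _ hn0 (pow_ne_zero _ hc0), od_mul _ h0 (pow_ne_zero _ hc0), od_pow, od_pow, hc]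
  have h1 := hN j hjn.le
  have h3 : (j:ℤ) + 1 ≤ n := by exact_mod_cast hjn
  nlinarith [mul_nonneg (sub_nonneg.2 h3) (Int.natCast_nonneg N)]
end

section
open Polynomial
set_option linter.all false
open IsDedekindDomain NumberField

theorem lc_pos_real (f : ℝ[X]) (hf : ∀ x, 0 < f.eval x) : 0 < f.leadingCoeff := by
  by_contra hcon
  push Not at hcon
  by_cases hd : 0 < f.degree
  · have h1 := tendsto_atBot_of_leadingCoeff_nonpos f hd hcon
    obtain ⟨x, hx⟩ := (h1.eventually (Filter.eventually_lt_atBot 0)).exists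
    exact absurd (hf x) (not_lt.2 hx.le)
  · push Not at hd
    have h1 := eq_C_of_degree_le_zero hd
    have h2 := hf 0
    rw [h1, eval_C] at h2
    rw [h1, leadingCoeff_C] at hcon
    linarith

theorem even_deg_real (f : ℝ[X]) (hf : ∀ x, 0 < f.eval x) : Even f.natDegree := by
  have h1 := lc_pos_real f hf
  have h2 := lc_pos_real (f.comp (-X)) (by intro x; rw [eval_comp]; exact hf _)
  rw [leadingCoeff_comp (by rw [natDegree_neg, natDegree_X]; exact one_ne_zero), leadingCoeff_neg, leadingCoeff_X] at h2
  by_contra hcon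
  rw [Nat.not_even_iff_odd] at hcon
  rw [hcon.neg_one_pow] at h2
  linarith

theorem pos_half (f : ℝ[X]) (hf : ∀ x, 0 < f.eval x) (m : ℕ) (hm : f.natDegree = 2 * m) :
    ∃ ε > 0, ∃ R : ℝ, ∀ x, R ≤ x → ε * (1 + x ^ 2) ^ m ≤ f.eval x := by
  have h1 := lc_pos_real f hf
  have hf0 : f ≠ 0 := by rintro rfl; simp at h1
  have hQm : ((X ^ 2 + C 1 : ℝ[X]) ^ m).Monic := (monic_X_pow_add_C (1:ℝ) two_ne_zero).pow m
  have hQd : ((X ^ 2 + C 1 : ℝ[X]) ^ m).natDegree = 2 * m := by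
    rw [natDegree_pow, natDegree_X_pow_add_C, mul_comm]
  have h2 := div_tendsto_atTop_leadingCoeff_div_of_degree_eq f ((X ^ 2 + C 1) ^ m) (by
    rw [degree_eq_natDegree hf0, degree_eq_natDegree hQm.ne_zero, hQd, hm])
  rw [hQm.leadingCoeff, div_one] at h2
  have h3 := h2.eventually (lt_mem_nhds (half_lt_self h1))
  obtain ⟨R, hR⟩ := Filter.eventually_atTop.1 h3
  refine ⟨f.leadingCoeff / 2, half_pos h1, R, fun x hx => ?_⟩
  have h4 := hR x hx
  simp only [eval_pow, eval_add, eval_X, eval_C] at h4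
  rw [lt_div_iff₀ (by positivity)] at h4
  rw [add_comm (1:ℝ)]
  exact h4.le

theorem pos_bound (f : ℝ[X]) (hf : ∀ x, 0 < f.eval x) (m : ℕ) (hm : f.natDegree = 2 * m) :
    ∃ ε > 0, ∀ x, ε * (1 + x ^ 2) ^ m ≤ f.eval x := by
  obtain ⟨ε1, he1, R1, h1⟩ := pos_half f hf m hm
  obtain ⟨ε2, he2, R2, h2⟩ := pos_half (f.comp (-X)) (by intro x; rw [eval_comp]; exact hf _) m (by
    rw [natDegree_comp, natDegree_neg, natDegree_X, mul_one, hm])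
  set R := max (max R1 R2) 0 with hR
  have hR0 : 0 ≤ R := le_max_right _ _
  obtain ⟨x0, hx0, hmin⟩ := (isCompact_Icc (a := -R) (b := R)).exists_isMinOn ⟨0, by constructor <;> linarith⟩ (f := fun x => f.eval x / (1 + x ^ 2) ^ m)
    (by
      apply Continuous.continuousOn
      apply f.continuous.div (by fun_prop)
      intro x; positivity)
  have hp0 : 0 < f.eval x0 / (1 + x0 ^ 2) ^ m := div_pos (hf x0) (by positivity)
  refine ⟨min (min ε1 ε2) (f.eval x0 / (1 + x0 ^ 2) ^ m), lt_min (lt_min he1 he2) hp0, fun x => ?_⟩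
  have hpos : (0:ℝ) ≤ (1 + x ^ 2) ^ m := by positivity
  rcases le_total R x with hx | hx
  · refine le_trans (mul_le_mul_of_nonneg_right ((min_le_left _ _).trans (min_le_left _ _)) hpos) (h1 x ?_)
    exact le_trans (le_trans (le_max_left _ _) (le_max_left _ _)) hx
  rcases le_total x (-R) with hx' | hx'
  · have h3 := h2 (-x) (by
      have : R2 ≤ R := le_trans (le_max_right _ _) (le_max_left _ _)
      linarith)
    rw [eval_comp, eval_neg, eval_X, neg_neg, neg_sq] at h3
    exact le_trans (mul_le_mul_of_nonneg_right ((min_le_left _ _).trans (min_le_right _ _)) hpos) h3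
  · have h3 : f.eval x0 / (1 + x0 ^ 2) ^ m ≤ f.eval x / (1 + x ^ 2) ^ m := hmin (show x ∈ Set.Icc (-R) R from ⟨hx', hx⟩)
    refine le_trans (mul_le_mul_of_nonneg_right (min_le_right _ _) hpos) ?_
    rwa [le_div_iff₀ (by positivity)] at h3

theorem exists_real_emb (F : Type) [Field F] [NumberField F] (h : Odd (Module.finrank ℚ F)) : Nonempty (F →+* ℝ) := by
  classical
  have h1 := NumberField.InfinitePlace.card_add_two_mul_card_eq_rank F
  have h2 : NumberField.InfinitePlace.nrRealPlaces F ≠ 0 := by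
    intro h0; rw [h0, zero_add] at h1; rw [← h1] at h
    exact absurd h (Nat.not_odd_iff_even.2 (even_two_mul _))
  have h3 : 0 < Fintype.card { w : NumberField.InfinitePlace F // w.IsReal } := Nat.pos_of_ne_zero h2
  obtain ⟨w, hw⟩ := Fintype.card_pos_iff.1 h3
  exact ⟨NumberField.InfinitePlace.embedding_of_isReal hw⟩

section A
variable {K : Type} [Field K] [NumberField K]

theorem exists_adj' (p : K[X]) (hirr : Irreducible p) :
    ∃ (M : Type) (_ : Field M) (_ : NumberField M) (_ : Algebra K M) (θ : M), aeval θ p = 0 ∧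
      Module.finrank K M = p.natDegree ∧ (∀ x : M, ∃ a : K[X], aeval θ a = x) ∧ (∀ a : K[X], aeval θ a = 0 → p ∣ a) ∧
      (∀ u : K, p.leadingCoeff * Algebra.norm K (algebraMap K M u - θ) = p.eval u) := by
  classical
  haveI : Fact (Irreducible p) := ⟨hirr⟩
  let M := AdjoinRoot p
  let pb := AdjoinRoot.powerBasis hirr.ne_zero
  haveI : Module.Finite K M := pb.finite
  haveI : CharZero M := charZero_of_injective_algebraMap (algebraMap K M).injective
  haveI : Module.Finite ℚ M := Module.Finite.trans K M
  haveI : NumberField M := ⟨⟩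
  refine ⟨M, inferInstance, inferInstance, inferInstance, AdjoinRoot.root p, ?_, ?_, ?_, ?_, ?_⟩
  · rw [aeval_def]; exact AdjoinRoot.eval₂_root p
  · exact pb.finrank.trans (AdjoinRoot.powerBasis_dim hirr.ne_zero)
  · intro x
    obtain ⟨a, ha⟩ := AdjoinRoot.mk_surjective x
    exact ⟨a, by rw [AdjoinRoot.aeval_eq]; exact ha⟩
  · intro a ha
    rw [AdjoinRoot.aeval_eq] at ha
    exact AdjoinRoot.mk_eq_zero.1 ha
  · intro u
    have h1 := charpoly_leftMulMatrix pb
    have h2 := congrArg (Polynomial.eval u) h1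
    rw [Matrix.eval_charpoly] at h2
    have h3 : Algebra.norm K (algebraMap K M u - pb.gen) = (minpoly K pb.gen).eval u := by
      rw [← h2, Algebra.norm_eq_matrix_det pb.basis, map_sub]
      congr 2
      rw [AlgHom.commutes]; rfl
    have h4 : pb.gen = AdjoinRoot.root p := AdjoinRoot.powerBasis_gen _
    rw [← h4, h3, h4, AdjoinRoot.minpoly_root hirr.ne_zero, eval_mul, eval_C]
    have := leadingCoeff_ne_zero.2 hirr.ne_zero
    field_simp

theorem levtwo_of {M : Type} [Field M] [Algebra K M] (p : K[X]) (θ : M) (h1 : ∀ x : M, ∃ a : K[X], aeval θ a = x) (h2 : ∀ a : K[X], aeval θ a = 0 → p ∣ a)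
    (h : ∃ c d : M, c ^ 2 + d ^ 2 = -1) : LevTwo p := by
  obtain ⟨c, d, hcd⟩ := h
  obtain ⟨a, rfl⟩ := h1 c
  obtain ⟨b, rfl⟩ := h1 d
  refine ⟨a, b, h2 _ ?_⟩
  simp only [map_add, map_pow, map_one, hcd]; ring

theorem trace_even {v0 : Pl K} (hv0 : ∀ v : Pl K, od v (2:K) ≠ 0 → v = v0) {a : 𝓞 K} (ha : a ∈ v0.asIdeal) :
    (2:ℤ) ∣ Algebra.trace ℤ (𝓞 K) a := by
  classical
  obtain ⟨n, hn⟩ : ∃ n : ℕ, (2 : 𝓞 K) ∣ a ^ n := by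
    have c2 : ((2 : 𝓞 K) : K) = 2 := map_ofNat _ 2
    refine ⟨(od v0 (2:K)).toNat, ?_⟩
    obtain ⟨b, hb⟩ := int_of_OG (x := ((a ^ (od v0 (2:K)).toNat : 𝓞 K) : K) / 2) (by
      intro v
      rw [div_eq_mul_inv]
      by_cases hv : od v (2:K) = 0
      · have := (OG_int v (a ^ (od v0 (2:K)).toNat)).mul (od_OG v (2:K)⁻¹)
        rwa [od_inv, hv, neg_zero, add_zero] at this
      · have := hv0 v hv; subst this
        have h1 := ((OG_one_iff_mem v a).2 ha).pow (od v (2:K)).toNat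
        have h2 := h1.mul (od_OG v (2:K)⁻¹)
        rw [od_inv, mul_one, Int.toNat_of_nonneg (od_two_nonneg v), add_neg_cancel] at h2
        rwa [show ((a ^ (od v (2:K)).toNat : 𝓞 K) : K) = (a : K) ^ (od v (2:K)).toNat from map_pow _ _ _])
    refine ⟨b, ?_⟩
    apply RingOfIntegers.coe_injective
    rw [map_mul]
    change _ = ((2 : 𝓞 K) : K) * (b : K)
    rw [c2, hb]
    field_simp
  set b := RingOfIntegers.basis K
  change ((2:ℕ):ℤ) ∣ _
  rw [← ZMod.intCast_zmod_eq_zero_iff_dvd, Algebra.trace_eq_matrix_trace b]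
  set A := Algebra.leftMulMatrix b a with hA
  have h1 : ((A.trace : ℤ) : ZMod 2) = (A.map (Int.castRingHom (ZMod 2))).trace := by
    rw [Matrix.trace, Matrix.trace]; simp
  have h2 : IsNilpotent (A.map (Int.castRingHom (ZMod 2))) := by
    refine ⟨n, ?_⟩
    rw [← RingHom.mapMatrix_apply, ← map_pow, hA, ← map_pow]
    obtain ⟨c, hc⟩ := hn
    rw [hc, map_mul, map_ofNat, map_mul, map_ofNat]
    have : (2 : Matrix (Module.Free.ChooseBasisIndex ℤ (𝓞 K)) (Module.Free.ChooseBasisIndex ℤ (𝓞 K)) (ZMod 2)) = 0 := CharTwo.two_eq_zero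
    rw [this, zero_mul]
  rw [h1]
  exact (Matrix.isNilpotent_trace_of_isNilpotent h2).eq_zero

theorem coprime_two {v0 : Pl K} (hv0 : ∀ v : Pl K, od v (2:K) ≠ 0 → v = v0) {d : 𝓞 K} (hd : d ∉ v0.asIdeal) :
    IsCoprime d 2 := by
  rw [← Ideal.isCoprime_span_singleton_iff, Ideal.isCoprime_iff_sup_eq]
  by_contra h
  obtain ⟨m, hm, hle⟩ := Ideal.exists_le_maximal _ h
  have hd2 : d ∈ m := hle (Ideal.mem_sup_left (Ideal.mem_span_singleton_self d))
  have h22 : (2 : 𝓞 K) ∈ m := hle (Ideal.mem_sup_right (Ideal.mem_span_singleton_self 2))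
  have hmb : m ≠ ⊥ := by
    rintro rfl
    have h22 : (2 : 𝓞 K) = 0 := by simpa using h22
    norm_num at h22
  have : (⟨m, hm.isPrime, hmb⟩ : Pl K) = v0 := by
    apply hv0
    have h3 := (OG_one_iff_mem (⟨m, hm.isPrime, hmb⟩ : Pl K) 2).2 h22
    have e : ((2 : 𝓞 K) : K) = 2 := map_ofNat _ 2
    rw [e, OG_iff _ (two_ne K)] at h3
    omega
  rw [← this] at hd
  exact hd hd2

theorem norm_one_add_two {v0 : Pl K} (hv0 : ∀ v : Pl K, od v (2:K) ≠ 0 → v = v0) (h0 : od v0 (2:K) ≠ 0) {c : K} (hc : OG v0 1 c) :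
    InE (Algebra.norm ℚ (1 + 2 * c)) := by
  obtain ⟨a, d, hd, h⟩ := exists_num_den v0 (hc.mono zero_le_one)
  have hd0 := od_eq_zero_of_notMem v0 hd
  have h1 := norm_odd hv0 hd
  obtain ⟨x, y, hxy⟩ := coprime_two hv0 hd
  have ha : a ∈ v0.asIdeal := by
    rw [← OG_one_iff_mem, ← h]
    have := hc.mul (OG_int v0 d)
    rwa [add_zero] at this
  have e1 : d + 2 * a = d * (1 + (2:ℤ) • (x * a)) + ((4:ℕ) : 𝓞 K) * (y * a) := by
    rw [zsmul_eq_mul]; push_cast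
    linear_combination (-2 * a) * hxy
  obtain ⟨r, hr⟩ := Algebra.norm_one_add_smul (2:ℤ) (x * a)
  obtain ⟨τ, hτ⟩ := trace_even hv0 (v0.asIdeal.mul_mem_left x ha)
  have h2 : (4:ℤ) ∣ Algebra.norm ℤ (d + 2 * a) - Algebra.norm ℤ d := by
    obtain ⟨s, hs⟩ := norm_mod 4 (d * (1 + (2:ℤ) • (x * a))) (y * a)
    rw [← e1, map_mul, hr, hτ] at hs
    push_cast at hs
    exact ⟨s + Algebra.norm ℤ d * (τ + r), by linear_combination hs⟩
  have h3 : ((d + 2 * a : 𝓞 K) : K) = (1 + 2 * c) * d := by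
    have e : ((d + 2 * a : 𝓞 K) : K) = (d : K) + 2 * (a : K) := by push_cast; rfl
    rw [e]
    linear_combination -2 * h
  have h4 : Odd (Algebra.norm ℤ (d + 2 * a)) := by
    obtain ⟨k, hk⟩ := h2
    obtain ⟨m, hm⟩ := h1
    refine ⟨m + 2 * k, ?_⟩
    linarith
  have h5 := InE_odd h4 h1 h2
  have h6 : (Algebra.norm ℚ) ((d + 2 * a : 𝓞 K) : K) / Algebra.norm ℚ (d : K) = Algebra.norm ℚ (1 + 2 * c) := by
    rw [h3, map_mul, mul_div_assoc, div_self, mul_one]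
    rw [Algebra.norm_ne_zero_iff]; exact hd0.1
  rw [← h6]
  rw [Algebra.coe_norm_int, Algebra.coe_norm_int] at h5
  exact h5
end A
end

section
open Polynomial
set_option linter.all false
open IsDedekindDomain NumberField

theorem tc_of {F M : Type} [Field F] [Field M] [Algebra F M] (θ : M) (h : F[X]) (hθ : aeval θ h = 0)
    (hpos : ∀ (σ : F →+* ℝ) (x : ℝ), 0 < (h.map σ).eval x) : IsEmpty (M →+* ℝ) := by
  constructor
  intro τ
  have h1 := hpos (τ.comp (algebraMap F M)) (τ θ)
  rw [eval_map, ← hom_eval₂, ← aeval_def, hθ, map_zero] at h1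
  exact lt_irrefl _ h1

theorem exists_pow_small (a : ℝ) (ha : 0 < a) : ∃ k0 : ℕ, ∀ k, k0 ≤ k → (4:ℝ)⁻¹ ^ k < a := by
  obtain ⟨k0, hk0⟩ := exists_pow_lt_of_lt_one ha (show (4:ℝ)⁻¹ < 1 by norm_num)
  exact ⟨k0, fun k hk => lt_of_le_of_lt (pow_le_pow_of_le_one (by norm_num) (by norm_num) hk) hk0⟩

theorem exists_coeff_bound {F : Type} [Field F] [NumberField F] (v : Pl F) (P : F[X]) : ∃ C : ℕ, ∀ j, OG v (-(C:ℤ)) (P.coeff j) := by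
  refine ⟨∑ j ∈ Finset.range (P.natDegree + 1), (od v (P.coeff j)).natAbs, fun j => ?_⟩
  by_cases h0 : P.coeff j = 0
  · rw [h0]; exact OG_zero _ _
  have hj := le_natDegree_of_ne_zero h0
  have := Finset.single_le_sum (f := fun j => (od v (P.coeff j)).natAbs) (fun i _ => Nat.zero_le _)
      (Finset.mem_range.2 (Nat.lt_succ_of_le hj))
  rw [OG_iff _ h0]
  have h2 : ((od v (P.coeff j)).natAbs : ℤ) ≤ ((∑ j ∈ Finset.range (P.natDegree + 1), (od v (P.coeff j)).natAbs : ℕ) : ℤ) := by exact_mod_cast this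
  omega

section E
variable {K : Type} [Field K] [NumberField K]

/-- the local computation in the even case -/
theorem even_local (v : Pl K) (hE : 0 < od v (2:K)) (P : K[X]) (m : ℕ) (hd : P.natDegree ≤ 2 * m) (hme : Even m) (hm : 0 < m)
    (hP : ∀ j, OG v (6 * od v (2:K)) (P.coeff j)) (θ : K) (hθ : P.eval θ = (θ ^ m + 1) ^ 2) : (-1 : Kˣ) ∈ SqV v := by
  set E := od v (2:K) with hEdef
  have hθ0 : θ ≠ 0 := by
    rintro rfl
    rw [zero_pow hm.ne', zero_add, one_pow, ← coeff_zero_eq_eval_zero] at hθ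
    have := hP 0
    rw [hθ, OG_iff _ one_ne_zero, od_one] at this
    omega
  have hsum : ∀ s : ℤ, (∀ j : ℕ, j ≤ 2 * m → s ≤ 6 * E + j * od v θ) → OG v s (P.eval θ) := by
    intro s hs
    rw [eval_eq_sum_range]
    apply OG.sum
    intro j hj
    rw [Finset.mem_range] at hj
    refine ((hP j).mul ((od_OG v θ).pow j)).mono (hs j (by omega))
  have hm' : (0:ℤ) < m := by exact_mod_cast hm
  have hs0 : od v θ = 0 := by
    rcases lt_trichotomy (od v θ) 0 with h | h | h
    · exfalso
      have h1 := od_add_eq v (pow_ne_zero m hθ0) (y := 1) (by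
        rw [OG_iff _ one_ne_zero, od_one, od_pow]; nlinarith)
      have h2 := hsum (6 * E + (2 * m : ℕ) * od v θ) (by
        intro j hj
        have : (j:ℤ) ≤ (2 * m : ℕ) := by exact_mod_cast hj
        nlinarith)
      rw [hθ, OG_iff _ (pow_ne_zero _ h1.1), od_pow, h1.2, od_pow] at h2
      push_cast at h2
      nlinarith
    · exact h
    · exfalso
      have h1 := od_add_eq v (one_ne_zero (α := K)) (y := θ ^ m) (by
        rw [OG_iff _ (pow_ne_zero m hθ0), od_one, od_pow]; nlinarith)
      rw [add_comm] at h1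
      have h2 := hsum (6 * E) (by
        intro j hj
        nlinarith)
      rw [hθ, OG_iff _ (pow_ne_zero _ h1.1), od_pow, h1.2, od_one] at h2
      omega
  have h3 : OG v (3 * E) (θ ^ m + 1) := by
    by_cases h0 : θ ^ m + 1 = 0
    · rw [h0]; exact OG_zero _ _
    have h2 := hsum (6 * E) (by intro j hj; rw [hs0]; simp)
    rw [hθ, OG_iff _ (pow_ne_zero _ h0), od_pow] at h2
    rw [OG_iff _ h0]
    push_cast at h2
    omega
  obtain ⟨l, hl⟩ := hme
  refine ⟨Units.mk0 (θ ^ l) (pow_ne_zero _ hθ0), ?_⟩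
  have e : ((-1 : Kˣ) : K) / ((Units.mk0 (θ ^ l) (pow_ne_zero _ hθ0) : Kˣ) : K) ^ 2 - 1 = -((θ ^ m + 1) * (θ ^ m)⁻¹) := by
    have := pow_ne_zero m hθ0
    rw [Units.val_neg, Units.val_one, Units.val_mk0, ← pow_mul, show l * 2 = m by omega]
    field_simp
    ring
  rw [e]
  have h4 := (h3.mul (od_OG v (θ ^ m)⁻¹)).neg
  rw [od_inv, od_pow, hs0, mul_zero, neg_zero, add_zero] at h4
  refine h4.mono ?_
  have : od v (4:K) = 2 * E := od_four v
  omega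
end E

theorem even_case (f : ℚ[X]) (hpos : ∀ t : ℝ, 0 < aeval t f) (m : ℕ) (hm : f.natDegree = 2 * m) (hme : Even m) (hm0 : 0 < m) :
    ∃ g : Fin 5 → ℚ[X], f = ∑ i, g i ^ 2 := by
  have hfr : ∀ x : ℝ, 0 < (f.map (algebraMap ℚ ℝ)).eval x := by
    intro x; rw [eval_map, ← aeval_def]; exact hpos x
  obtain ⟨ε, hε, hb⟩ := pos_bound (f.map (algebraMap ℚ ℝ)) hfr m (by rw [natDegree_map, hm])
  have hc : 0 < f.leadingCoeff := by
    have := lc_pos_real _ hfr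
    rw [leadingCoeff_map] at this
    simpa using this
  obtain ⟨k1, hk1⟩ := exists_pow_small (ε / 4) (by positivity)
  obtain ⟨k2, hk2⟩ := exists_pow_small (f.leadingCoeff : ℝ) (by exact_mod_cast hc)
  obtain ⟨v2, hv2, h22⟩ := good_rat
  obtain ⟨Cb, hCb⟩ := exists_coeff_bound v2 f
  set k := k1 + k2 + Cb + 6 with hk
  have hk1' := hk1 k (by omega)
  have hk2' := hk2 k (by omega)
  set A : ℚ[X] := C ((2:ℚ)⁻¹ ^ k) * (X ^ m + C 1) with hA
  set h : ℚ[X] := f - A ^ 2 with hh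
  have h4k : ((2:ℚ)⁻¹ ^ k) ^ 2 = (4:ℚ)⁻¹ ^ k := by rw [← pow_mul, mul_comm, pow_mul]; norm_num
  have hA2 : A ^ 2 = C ((4:ℚ)⁻¹ ^ k) * (X ^ m + C 1) ^ 2 := by rw [hA, mul_pow, ← C_pow, h4k]
  have hdA : ((X ^ m + C 1 : ℚ[X]) ^ 2).natDegree = 2 * m := by rw [natDegree_pow, natDegree_X_pow_add_C]
  have hmA : ((X ^ m + C 1 : ℚ[X]) ^ 2).Monic := (monic_X_pow_add_C (1:ℚ) hm0.ne').pow 2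
  have hco : h.coeff (2 * m) = f.leadingCoeff - (4:ℚ)⁻¹ ^ k := by
    rw [hh, hA2, coeff_sub, coeff_C_mul, ← hdA, hmA.coeff_natDegree, hdA, ← hm, mul_one, coeff_natDegree]
  have hlcp : 0 < f.leadingCoeff - (4:ℚ)⁻¹ ^ k := by
    have : (((4:ℚ)⁻¹ ^ k : ℚ) : ℝ) < f.leadingCoeff := by push_cast; exact hk2'
    have : (4:ℚ)⁻¹ ^ k < f.leadingCoeff := by exact_mod_cast this
    linarith
  have hdh : h.natDegree = 2 * m := by
    apply le_antisymm
    · rw [hh, hA2]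
      refine (natDegree_sub_le _ _).trans (max_le hm.le ?_)
      exact (natDegree_C_mul_le _ _).trans hdA.le
    · apply le_natDegree_of_ne_zero; rw [hco]; exact hlcp.ne'
  have hlc : h.leadingCoeff = f.leadingCoeff - (4:ℚ)⁻¹ ^ k := by rw [leadingCoeff, hdh, hco]
  have h0 : h ≠ 0 := by rw [← leadingCoeff_ne_zero, hlc]; exact hlcp.ne'
  have hposh : ∀ (σ : ℚ →+* ℝ) (x : ℝ), 0 < (h.map σ).eval x := by
    intro σ x
    have hσ : σ = algebraMap ℚ ℝ := Subsingleton.elim _ _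
    subst hσ
    have h1 := hb x
    rw [hh, hA2, Polynomial.map_sub, eval_sub, Polynomial.map_mul, Polynomial.map_pow, Polynomial.map_add, Polynomial.map_pow, map_X, map_C, map_C, eval_mul, eval_pow, eval_add, eval_pow, eval_X, eval_C, eval_C, map_pow, map_inv₀, map_ofNat, map_one]
    have hx2 : 0 ≤ x ^ 2 := sq_nonneg x
    have h2 : (x ^ m) ^ 2 ≤ (1 + x ^ 2) ^ m := by
      rw [← pow_mul, mul_comm, pow_mul]
      exact pow_le_pow_left₀ hx2 (by linarith) m
    have h3 : 1 ≤ (1 + x ^ 2) ^ m := one_le_pow₀ (by linarith)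
    have h4 : (x ^ m + 1) ^ 2 ≤ 4 * (1 + x ^ 2) ^ m := by nlinarith [sq_nonneg (x ^ m - 1)]
    have h5 : (4:ℝ)⁻¹ ^ k * (x ^ m + 1) ^ 2 ≤ (4:ℝ)⁻¹ ^ k * (4 * (1 + x ^ 2) ^ m) := mul_le_mul_of_nonneg_left h4 (by positivity)
    have h6 : (4:ℝ)⁻¹ ^ k * (4 * (1 + x ^ 2) ^ m) < ε / 4 * (4 * (1 + x ^ 2) ^ m) := mul_lt_mul_of_pos_right hk1' (by positivity)
    linarith
  have hR4 : IsR4 h := by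
    refine pr_D4 (algebraMap ℚ ℝ) h h0 (by rw [hlc]; exact pr_rat_four _ hlcp.le) ?_
    intro π hπ hπh
    obtain ⟨K, _, _, _, θ, hθ, -, hs1, hs2, -⟩ := exists_adj' π hπ
    apply levtwo_of π θ hs1 hs2
    have hθh : aeval θ h = 0 := by
      obtain ⟨r, hr⟩ := hπh
      rw [hr, map_mul, hθ, zero_mul]
    apply levelA (tc_of θ h hθh hposh)
    intro v hv
    have hE : 0 < od v (2:K) := lt_of_le_of_ne (od_two_nonneg v) (Ne.symm hv)
    have hr2 : od v (2:K) = ram ℚ v * od (und ℚ v) (2:ℚ) := by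
      rw [← od_alg, map_ofNat]
    have hu : und ℚ v = v2 := by
      apply hv2.2.2
      intro h0'; rw [h0', mul_zero] at hr2; exact hv hr2
    rw [hu, h22, mul_one] at hr2
    refine even_local v hE ((C ((4:ℚ) ^ k) * f).map (algebraMap ℚ K)) m ?_ hme hm0 ?_ θ ?_
    · rw [natDegree_map]; exact (natDegree_C_mul_le _ _).trans hm.le
    · intro j
      rw [coeff_map, hr2, mul_comm]
      apply OG_alg
      rw [hu, coeff_C_mul]
      have h1 : od v2 ((4:ℚ) ^ k) = 2 * k := by rw [od_pow, od_four, h22]; ring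
      refine ((od_OG v2 ((4:ℚ) ^ k)).mul (hCb j)).mono ?_
      rw [h1]; omega
    · rw [eval_map, ← aeval_def, map_mul, aeval_C]
      rw [hh, hA2, map_sub, sub_eq_zero] at hθh
      rw [hθh]
      simp only [map_mul, map_pow, map_add, aeval_C, aeval_X, map_one]
      rw [← mul_assoc, ← mul_pow, ← _root_.map_mul]
      norm_num
  apply pr_five_of_R4 ℚ (by simp) f 1 A one_ne_zero
  have e : ∀ φ : ℚ →+* ℚ, f.map φ = f := fun φ => by rw [Subsingleton.elim φ (RingHom.id ℚ), Polynomial.map_id]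
  rw [e, one_pow, mul_one]
  exact hR4
end

section
open Polynomial
set_option linter.all false
open IsDedekindDomain NumberField

section N
variable {F : Type} [Field F] [NumberField F] {v : Pl F}

theorem newton {M : Type} [Field M] [NumberField M] [Algebra F M] (w : Pl M) (P : F[X]) (n : ℕ) (hn : 0 < n)
    (hd : P.natDegree ≤ n) (h0 : P.coeff 0 ≠ 0) (hPn : P.coeff n ≠ 0)
    (hi : ∀ i : ℕ, 0 < i → i < n → ∃ X : ℤ, OG (und F w) X (P.coeff i) ∧
      ((n:ℤ) - i) * od (und F w) (P.coeff 0) + i * od (und F w) (P.coeff n) < n * X)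
    (z : M) (hz : aeval z P = 0) :
    (n:ℤ) * od w z = ram F w * (od (und F w) (P.coeff 0) - od (und F w) (P.coeff n)) := by
  have hinj : Function.Injective (algebraMap F M) := (algebraMap F M).injective
  have hz0 : z ≠ 0 := by
    rintro rfl
    rw [aeval_def, eval₂_at_zero] at hz
    exact h0 ((map_eq_zero _).1 hz)
  set E : ℤ := (ram F w : ℤ) with hE
  have hE0 : 0 < E := by rw [hE]; exact_mod_cast ram_pos (K := F) w
  set α := od (und F w) (P.coeff 0) with hα
  set β := od (und F w) (P.coeff n) with hβ
  have hn' : (0:ℤ) < n := by exact_mod_cast hn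
  have hsum : ∑ i ∈ Finset.range (n + 1), algebraMap F M (P.coeff i) * z ^ i = 0 := by
    rw [aeval_eq_sum_range' (Nat.lt_succ_of_le hd)] at hz
    rw [← hz]
    exact Finset.sum_congr rfl fun i _ => by rw [Algebra.smul_def]
  have hdom : ∀ i0 ∈ Finset.range (n + 1), P.coeff i0 ≠ 0 →
      (∀ i ∈ Finset.range (n + 1), i ≠ i0 → OG w (E * od (und F w) (P.coeff i0) + i0 * od w z + 1) (algebraMap F M (P.coeff i) * z ^ i)) → False := by
    intro i0 hi0 hne hall
    have hne' : algebraMap F M (P.coeff i0) * z ^ i0 ≠ 0 := mul_ne_zero (by simpa using hne) (pow_ne_zero _ hz0)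
    rw [← Finset.add_sum_erase _ _ hi0] at hsum
    refine (od_add_eq w hne' (y := ∑ i ∈ (Finset.range (n + 1)).erase i0, algebraMap F M (P.coeff i) * z ^ i) ?_).1 hsum
    rw [od_mul w (by simpa using hne) (pow_ne_zero _ hz0), od_alg, od_pow]
    apply OG.sum
    intro i hi
    rw [Finset.mem_erase] at hi
    exact hall i hi.2 hi.1
  have hterm : ∀ i X, OG (und F w) X (P.coeff i) → OG w (E * X + i * od w z) (algebraMap F M (P.coeff i) * z ^ i) := by
    intro i X hX
    exact (OG_alg w hX).mul ((od_OG w z).pow i)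
  have hlarge : ∀ a b : ℤ, n * a < n * b → a + 1 ≤ b := by
    intro a b hab
    have := lt_of_mul_lt_mul_left hab hn'.le
    omega
  rcases lt_trichotomy ((n:ℤ) * od w z) (E * (α - β)) with h | h | h
  · exfalso
    apply hdom n (by simp) hPn
    intro i hi' hin
    rw [Finset.mem_range] at hi'
    rcases Nat.eq_zero_or_pos i with rfl | hi0
    · refine (hterm 0 α (od_OG _ _)).mono ?_
      rw [← hβ]
      push_cast; nlinarith
    · obtain ⟨X, hX, hlt⟩ := hi i hi0 (by omega)
      refine (hterm i X hX).mono ?_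
      rw [← hβ]
      apply hlarge
      have h1 : (0:ℤ) ≤ (n:ℤ) - i := by omega
      have h2 := mul_le_mul_of_nonneg_left h.le h1
      have h3 := mul_lt_mul_of_pos_left hlt hE0
      linarith
  · exact h
  · exfalso
    apply hdom 0 (by simp) h0
    intro i hi' hin
    rw [Finset.mem_range] at hi'
    rcases Nat.lt_or_ge i n with hi1 | hi1
    · obtain ⟨X, hX, hlt⟩ := hi i (by omega) hi1
      refine (hterm i X hX).mono ?_
      rw [← hα]
      apply hlarge
      have h1 : (0:ℤ) ≤ (i:ℤ) := by omega
      have h2 := mul_le_mul_of_nonneg_left h.le h1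
      have h3 := mul_lt_mul_of_pos_left hlt hE0
      push_cast
      linarith
    · obtain rfl : i = n := by omega
      refine (hterm i β (od_OG _ _)).mono ?_
      rw [← hα]
      push_cast
      linarith

theorem exists_root_resid (h : Good F v) (M : ℕ) (hM : 0 < M)
    (hQ : (Nat.card (𝓞 F ⧸ v.asIdeal)ˣ).Coprime M) (η : F) (hη0 : η ≠ 0) (hη : od v η = 0) :
    ∃ ν : 𝓞 F, (ν : F) ≠ 0 ∧ od v (ν : F) = 0 ∧ OG v 1 (η / (ν : F) ^ (2 * M) - 1) := by
  letI : Field (𝓞 F ⧸ v.asIdeal) := Ideal.Quotient.field _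
  haveI := finite_quot v
  haveI := charTwo_quot h
  obtain ⟨a, d, hd, had⟩ := exists_num_den v ((OG_iff v hη0).2 hη.ge)
  have hd' := od_eq_zero_of_notMem v hd
  have ha0 : (a : F) ≠ 0 := by rw [← had]; exact mul_ne_zero hη0 hd'.1
  have ha1 : od v (a : F) = 0 := by rw [← had, od_mul v hη0 hd'.1, hη, hd'.2, add_zero]
  have ham : a ∉ v.asIdeal := by
    rw [← OG_one_iff_mem, OG_iff _ ha0, ha1]; omega
  have hka : Ideal.Quotient.mk v.asIdeal a ≠ 0 := by rwa [Ne, Ideal.Quotient.eq_zero_iff_mem]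
  have hkd : Ideal.Quotient.mk v.asIdeal d ≠ 0 := by rwa [Ne, Ideal.Quotient.eq_zero_iff_mem]
  obtain ⟨s, hs⟩ := FiniteField.isSquare_of_char_two (F := 𝓞 F ⧸ v.asIdeal) (ringChar.eq _ 2)
    (Ideal.Quotient.mk v.asIdeal a / Ideal.Quotient.mk v.asIdeal d)
  have hs0 : s ≠ 0 := by
    rintro rfl
    rw [zero_mul] at hs
    exact div_ne_zero hka hkd hs
  obtain ⟨x, hx⟩ := (powCoprime hQ).surjective (Units.mk0 s hs0)
  have hx' : (x : 𝓞 F ⧸ v.asIdeal) ^ M = s := by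
    have := congrArg Units.val hx
    simpa using this
  obtain ⟨ν, hν⟩ := Ideal.Quotient.mk_surjective (x : 𝓞 F ⧸ v.asIdeal)
  have hνm : ν ∉ v.asIdeal := by
    rw [← Ideal.Quotient.eq_zero_iff_mem, hν]; exact x.ne_zero
  have hν' := od_eq_zero_of_notMem v hνm
  refine ⟨ν, hν'.1, hν'.2, ?_⟩
  have hmem : a - d * ν ^ (2 * M) ∈ v.asIdeal := by
    rw [← Ideal.Quotient.eq_zero_iff_mem, map_sub, map_mul, map_pow, hν, mul_comm 2 M, pow_mul, hx', pow_two, ← hs]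
    field_simp
    ring
  rw [← OG_one_iff_mem] at hmem
  have e : η / (ν : F) ^ (2 * M) - 1 = ((a - d * ν ^ (2 * M) : 𝓞 F) : F) * ((d : F) * (ν : F) ^ (2 * M))⁻¹ := by
    have e1 : ((a - d * ν ^ (2 * M) : 𝓞 F) : F) = (a : F) - (d : F) * (ν : F) ^ (2 * M) := by push_cast; rfl
    have := hν'.1
    have := hd'.1
    rw [e1, ← had]
    field_simp
  rw [e]
  have := hmem.mul (od_OG v ((d : F) * (ν : F) ^ (2 * M))⁻¹)
  rwa [od_inv, od_mul v hd'.1 (pow_ne_zero _ hν'.1), od_pow, hd'.2, hν'.2, mul_zero, add_zero, neg_zero, add_zero] at this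

theorem choose_u (h : Good F v) (M : ℕ) (hM : 0 < M) (hQ : (Nat.card (𝓞 F ⧸ v.asIdeal)ˣ).Coprime M)
    (D G : F) (hD0 : D ≠ 0) (hG : G = 0 ∨ od v D < 2 * od v G + od v (2:F)) (k : ℕ) (r : ℤ)
    (hr : od v D - od v (2:F) + 2 * k * od v (2:F) = 2 * M * r) (hr0 : 0 ≤ r) (T : F[X]) (hT0 : T.coeff 0 = G ^ 2 + D)
    (hT : ∀ j, OG v (od v D + 1 - r) (T.coeff (j + 1))) :
    ∃ y Y μ : F, Y ≠ 0 ∧ OG v 1 μ ∧ T.eval y - (G + (2:F)⁻¹ ^ k * y ^ M) ^ 2 = Y ^ 2 * (1 + 2 * μ) := by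
  obtain ⟨p, hp0, hp1⟩ := exists_unif' v
  have h2 := two_ne F
  set e := od v (2:F) with he
  set Y0 : F := (2:F)⁻¹ ^ k * (p ^ r) ^ M with hY0
  have hY00 : Y0 ≠ 0 := mul_ne_zero (pow_ne_zero _ (inv_ne_zero h2)) (pow_ne_zero _ (zpow_ne_zero _ hp0))
  have hY0od : 2 * od v Y0 = od v D - e := by
    rw [hY0, od_mul v (pow_ne_zero _ (inv_ne_zero h2)) (pow_ne_zero _ (zpow_ne_zero _ hp0)), od_pow, od_pow, od_inv, od_zpow, hp1, ← he]
    linarith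
  have hη0 : D / (2 * Y0 ^ 2) ≠ 0 := div_ne_zero hD0 (mul_ne_zero h2 (pow_ne_zero _ hY00))
  obtain ⟨ν, hν0, hν, hη⟩ := exists_root_resid h M hM hQ (D / (2 * Y0 ^ 2)) hη0 (by
    rw [od_div v hD0 (mul_ne_zero h2 (pow_ne_zero _ hY00)), od_mul v h2 (pow_ne_zero _ hY00), od_pow, ← he]
    push_cast; linarith)
  set y : F := p ^ r * ν with hy
  set Y : F := (2:F)⁻¹ ^ k * y ^ M with hY
  have hYY : Y = Y0 * (ν : F) ^ M := by rw [hY, hY0, hy, mul_pow]; ring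
  have hYne : Y ≠ 0 := by rw [hYY]; exact mul_ne_zero hY00 (pow_ne_zero _ hν0)
  have hYod : 2 * od v Y = od v D - e := by
    rw [hYY, od_mul v hY00 (pow_ne_zero _ hν0), od_pow, hν, mul_zero, add_zero, hY0od]
  have hyod : OG v r y := by
    have := (od_OG v (p ^ r)).mul (od_OG v (ν : F))
    rwa [od_zpow, hp1, hν, mul_one, add_zero] at this
  have hD2 : OG v 1 (D / (2 * Y ^ 2) - 1) := by
    have e1 : D / (2 * Y ^ 2) = D / (2 * Y0 ^ 2) / (ν : F) ^ (2 * M) := by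
      rw [hYY]; field_simp
      ring
    rw [e1]; exact hη
  set S := y * T.divX.eval y with hS
  have hTS : T.eval y = G ^ 2 + D + S := by
    conv_lhs => rw [← divX_mul_X_add T]
    rw [eval_add, eval_mul, eval_X, eval_C, hT0, hS]; ring
  have hSO : OG v (od v D + 1) S := by
    have h1 : OG v (od v D + 1 - r) (T.divX.eval y) := by
      rw [eval_eq_sum_range]
      apply OG.sum
      intro j _
      rw [coeff_divX]
      refine ((hT j).mul (hyod.pow j)).mono ?_
      have : 0 ≤ (j:ℤ) * r := by positivity
      linarith
    refine (hyod.mul h1).mono ?_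
    linarith
  have hod2 : od v (2 * Y ^ 2)⁻¹ = - od v D := by
    rw [od_inv, od_mul v h2 (pow_ne_zero _ hYne), od_pow, ← he]; push_cast; linarith
  have hS2 : OG v 1 (S * (2 * Y ^ 2)⁻¹) := by
    refine (hSO.mul (od_OG v _)).mono ?_
    rw [hod2]; linarith
  have hG2 : OG v 1 (G * Y⁻¹) := by
    rcases hG with rfl | hG
    · rw [zero_mul]; exact OG_zero _ _
    · refine ((od_OG v G).mul (od_OG v _)).mono ?_
      rw [od_inv]; omega
  refine ⟨y, Y, (D / (2 * Y ^ 2) - 1) + S * (2 * Y ^ 2)⁻¹ - G * Y⁻¹, hYne, (hD2.add hS2).sub hG2, ?_⟩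
  rw [← hY, hTS]
  field_simp
  ring
end N
end

section
open Polynomial
set_option linter.all false
open IsDedekindDomain NumberField

section Core
variable {F : Type} [Field F] [NumberField F] {v : Pl F}

theorem core_norm (hv : Good F v) (c κ : ℚ) (hκ : InE (κ - c)) (Y μ ν : F) (hY : Y ≠ 0) (hμ : OG v 1 μ)
    (h : algebraMap ℚ F (c - κ) * ν = Y ^ 2 * (1 + 2 * μ)) : InE (- Algebra.norm ℚ ν) := by
  have h1 : InE (Algebra.norm ℚ (1 + 2 * μ)) := norm_one_add_two hv.2.2 hv.two_pos.ne' hμ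
  have hN := congrArg (Algebra.norm ℚ) h
  rw [_root_.map_mul, _root_.map_mul, Algebra.norm_algebraMap, _root_.map_pow] at hN
  have hY' : Algebra.norm ℚ Y ≠ 0 := Algebra.norm_ne_zero_iff.2 hY
  have hκ0 := hκ.ne
  have hc : (c - κ) = - (κ - c) := by ring
  rw [hc, hv.1.neg_pow] at hN
  have e : - Algebra.norm ℚ ν = (Algebra.norm ℚ Y) ^ 2 * Algebra.norm ℚ (1 + 2 * μ) * ((κ - c) ^ Module.finrank ℚ F)⁻¹ := by
    rw [← hN]; field_simp
  rw [e]
  exact ((InE_sq hY').mul h1).mul (hκ.pow _).inv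

theorem core_newton {K : Type} [Field K] [NumberField K] [Algebra F K] (hv : Good F v)
    (M : ℕ) (hM0 : 0 < M) (T : F[X]) (hdT : T.natDegree ≤ 2 * M)
    (D G q : F) (hD0 : D ≠ 0) (hG : G = 0 ∨ od v D < 2 * od v G + od v (2:F))
    (hT0 : T.coeff 0 = G ^ 2 + D) (k : ℕ) (hq0 : q ≠ 0) (hq : od v q = - (k * od v (2:F)))
    (Cst : ℕ) (hC : ∀ j, OG v (-(Cst:ℤ)) (T.coeff j)) (hk : (M:ℤ) * (Cst + |od v D|) + 1 ≤ k)
    (w : Pl K) (hw : und F w = v) (z : K) (hz : aeval z (T - (C G + C q * X ^ M) ^ 2) = 0) :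
    (2 * M : ℤ) * od w z = ram F w * (od v D + 2 * k * od v (2:F)) := by
  subst hw
  set v := und F w with hvdef
  set e := od v (2:F) with he
  have he0 : 0 < e := hv.two_pos
  have hMZ : (1:ℤ) ≤ M := by exact_mod_cast hM0
  have hab := le_abs_self (od v D)
  have hab0 := abs_nonneg (od v D)
  have hCk : (Cst:ℤ) + 1 ≤ k := by nlinarith
  have hek : (k:ℤ) ≤ k * e := by nlinarith
  have ex : (T - (C G + C q * X ^ M) ^ 2) = T - C (G ^ 2) - C (2 * G * q) * X ^ M - C (q ^ 2) * X ^ (2 * M) := by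
    simp only [C_mul, C_pow]
    rw [show (C (2:F)) = (2 : F[X]) from map_ofNat C 2]; ring
  set P := (T - (C G + C q * X ^ M) ^ 2) with hP
  have hco : ∀ i, P.coeff i = T.coeff i - (if i = 0 then G ^ 2 else 0) - (if i = M then 2 * G * q else 0) - (if i = 2 * M then q ^ 2 else 0) := by
    intro i
    rw [ex]
    simp only [coeff_sub, coeff_C_mul_X_pow, coeff_C]
  have hP0 : P.coeff 0 = D := by
    rw [hco, hT0, if_pos rfl, if_neg (by omega), if_neg (by omega)]; ring
  have hPn : P.coeff (2 * M) = -q ^ 2 + T.coeff (2 * M) := by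
    rw [hco, if_neg (by omega), if_neg (by omega), if_pos rfl]; ring
  have hq2 : od v (-q ^ 2) = -(2 * k * e) := by
    rw [od_neg, od_pow, hq]; push_cast; ring
  have hod := od_add_eq v (x := -q ^ 2) (y := T.coeff (2 * M)) (neg_ne_zero.2 (pow_ne_zero _ hq0)) ((hC _).mono (by rw [hq2]; linarith))
  rw [← hPn, hq2] at hod
  have key := newton w P (2 * M) (by omega) ?_ (by rwa [hP0]) hod.1 ?_ z hz
  · rw [← hvdef, hP0, hod.2] at key
    push_cast at key
    rw [key]; ring
  · rw [ex]
    refine (natDegree_sub_le _ _).trans (max_le ((natDegree_sub_le _ _).trans (max_le ((natDegree_sub_le _ _).trans (max_le hdT ?_)) ?_)) ?_)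
    · simp
    · exact (natDegree_C_mul_X_pow_le _ _).trans (by omega)
    · exact natDegree_C_mul_X_pow_le _ _
  · intro i hi hi2
    rw [← hvdef, hP0, hod.2]
    have hi' : (1:ℤ) ≤ i := by exact_mod_cast hi
    have hi2' : (i:ℤ) < 2 * M := by exact_mod_cast hi2
    have hfar : (((2 * M : ℕ) : ℤ) - i) * od v D + i * -(2 * k * e) < ((2 * M : ℕ) : ℤ) * (-(Cst : ℤ)) := by
      push_cast
      have h1 : (2 * (M:ℤ) - i) * od v D ≤ 2 * M * |od v D| := by
        have : (2 * (M:ℤ) - i) * od v D ≤ (2 * (M:ℤ) - i) * |od v D| := mul_le_mul_of_nonneg_left hab (by linarith)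
        nlinarith
      have h2 : 2 * (k:ℤ) ≤ i * (2 * k * e) := by
        have : (1:ℤ) * (2 * k) ≤ i * (2 * k * e) := mul_le_mul hi' (by linarith) (by linarith) (by linarith)
        linarith
      linarith
    by_cases hiM : i = M
    · rcases hG with hG | hG
      · refine ⟨-(Cst:ℤ), ?_, hfar⟩
        rw [hco, if_neg (by omega), if_neg (c := i = 2 * M) (by omega), hG]
        simpa using hC i
      · subst hiM
        have h3 : (((2 * i : ℕ) : ℤ) - i) * od v D + i * -(2 * k * e) < ((2 * i : ℕ) : ℤ) * (e + od v G - k * e) := by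
          push_cast
          have : (i:ℤ) * od v D < i * (2 * od v G + 2 * e) := mul_lt_mul_of_pos_left (by linarith) (by linarith)
          linarith
        refine ⟨min (-(Cst:ℤ)) (e + od v G - k * e), ?_, ?_⟩
        · rw [hco, if_neg (by omega), if_pos rfl, if_neg (by omega), sub_zero, sub_zero]
          refine ((hC i).mono (min_le_left _ _)).sub (OG.mono ?_ (min_le_right _ _))
          refine (((od_OG v (2:F)).mul (od_OG v G)).mul (od_OG v q)).mono ?_
          rw [hq]; linarith
        · rcases min_choice (-(Cst:ℤ)) (e + od v G - k * e) with h | h <;> rw [h] <;> assumption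
    · refine ⟨-(Cst:ℤ), ?_, hfar⟩
      rw [hco, if_neg (by omega), if_neg hiM, if_neg (by omega)]
      simpa using hC i

theorem coreF (hv : Good F v) (P : F[X]) (M : ℕ) (hM : Odd M) (hdP : P.natDegree = 2 * M) (c : ℚ) (hlc : P.leadingCoeff = algebraMap ℚ F c)
    (t G : F) (k : ℕ) (hck : 0 < c - (4:ℚ)⁻¹ ^ k) (hcE : InE ((4:ℚ)⁻¹ ^ k - c))
    (hD0 : P.eval t - G ^ 2 ≠ 0)
    (hG : G = 0 ∨ od v (P.eval t - G ^ 2) < 2 * od v G + od v (2:F))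
    (Cst : ℕ) (hC : ∀ j, OG v (-(Cst:ℤ)) ((P.comp (X + C t)).coeff j)) (hk : (M:ℤ) * (Cst + |od v (P.eval t - G ^ 2)|) + 1 ≤ k)
    (r : ℤ) (hr : od v (P.eval t - G ^ 2) - od v (2:F) + 2 * k * od v (2:F) = 2 * M * r) (hr0 : Cst + |od v (P.eval t - G ^ 2)| + 1 ≤ r)
    (hMe : IsCoprime (M:ℤ) (od v (2:F))) (hQ : (Nat.card (𝓞 F ⧸ v.asIdeal)ˣ).Coprime M)
    (hpos : ∀ (σ : F →+* ℝ) (x : ℝ), 0 < ((P - (C G + C ((2:F)⁻¹ ^ k) * (X - C t) ^ M) ^ 2).map σ).eval x) :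
    IsR4 (P - (C G + C ((2:F)⁻¹ ^ k) * (X - C t) ^ M) ^ 2) := by
  set D := P.eval t - G ^ 2 with hD
  set q : F := (2:F)⁻¹ ^ k with hq
  have h2 := two_ne F
  have hM0 : 0 < M := hM.pos
  have hq0 : q ≠ 0 := pow_ne_zero _ (inv_ne_zero h2)
  have hqod : od v q = - (k * od v (2:F)) := by rw [hq, od_pow, od_inv]; ring
  have hq2 : q ^ 2 = algebraMap ℚ F ((4:ℚ)⁻¹ ^ k) := by
    rw [hq, ← pow_mul, mul_comm, pow_mul, _root_.map_pow, _root_.map_inv₀, map_ofNat]; norm_num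
  set h := P - (C G + C q * (X - C t) ^ M) ^ 2 with hh
  set T := P.comp (X + C t) with hT
  have hdX : (X + C t : F[X]).natDegree = 1 := natDegree_X_add_C t
  have hdT : T.natDegree = 2 * M := by rw [hT, natDegree_comp, hdX, mul_one, hdP]
  have hT0 : T.coeff 0 = G ^ 2 + D := by
    rw [hT, coeff_zero_eq_eval_zero, eval_comp]; simp [hD]
  have hXt : ((X - C t : F[X]) ^ M).natDegree = M := by rw [natDegree_pow, natDegree_X_sub_C, mul_one]
  have hXm : ((X - C t : F[X]) ^ M).Monic := (monic_X_sub_C t).pow M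
  have hAn : (C G + C q * (X - C t) ^ M).natDegree ≤ M := by
    refine (natDegree_add_le _ _).trans (max_le (by simp) ((natDegree_C_mul_le _ _).trans hXt.le))
  have hAc : (C G + C q * (X - C t) ^ M).coeff M = q := by
    rw [coeff_add, coeff_C, if_neg hM0.ne', coeff_C_mul]
    have := hXm.coeff_natDegree
    rw [hXt] at this
    rw [this]; ring
  have hco : h.coeff (2 * M) = algebraMap ℚ F (c - (4:ℚ)⁻¹ ^ k) := by
    have h3 : ((C G + C q * (X - C t) ^ M) ^ 2).coeff (2 * M) = q ^ 2 := by
      rw [coeff_pow_of_natDegree_le hAn, hAc]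
    rw [hh, coeff_sub, h3, ← hdP, coeff_natDegree, hlc, hq2, _root_.map_sub]
  have hck0 : algebraMap ℚ F (c - (4:ℚ)⁻¹ ^ k) ≠ 0 := by
    rw [Ne, map_eq_zero]; exact hck.ne'
  have hdh : h.natDegree = 2 * M := by
    apply le_antisymm
    · refine (natDegree_sub_le _ _).trans (max_le hdP.le ?_)
      exact natDegree_pow_le.trans (by omega)
    · apply le_natDegree_of_ne_zero; rw [hco]; exact hck0
  have hlch : h.leadingCoeff = algebraMap ℚ F (c - (4:ℚ)⁻¹ ^ k) := by rw [leadingCoeff, hdh, hco]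
  have h0 : h ≠ 0 := by rw [← leadingCoeff_ne_zero, hlch]; exact hck0
  obtain ⟨φ⟩ := exists_real_emb F hv.1
  refine pr_D4 φ h h0 (by rw [hlch]; exact (pr_rat_four _ hck.le).map _) ?_
  intro π hπ hπh
  obtain ⟨K, _, _, _, θ, hθ, hfin, hs1, hs2, hnorm⟩ := exists_adj' π hπ
  apply levtwo_of π θ hs1 hs2
  obtain ⟨s, hs⟩ := hπh
  have hθh : aeval θ h = 0 := by rw [hs, _root_.map_mul, hθ, zero_mul]
  have hs0 : s ≠ 0 := by rintro rfl; rw [mul_zero] at hs; exact h0 hs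
  have hdeg : π.natDegree + s.natDegree = 2 * M := by rw [← natDegree_mul hπ.ne_zero hs0, ← hs, hdh]
  have hroot : aeval (θ - algebraMap F K t) (T - (C G + C q * X ^ M) ^ 2) = 0 := by
    rw [← hθh, hh, _root_.map_sub, _root_.map_sub, hT, aeval_comp]
    simp
  have he0 := hv.two_pos
  have hram : ∀ w : Pl K, und F w = v → 2 * M ≤ ram F w := by
    intro w hw
    have key := core_newton hv M hM0 T hdT.le D G q hD0 hG hT0 k hq0 hqod Cst hC hk w hw _ hroot
    have e1 : od v D + 2 * k * od v (2:F) = od v (2:F) + (2 * M) * r := by linarith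
    rw [e1] at key
    have hcop : IsCoprime (2 * M : ℤ) (od v (2:F) + (2 * M) * r) := by
      rw [IsCoprime.add_mul_left_right_iff]
      refine IsCoprime.mul_left ?_ hMe
      obtain ⟨b, hb⟩ := hv.2.1
      exact ⟨-b, 1, by rw [hb]; ring⟩
    have hdvd : (2 * M : ℤ) ∣ ram F w := hcop.dvd_of_dvd_mul_right (Dvd.intro _ key)
    have : 2 * M ∣ ram F w := by exact_mod_cast hdvd
    exact Nat.le_of_dvd (ram_pos w) this
  obtain ⟨hf1, w, hw, huniq, -⟩ := TR0 (M := K) v (2 * M) (by omega) (by omega) (fun w hw =>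
    (hram w hw).trans (Nat.le_mul_of_pos_right _ (inert_pos w)))
  have hs00 : s.natDegree = 0 := by omega
  obtain ⟨a, rfl⟩ := natDegree_eq_zero.1 hs00
  have hod2 : ∀ w' : Pl K, od w' (2:K) = ram F w' * od (und F w') (2:F) := fun w' => by
    rw [← od_alg, map_ofNat]
  have hw0 : od w (2:K) ≠ 0 := by
    rw [hod2, hw]
    have := ram_pos (K := F) w
    positivity
  have hw1 : ∀ w' : Pl K, od w' (2:K) ≠ 0 → w' = w := by
    intro w' hw'
    apply huniq
    apply hv.2.2
    intro h'
    apply hw'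
    rw [hod2, h', mul_zero]
  have hab := le_abs_self (od v D)
  have hab0 := abs_nonneg (od v D)
  obtain ⟨y, Y, μ, hY, hμ, hyY⟩ := choose_u hv M hM0 hQ D G hD0 hG k r hr (by linarith) T hT0 (fun j => (hC (j+1)).mono (by linarith))
  have hN : algebraMap ℚ F (c - (4:ℚ)⁻¹ ^ k) * Algebra.norm F (algebraMap F K (y + t) - θ) = Y ^ 2 * (1 + 2 * μ) := by
    have h1 := hnorm (y + t)
    rw [← hlch, hs, leadingCoeff_mul, leadingCoeff_C, mul_right_comm, h1, ← hyY]
    have h3 : h.eval (y + t) = π.eval (y + t) * a := by rw [hs, eval_mul, eval_C]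
    rw [← h3, hh, hT, eval_comp]
    simp [hq]
  have hE := core_norm hv c _ hcE Y μ _ hY hμ hN
  haveI : IsScalarTower ℚ F K := IsScalarTower.rat
  rw [Algebra.norm_norm] at hE
  refine levelB (tc_of θ h hθh hpos) hw0 hw1 (algebraMap F K (y + t) - θ) ?_ hE
  intro h'
  rw [h', Algebra.norm_zero, neg_zero] at hE
  exact hE.ne rfl
end Core
end

section
open Polynomial
set_option linter.all false
open IsDedekindDomain NumberField

theorem real_bd (ε y g q x τ S : ℝ) (M : ℕ) (hy : ε * (1 + x ^ 2) ^ M ≤ y) (hg : 4 * g ^ 2 < ε) (hτ : 2 * (1 + τ ^ 2) ≤ S)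
    (hq : 4 * (q ^ 2 * S ^ M) < ε) : 0 < y - (g + q * (x - τ) ^ M) ^ 2 := by
  have h1 : (x - τ) ^ 2 ≤ S * (1 + x ^ 2) := by
    have : (x - τ) ^ 2 ≤ 2 * (1 + τ ^ 2) * (1 + x ^ 2) := by nlinarith [sq_nonneg (x + τ), sq_nonneg (x * τ)]
    have : 2 * (1 + τ ^ 2) * (1 + x ^ 2) ≤ S * (1 + x ^ 2) := mul_le_mul_of_nonneg_right hτ (by positivity)
    linarith
  have h2 : ((x - τ) ^ M) ^ 2 ≤ S ^ M * (1 + x ^ 2) ^ M := by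
    rw [← pow_mul, mul_comm, pow_mul, ← mul_pow]
    exact pow_le_pow_left₀ (sq_nonneg _) h1 M
  have h3 : 1 ≤ (1 + x ^ 2) ^ M := one_le_pow₀ (by nlinarith [sq_nonneg x])
  have h4 : (q * (x - τ) ^ M) ^ 2 ≤ q ^ 2 * S ^ M * (1 + x ^ 2) ^ M := by
    rw [mul_pow, mul_assoc]
    exact mul_le_mul_of_nonneg_left h2 (sq_nonneg _)
  have h5 : 4 * g ^ 2 * 1 ≤ 4 * g ^ 2 * (1 + x ^ 2) ^ M := mul_le_mul_of_nonneg_left h3 (by positivity)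
  have h6 : 4 * g ^ 2 * (1 + x ^ 2) ^ M < ε * (1 + x ^ 2) ^ M := mul_lt_mul_of_pos_right hg (by positivity)
  have h7 : 4 * (q ^ 2 * S ^ M) * (1 + x ^ 2) ^ M < ε * (1 + x ^ 2) ^ M := mul_lt_mul_of_pos_right hq (by positivity)
  have h8 : (g + q * (x - τ) ^ M) ^ 2 ≤ 2 * g ^ 2 + 2 * (q * (x - τ) ^ M) ^ 2 := by
    nlinarith [sq_nonneg (g - q * (x - τ) ^ M)]
  linarith

theorem emb_bd {F : Type} [Field F] [NumberField F] (x : F) : ∃ S : ℝ, 0 ≤ S ∧ ∀ σ : F →+* ℝ, (σ x) ^ 2 ≤ S := by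
  haveI : Finite (F →+* ℝ) := by
    refine Finite.of_injective (fun σ : F →+* ℝ => (Complex.ofRealHom.comp σ : F →+* ℂ)) ?_
    intro σ τ h
    ext y
    have := congrArg (fun φ : F →+* ℂ => φ y) h
    simpa using this
  obtain ⟨S, hS⟩ := (Set.finite_range (fun σ : F →+* ℝ => (σ x) ^ 2)).bddAbove
  exact ⟨max S 0, le_max_right _ _, fun σ => (hS ⟨σ, rfl⟩).trans (le_max_left _ _)⟩

theorem lc_E (c : ℚ) : ∃ k1 : ℕ, ∀ k, k1 ≤ k → InE ((4:ℚ)⁻¹ ^ k - c) := by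
  obtain ⟨n, b, hb, hn⟩ := exists_odd_part (a := (c.den : ℤ)) (by exact_mod_cast c.den_nz)
  refine ⟨n + 1, fun k hk => ?_⟩
  obtain ⟨j, rfl⟩ := Nat.exists_eq_add_of_le hk
  have hb0 : (b:ℚ) ≠ 0 := by
    rintro h
    have : b = 0 := by exact_mod_cast h
    subst this; simp at hb
  have hden : (c.den : ℚ) = 2 ^ n * b := by exact_mod_cast congrArg (Int.cast : ℤ → ℚ) hn
  have hc : c = c.num / (2 ^ n * b) := by rw [← hden]; exact (Rat.num_div_den c).symm
  have e : (4:ℚ)⁻¹ ^ (n + 1 + j) - c = (2⁻¹ ^ 2) ^ (n + 1 + j) * (((b - 4 * (c.num * 2 ^ n * 4 ^ j) : ℤ) : ℚ) / (b : ℤ)) := by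
    conv_lhs => rw [hc]
    push_cast
    have e4 : (4:ℚ) ^ n = 2 ^ n * 2 ^ n := by rw [← mul_pow]; norm_num
    have e3 : (2⁻¹ ^ 2 : ℚ) = 4⁻¹ := by norm_num
    rw [e3]
    simp only [inv_pow, pow_add, e4, pow_one]
    field_simp
  rw [e]
  refine ((InE_sq (by norm_num)).pow _).mul (InE_odd ?_ hb ?_)
  · have : Even (4 * (c.num * 2 ^ n * 4 ^ j)) := ⟨2 * (c.num * 2 ^ n * 4 ^ j), by ring⟩
    exact hb.sub_even this
  · exact ⟨-(c.num * 2 ^ n * 4 ^ j), by ring⟩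

/-- adjusting g -/
theorem adj_g {F : Type} [Field F] [NumberField F] {v : Pl F} (hv : Good F v) (y g : F) (hodd : Odd (od v (y - g ^ 2)))
    (hg : g = 0 ∨ od v (y - g ^ 2) < 2 * od v g + od v (2:F)) (b : F) (hb : b ≠ 0) (δ : ℝ) (hδ : 0 < δ) :
    ∃ G : F, Odd (od v (y * b ^ 2 - G ^ 2)) ∧ (G = 0 ∨ od v (y * b ^ 2 - G ^ 2) < 2 * od v G + od v (2:F)) ∧
      ∀ σ : F →+* ℝ, (σ G) ^ 2 < δ := by
  have h2 := two_ne F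
  have he := hv.two_pos
  have hD0 : y - g ^ 2 ≠ 0 := by intro h; rw [h, od_zero] at hodd; simp at hodd
  rcases eq_or_ne g 0 with rfl | hg0
  · refine ⟨0, ?_, Or.inl rfl, fun σ => by simpa using hδ⟩
    have e : y * b ^ 2 - 0 ^ 2 = (y - 0 ^ 2) * b ^ 2 := by ring
    rw [e, od_mul v hD0 (pow_ne_zero _ hb), od_pow]
    exact hodd.add_even (even_two_mul _)
  have hg := hg.resolve_left hg0
  obtain ⟨S, hS0, hS⟩ := emb_bd (g * b)
  obtain ⟨N1, hN1⟩ := exists_pow_small (δ / (S + 1)) (by positivity)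
  set N := N1 + (od v (y - g ^ 2)).natAbs + 2 * (od v g).natAbs + 1 with hN
  have hN1' := hN1 N (by omega)
  set e := od v (2:F) with hedef
  have hNe : (N:ℤ) ≤ N * e := by nlinarith
  have hu := od_add_eq v (x := (1:F)) (y := 2 ^ N) one_ne_zero (((od_OG v (2:F)).pow N).mono (by rw [od_one, ← hedef]; omega))
  rw [od_one] at hu
  set u : F := 1 + 2 ^ N with hudef
  set G : F := u⁻¹ * (g * b) with hG
  have hGod : od v G = od v g + od v b := by
    rw [hG, od_mul v (inv_ne_zero hu.1) (mul_ne_zero hg0 hb), od_mul v hg0 hb, od_inv, hu.2]; ring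
  have eD : y * b ^ 2 - G ^ 2 = ((y - g ^ 2) + 2 ^ N * ((u + 1) * (u⁻¹ ^ 2 * g ^ 2))) * b ^ 2 := by
    have : (2:F) ^ N = u - 1 := by rw [hudef]; ring
    have hu1 := hu.1
    rw [this, hG]
    field_simp
    ring
  have hOG : OG v (od v (y - g ^ 2) + 1) (2 ^ N * ((u + 1) * (u⁻¹ ^ 2 * g ^ 2))) := by
    have h1 : OG v 0 (u + 1) := by
      have a := od_OG v u
      have b := od_OG v (1:F)
      rw [hu.2] at a; rw [od_one] at b
      exact a.add b
    have h3 := ((od_OG v (2:F)).pow N).mul (h1.mul ((od_OG v (u⁻¹ ^ 2)).mul (od_OG v (g ^ 2))))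
    refine h3.mono ?_
    rw [od_pow, od_pow, od_inv, hu.2, ← hedef]
    push_cast
    omega
  have hs := od_add_eq v hD0 hOG
  have hodD : od v (y * b ^ 2 - G ^ 2) = od v (y - g ^ 2) + 2 * od v b := by
    rw [eD, od_mul v hs.1 (pow_ne_zero _ hb), hs.2, od_pow]; push_cast; ring
  refine ⟨G, ?_, Or.inr ?_, ?_⟩
  · rw [hodD]; exact hodd.add_even (even_two_mul _)
  · rw [hodD, hGod]; linarith
  · intro σ
    have h1 : σ u = 1 + 2 ^ N := by rw [hudef, map_add, map_one, map_pow, map_ofNat]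
    rw [hG, map_mul, map_inv₀, mul_pow, h1]
    have h3 : ((1 + 2 ^ N : ℝ)⁻¹) ^ 2 ≤ (4:ℝ)⁻¹ ^ N := by
      have h4 : (4:ℝ) ^ N = (2 ^ N) ^ 2 := by rw [← pow_mul, mul_comm, pow_mul]; norm_num
      rw [inv_pow, inv_pow, h4]
      apply inv_anti₀ (by positivity)
      exact pow_le_pow_left₀ (by positivity) (by linarith) 2
    have h5 : ((1 + 2 ^ N : ℝ)⁻¹) ^ 2 * (σ (g * b)) ^ 2 ≤ (4:ℝ)⁻¹ ^ N * S := mul_le_mul h3 (hS σ) (sq_nonneg _) (by positivity)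
    have h6 : (4:ℝ)⁻¹ ^ N * S ≤ (4:ℝ)⁻¹ ^ N * (S + 1) := mul_le_mul_of_nonneg_left (by linarith) (by positivity)
    have h7 : (4:ℝ)⁻¹ ^ N * (S + 1) < δ := by
      rwa [lt_div_iff₀ (by positivity)] at hN1'
    linarith

theorem choose_k (M : ℕ) (hM : 0 < M) (e : ℤ) (he : 0 < e) (hMe : IsCoprime (M:ℤ) e) (v1 : ℤ) (hv1 : Even (v1 - e)) (k0 : ℕ) (R : ℕ) :
    ∃ (k : ℕ) (r : ℤ), k0 ≤ k ∧ (R:ℤ) ≤ r ∧ v1 - e + 2 * k * e = 2 * M * r := by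
  obtain ⟨s, hs⟩ := hv1
  obtain ⟨a, b, hab⟩ := hMe
  have hMZ : (1:ℤ) ≤ M := by exact_mod_cast hM
  set L : ℤ := |s * b| + k0 + |s| + M * R with hL
  have hL0 : 0 ≤ L := by positivity
  have hk : |s| + k0 + M * R ≤ -(s * b) + M * L := by
    have h1 := le_abs_self (s * b)
    have : L ≤ M * L := by nlinarith
    linarith
  have h0 := abs_nonneg s
  have hMR : (0:ℤ) ≤ M * R := by positivity
  have hkk : ((-(s * b) + M * L).toNat : ℤ) = -(s * b) + M * L := Int.toNat_of_nonneg (by linarith)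
  refine ⟨(-(s * b) + M * L).toNat, s * a + e * L, ?_, ?_, ?_⟩
  · zify; rw [hkk]; linarith
  · have h1 : (M:ℤ) * (s * a + e * L) = s + (-(s * b) + M * L) * e := by linear_combination s * hab
    have h2 : (M:ℤ) * R ≤ M * (s * a + e * L) := by
      rw [h1]
      have h3 := neg_abs_le s
      have : (-(s * b) + M * L) ≤ (-(s * b) + M * L) * e := by nlinarith
      linarith
    exact le_of_mul_le_mul_left h2 (by linarith)
  · rw [hkk]; linear_combination hs - 2 * s * hab

theorem odd_case (f : ℚ[X]) (hpos : ∀ t : ℝ, 0 < aeval t f) (hsf : Squarefree f) (m : ℕ) (hm : f.natDegree = 2 * m) (hmo : Odd m) :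
    ∃ g : Fin 5 → ℚ[X], f = ∑ i, g i ^ 2 := by
  obtain ⟨F, _, _, i, v, t, g0, hv, hodd, hg⟩ := goal_rat f hsf (by rw [hm]; obtain ⟨j, rfl⟩ := hmo; omega)
  have hi : i = algebraMap ℚ F := Subsingleton.elim _ _
  rw [hi] at hodd hg
  have h2 := two_ne F
  have hfr : ∀ x, 0 < (f.map (algebraMap ℚ ℝ)).eval x := fun x => by rw [eval_map, ← aeval_def]; exact hpos x
  obtain ⟨ε, hε, hb⟩ := pos_bound (f.map (algebraMap ℚ ℝ)) hfr m (by rw [natDegree_map, hm])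
  have hc : 0 < f.leadingCoeff := by
    have := lc_pos_real _ hfr
    rw [leadingCoeff_map] at this
    simpa using this
  obtain ⟨φ⟩ := exists_real_emb F hv.1
  haveI := finite_quot v
  set Qc := Nat.card (𝓞 F ⧸ v.asIdeal)ˣ with hQc
  have hQ0 : 0 < Qc := Nat.card_pos
  set e := od v (2:F) with he
  have he0 : 0 < e := hv.two_pos
  obtain ⟨eN, heN⟩ := Int.eq_ofNat_of_zero_le he0.le
  have heN0 : 0 < eN := by omega
  set M := 1 + 2 * (m * eN * Qc) with hM
  have hmM : m ≤ m * eN * Qc := by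
    rw [mul_assoc]; exact Nat.le_mul_of_pos_right _ (Nat.mul_pos heN0 hQ0)
  obtain ⟨n, hn⟩ : ∃ n, M = m + 2 * n := by
    obtain ⟨j, hj⟩ := hmo
    exact ⟨m * eN * Qc - j, by omega⟩
  have hMo : Odd M := ⟨m * eN * Qc, by omega⟩
  have hMe : IsCoprime (M:ℤ) e := ⟨1, -(2 * (m * Qc)), by rw [heN, hM]; push_cast; ring⟩
  have hQM : Qc.Coprime M := by
    rw [Nat.coprime_comm, ← Nat.isCoprime_iff_coprime]
    exact ⟨1, -(2 * (m * eN)), by rw [hM]; push_cast; ring⟩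
  set B : F[X] := (X ^ 2 + C 1) ^ n with hB
  have hX2 : (X ^ 2 + C 1 : F[X]).Monic := monic_X_pow_add_C (1:F) two_ne_zero
  have hBm : B.Monic := hX2.pow n
  have hBd : B.natDegree = 2 * n := by rw [hB, natDegree_pow, natDegree_X_pow_add_C, mul_comm]
  have hbt : B.eval t ≠ 0 := by
    rw [hB, eval_pow]
    apply pow_ne_zero
    intro h
    have := congrArg φ h
    simp at this
    nlinarith [sq_nonneg (φ t)]
  set P : F[X] := f.map (algebraMap ℚ F) * B ^ 2 with hP
  have hPd : P.natDegree = 2 * M := by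
    rw [hP, natDegree_mul ?_ (hBm.pow 2).ne_zero, natDegree_map, natDegree_pow, hBd, hm, hn]
    · ring
    · intro h; rw [Polynomial.map_eq_zero] at h; rw [h] at hc; simp at hc
  have hPlc : P.leadingCoeff = algebraMap ℚ F f.leadingCoeff := by
    rw [hP, leadingCoeff_mul_monic (hBm.pow 2), leadingCoeff_map]
  obtain ⟨G, hGo, hGb, hGs⟩ := adj_g hv _ g0 hodd hg (B.eval t) hbt (ε / 4) (by positivity)
  have hPt : P.eval t = f.eval₂ (algebraMap ℚ F) t * (B.eval t) ^ 2 := by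
    rw [hP, eval_mul, eval_map, eval_pow]
  rw [← hPt] at hGo hGb
  have hD0 : P.eval t - G ^ 2 ≠ 0 := by intro h; rw [h, od_zero] at hGo; simp at hGo
  obtain ⟨Cst, hC⟩ := exists_coeff_bound v (P.comp (X + C t))
  obtain ⟨S, hS0, hS⟩ := emb_bd t
  obtain ⟨k1, hk1⟩ := lc_E f.leadingCoeff
  obtain ⟨k2, hk2⟩ := exists_pow_small (f.leadingCoeff : ℝ) (by exact_mod_cast hc)
  obtain ⟨k3, hk3⟩ := exists_pow_small (ε / (4 * (2 * (1 + S)) ^ M)) (by positivity)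
  set v1 := od v (P.eval t - G ^ 2) with hv1
  obtain ⟨k, r, hkk, hr, hkr⟩ := choose_k M hMo.pos e he0 hMe v1 (hGo.sub_odd hv.2.1)
    (k1 + k2 + k3 + M * (Cst + v1.natAbs) + 1) (Cst + v1.natAbs + 1)
  generalize hX : M * (Cst + v1.natAbs) = Z at hkk
  have hk1' := hk1 k (by omega)
  have hk2' := hk2 k (by omega)
  have hk3' := hk3 k (by omega)
  have hkz : (Z : ℤ) + 1 ≤ k := by omega
  rw [← hX] at hkz
  push_cast at hkz hr
  refine pr_five_of_R4 F hv.1 f B (C G + C ((2:F)⁻¹ ^ k) * (X - C t) ^ M) hBm.ne_zero ?_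
  refine coreF hv P M hMo hPd f.leadingCoeff hPlc t G k ?_ hk1' hD0 hGb Cst hC hkz r hkr hr hMe hQM ?_
  · have : (((4:ℚ)⁻¹ ^ k : ℚ) : ℝ) < f.leadingCoeff := by push_cast; exact hk2'
    have : (4:ℚ)⁻¹ ^ k < f.leadingCoeff := by exact_mod_cast this
    linarith
  · intro σ x
    have hσ : σ.comp (algebraMap ℚ F) = algebraMap ℚ ℝ := Subsingleton.elim _ _
    have e1 : ((P - (C G + C ((2:F)⁻¹ ^ k) * (X - C t) ^ M) ^ 2).map σ).eval x =
        (f.map (algebraMap ℚ ℝ)).eval x * ((x ^ 2 + 1) ^ n) ^ 2 - (σ G + (2:ℝ)⁻¹ ^ k * (x - σ t) ^ M) ^ 2 := by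
      rw [hP, hB, Polynomial.map_sub, Polynomial.map_mul, Polynomial.map_map, hσ]
      have hσ2 : σ 2 = 2 := map_ofNat σ 2
      simp [hσ2]
    rw [e1]
    apply real_bd ε _ _ _ x (σ t) (2 * (1 + S)) M
    · have h3 := mul_le_mul_of_nonneg_right (hb x) (sq_nonneg ((x ^ 2 + 1) ^ n))
      refine le_trans (le_of_eq ?_) h3
      rw [hn]; ring
    · have := hGs σ; linarith
    · have := hS σ; linarith
    · rw [lt_div_iff₀ (by positivity)] at hk3'
      have e4 : ((2:ℝ)⁻¹ ^ k) ^ 2 = (4:ℝ)⁻¹ ^ k := by rw [← pow_mul, mul_comm, pow_mul]; norm_num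
      rw [e4]; linarith
end

section
open Polynomial
set_option linter.all false

theorem pr_main (n : ℕ) : ∀ f : ℚ[X], f.natDegree = n → (∀ t : ℝ, 0 < aeval t f) → ∃ g : Fin 5 → ℚ[X], f = ∑ i, g i ^ 2 := by
  induction n using Nat.strong_induction_on with
  | _ n ih =>
  intro f hn hpos
  have hf0 : f ≠ 0 := by
    rintro rfl
    have := hpos 0
    simp at this
  by_cases hsf : Squarefree f
  · have hfr : ∀ x, 0 < (f.map (algebraMap ℚ ℝ)).eval x := fun x => by rw [eval_map, ← aeval_def]; exact hpos x
    obtain ⟨m, hm⟩ := even_deg_real _ hfr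
    rw [natDegree_map, ← two_mul] at hm
    rcases Nat.eq_zero_or_pos m with rfl | hm0
    · rw [mul_zero] at hm
      obtain ⟨c, rfl⟩ := natDegree_eq_zero.1 hm
      have hc : 0 < c := by
        have := hpos 0
        rw [aeval_C] at this
        simpa using this
      obtain ⟨a, b, d, e, h⟩ := pr_rat_four c hc.le
      refine ⟨![C a, C b, C d, C e, 0], ?_⟩
      rw [Fin.sum_univ_five, h]
      simp
    · rcases Nat.even_or_odd m with he | ho
      · exact even_case f hpos m hm he hm0
      · exact odd_case f hpos hsf m hm ho
  · rw [Squarefree] at hsf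
    push Not at hsf
    obtain ⟨p, ⟨q, hq⟩, hp⟩ := hsf
    have hp0 : p ≠ 0 := by rintro rfl; rw [zero_mul, zero_mul] at hq; exact hf0 hq
    have hq0 : q ≠ 0 := by rintro rfl; rw [mul_zero] at hq; exact hf0 hq
    have hpd : p.natDegree ≠ 0 := by
      intro h
      obtain ⟨c, rfl⟩ := natDegree_eq_zero.1 h
      apply hp
      rw [isUnit_C]
      exact IsUnit.mk0 _ (by rintro rfl; exact hp0 C_0)
    have hd : f.natDegree = p.natDegree + p.natDegree + q.natDegree := by
      rw [hq, natDegree_mul (mul_ne_zero hp0 hp0) hq0, natDegree_mul hp0 hp0]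
    obtain ⟨g, hg⟩ := ih q.natDegree (by omega) q rfl (fun t => by
      have h1 := hpos t
      rw [hq, _root_.map_mul, _root_.map_mul] at h1
      exact (pos_iff_pos_of_mul_pos h1).1 (lt_of_le_of_ne (mul_self_nonneg _) (fun h => by rw [← h, zero_mul] at h1; exact lt_irrefl _ h1)))
    refine ⟨fun i => p * g i, ?_⟩
    simp only [mul_pow]
    rw [← Finset.mul_sum, ← hg, hq]; ring
end

open Polynomial

theorem pourchet_sum_of_five_squares (f : Polynomial ℚ)
    (hpos : ∀ t : ℝ, 0 < Polynomial.aeval t f) :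
    ∃ f₁ f₂ f₃ f₄ f₅ : Polynomial ℚ,
      f = f₁ ^ 2 + f₂ ^ 2 + f₃ ^ 2 + f₄ ^ 2 + f₅ ^ 2 := by
  obtain ⟨g, hg⟩ := pr_main f.natDegree f rfl hpos
  refine ⟨g 0, g 1, g 2, g 3, g 4, ?_⟩
  rw [Fin.sum_univ_five] at hg
  exact hg
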